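/- arXiv:2401.06770 — 5 statements merged into one kernel-verified Lean document; each statement's English description precedes it below -/
import Mathlib

section
/- For every c > 0 and α > −1 there exists a constant C < ∞ with the following property. Let (Ω, F, (F_k)_{k≥0}, P) be any filtered probability space and (S_k)_{k≥0} any nonnegative (F_k)-supermartingale which is absorbed at 0 (i.e. S_{k+1} = 0 a.s. on {S_k = 0}), satisfies the drift condition E[S_{k+1} − S_k | F_k] ≤ −c S_k^{−α} a.s. on the event {S_k > 0} for every k, and starts at S₀ = n a.s. for an integer n ≥ 1. Let τ := inf{k ≥ 0 : S_k = 0} be the absorption time. Then for every real x > 1, P(τ ≥ x n^{1+α}) ≤ C · x^{−1/(1+α)}. -/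
open MeasureTheory ProbabilityTheory Filter

/-- abstract Lyapunov-type estimate -/
lemma lyapunov_aux {Ω : Type} {inst : MeasurableSpace Ω} {P : Measure Ω}
    (hP : IsProbabilityMeasure P) {𝓕 : Filtration ℕ inst} {S : ℕ → Ω → ℝ} {c α : ℝ}
    (hc : 0 < c)
    (hS : Supermartingale S 𝓕 P)
    (hpos : ∀ k, ∀ᵐ ω ∂P, 0 ≤ S k ω)
    (habs : ∀ k, ∀ᵐ ω ∂P, S k ω = 0 → S (k + 1) ω = 0)
    (hdrift : ∀ k, ∀ᵐ ω ∂P, 0 < S k ω →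
          (P[fun ω' => S (k + 1) ω' - S k ω'|𝓕 k]) ω ≤ -c * S k ω ^ (-α))
    {n : ℕ} (h0 : ∀ᵐ ω ∂P, S 0 ω = n)
    (g φ : ℕ → ℝ → ℝ) (B : ℕ → ℝ)
    (hgm : ∀ k, Measurable (g k)) (hφm : ∀ k, Measurable (φ k))
    (hg0 : ∀ k y, 0 ≤ y → 0 ≤ g k y) (hφ0 : ∀ k s, 0 < s → 0 ≤ φ k s)
    (hφB : ∀ k s, 0 < s → c ≤ s ^ (1 + α) → φ k s ≤ B k)
    (hstep : ∀ k s y, 0 < s → 0 ≤ y →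
      g (k + 1) y ≤ g k s + φ k s * (y - s + c * s ^ (-α))) (K : ℕ) :
    Integrable (fun ω => if 0 < S K ω then g K (S K ω) else 0) P ∧
    ∫ ω, (if 0 < S K ω then g K (S K ω) else 0) ∂P ≤ g 0 n := by
  have hSm : ∀ k, Measurable[𝓕 k] (S k) := fun k => (hS.1 k).measurable
  have hSm' : ∀ k, Measurable (S k) := fun k => (hSm k).mono (𝓕.le k) le_rfl
  have hWm : ∀ k, Measurable (fun ω => if 0 < S k ω then g k (S k ω) else 0) := fun k =>
    Measurable.ite (measurableSet_lt measurable_const (hSm' k)) ((hgm k).comp (hSm' k))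
      measurable_const
  induction K with
  | zero =>
    have hle : ∀ᵐ ω ∂P, (if 0 < S 0 ω then g 0 (S 0 ω) else 0) =
        (if 0 < (n : ℝ) then g 0 n else 0) := by
      filter_upwards [h0] with ω h
      rw [h]
    refine ⟨(integrable_const _).congr (hle.mono fun ω h => h.symm), ?_⟩
    rw [integral_congr_ae hle]
    have := hg0 0 n (by positivity)
    simp only [integral_const, probReal_univ, one_smul]
    split_ifs <;> simp [this]
  | succ k ih =>
    obtain ⟨ihI, ihE⟩ := ih
    have hSi := hS.integrable k
    have hSi' := hS.integrable (k + 1)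
    set D : Ω → ℝ := fun ω' => S (k + 1) ω' - S k ω' with hD
    have hDi : Integrable D P := hSi'.sub hSi
    set G : Ω → ℝ := P[D|𝓕 k] with hG
    -- lower bound on positive values
    have hGge : ∀ᵐ ω ∂P, - S k ω ≤ G ω := by
      have h1 : P[fun ω => - S k ω | 𝓕 k] =ᵐ[P] fun ω => - S k ω := by
        exact (condExp_of_stronglyMeasurable (𝓕.le k) (hS.1 k).neg hSi.neg).eventuallyEq
      have h2 : P[fun ω => - S k ω | 𝓕 k] ≤ᵐ[P] G := by
        refine condExp_mono hSi.neg hDi ?_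
        filter_upwards [hpos (k+1)] with ω h
        simp only [hD]; linarith
      filter_upwards [h1, h2] with ω a b
      rw [← a]; exact b
    set Φ : Ω → ℝ := fun ω => if 0 < S k ω then φ k (S k ω) else 0 with hΦ
    have hΦm : Measurable[𝓕 k] Φ :=
      Measurable.ite (measurableSet_lt measurable_const (hSm k)) ((hφm k).comp (hSm k))
        measurable_const
    have hΦm' : Measurable Φ := hΦm.mono (𝓕.le k) le_rfl
    have hΦb : ∀ᵐ ω ∂P, ‖Φ ω‖ ≤ |B k| := by
      filter_upwards [hGge, hdrift k] with ω h1 h2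
      simp only [hΦ]
      split_ifs with hs
      · rw [Real.norm_of_nonneg (hφ0 k _ hs)]
        refine (hφB k _ hs ?_).trans (le_abs_self _)
        have h3 : c * S k ω ^ (-α) ≤ S k ω := by have := h2 hs; linarith
        have h4 := mul_le_mul_of_nonneg_right h3 (Real.rpow_nonneg hs.le α)
        rw [mul_assoc, ← Real.rpow_add hs, neg_add_cancel, Real.rpow_zero, mul_one] at h4
        rwa [Real.rpow_add hs, Real.rpow_one]
      · simp
    have hΦD : Integrable (fun ω => Φ ω * D ω) P :=
      hDi.bdd_mul hΦm'.aestronglyMeasurable hΦb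
    have hΦG : Integrable (fun ω => Φ ω * G ω) P :=
      integrable_condExp.bdd_mul hΦm'.aestronglyMeasurable hΦb
    have hint : ∫ ω, Φ ω * D ω ∂P = ∫ ω, Φ ω * G ω ∂P := by
      have h1 : P[fun ω => Φ ω * D ω|𝓕 k] =ᵐ[P] fun ω => Φ ω * G ω :=
        condExp_mul_of_stronglyMeasurable_left hΦm.stronglyMeasurable hΦD hDi
      rw [← integral_condExp (𝓕.le k), integral_congr_ae h1]
    have hΦ0 : ∀ ω, 0 ≤ Φ ω := by
      intro ω
      simp only [hΦ]
      split_ifs with hs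
      · exact hφ0 k _ hs
      · exact le_rfl
    set R : Ω → ℝ := fun ω => (if 0 < S k ω then g k (S k ω) else 0) + (Φ ω * D ω - Φ ω * G ω)
      with hR
    have hRi : Integrable R P := ihI.add (hΦD.sub hΦG)
    have hle : ∀ᵐ ω ∂P, (if 0 < S (k+1) ω then g (k+1) (S (k+1) ω) else 0) ≤ R ω := by
      filter_upwards [hpos k, hpos (k+1), habs k, hdrift k] with ω p1 p2 a d
      simp only [hR, hΦ]
      by_cases hs : 0 < S k ω
      · have h1 := hstep k _ _ hs p2
        have h2 := hg0 (k+1) _ p2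
        have h3 := mul_le_mul_of_nonneg_left (d hs) (hφ0 k _ hs)
        simp only [hs, if_true]
        have h4 : (if 0 < S (k+1) ω then g (k+1) (S (k+1) ω) else 0) ≤ g (k+1) (S (k+1) ω) := by
          split_ifs <;> simp [h2]
        have h5 : φ k (S k ω) * D ω = φ k (S k ω) * (S (k+1) ω - S k ω) := rfl
        nlinarith
      · have : S k ω = 0 := le_antisymm (not_lt.1 hs) p1
        simp [hs, a this]
    have h0W : ∀ᵐ ω ∂P, 0 ≤ (if 0 < S (k+1) ω then g (k+1) (S (k+1) ω) else 0) := by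
      filter_upwards with ω
      split_ifs with hs
      · exact hg0 _ _ hs.le
      · exact le_rfl
    have hI : Integrable (fun ω => if 0 < S (k+1) ω then g (k+1) (S (k+1) ω) else 0) P := by
      refine hRi.mono' (hWm _).aestronglyMeasurable ?_
      filter_upwards [hle, h0W] with ω a b
      rwa [Real.norm_of_nonneg b]
    refine ⟨hI, (integral_mono_ae hI hRi hle).trans ?_⟩
    have : ∫ ω, R ω ∂P = ∫ ω, (if 0 < S k ω then g k (S k ω) else 0) ∂P +
        (∫ ω, Φ ω * D ω ∂P - ∫ ω, Φ ω * G ω ∂P) := by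
      rw [← integral_sub hΦD hΦG]
      exact integral_add ihI (hΦD.sub hΦG)
    rw [this, hint]; linarith

/-- concavity step, `β = 1 + α ≤ 1` -/
lemma step_aux {c β A s y : ℝ} (hc : 0 < c) (hβ : 0 < β) (hβ1 : β ≤ 1) (hA : 0 ≤ A)
    (hs : 0 < s) (hy : 0 ≤ y) :
    (y ^ β + (A + c * β)) ^ (1 / β) ≤ (s ^ β + A) ^ (1 / β) +
      (1 + (A + c * β) / s ^ β) ^ (1 / β - 1) * (y - s + c * s ^ (-(β - 1))) := by
  have hcb : 0 < c * β := by positivity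
  obtain ⟨A', hA'⟩ : ∃ A', A' = A + c * β := ⟨_, rfl⟩
  have hA'0 : 0 < A' := by linarith
  have hsb : 0 < s ^ β := by positivity
  have hp : 1 ≤ 1 / β := by rw [le_div_iff₀ hβ]; linarith
  have hp0 : 0 < 1 / β := by positivity
  -- normalised: Z = Y / s^β
  obtain ⟨Z, hZ⟩ : ∃ Z, Z = 1 + A' / s ^ β := ⟨_, rfl⟩
  have hZ0 : 0 < Z := by rw [hZ]; positivity
  have hY : s ^ β + A' = s ^ β * Z := by rw [hZ]; field_simp
  have hsp : (s ^ β) ^ (1 / β) = s := by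
    rw [← Real.rpow_mul hs.le, mul_one_div_cancel hβ.ne', Real.rpow_one]
  have hZp : Z ^ (1 / β) = Z * Z ^ (1 / β - 1) := by
    rw [Real.rpow_sub_one hZ0.ne']; field_simp
  have hs1 : s ^ (-(β - 1)) = s / s ^ β := by
    rw [show -(β - 1) = 1 - β by ring, Real.rpow_sub hs, Real.rpow_one]
  have hQ : 0 < Z ^ (1 / β - 1) := by positivity
  rw [← hA', ← hZ, hs1]
  -- concavity
  have h1 : (y ^ β + A') ^ (1 / β) ≤ Z ^ (1 / β - 1) * (y + s * (A' / s ^ β)) := by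
    have hm1 : y / s ∈ Set.Ici (0 : ℝ) := Set.mem_Ici.2 (by positivity)
    have hm2 : (1 : ℝ) ∈ Set.Ici (0 : ℝ) := Set.mem_Ici.2 zero_le_one
    have hw1 : 0 ≤ 1 / Z := by positivity
    have hw2 : 0 ≤ A' / s ^ β / Z := by positivity
    have hw : 1 / Z + A' / s ^ β / Z = 1 := by rw [← add_div, ← hZ, div_self hZ0.ne']
    have hconc := (Real.concaveOn_rpow hβ.le hβ1).2 hm1 hm2 hw1 hw2 hw
    simp only [smul_eq_mul, Real.one_rpow, mul_one, Real.div_rpow hy hs.le] at hconc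
    have e1 : y ^ β + A' = (s ^ β * Z) * (1 / Z * (y ^ β / s ^ β) + A' / s ^ β / Z) := by
      field_simp
    have e2 : (y ^ β + A') ≤ (s ^ β * Z) * (1 / Z * (y / s) + A' / s ^ β / Z) ^ β := by
      rw [e1]; gcongr
    have hu : 0 ≤ 1 / Z * (y / s) + A' / s ^ β / Z := by positivity
    calc (y ^ β + A') ^ (1 / β) ≤
        ((s ^ β * Z) * (1 / Z * (y / s) + A' / s ^ β / Z) ^ β) ^ (1 / β) := by
          apply Real.rpow_le_rpow (by positivity) e2 hp0.le
      _ = s * Z ^ (1 / β) * (1 / Z * (y / s) + A' / s ^ β / Z) := by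
          rw [Real.mul_rpow (by positivity) (by positivity), Real.mul_rpow hsb.le hZ0.le, hsp,
            ← Real.rpow_mul hu, mul_one_div_cancel hβ.ne', Real.rpow_one]
      _ = _ := by
          rw [hZp]; field_simp
  -- Bernoulli
  have h2 : s * Z ^ (1 / β) - Z ^ (1 / β - 1) * (c * (s / s ^ β)) ≤ (s ^ β + A) ^ (1 / β) := by
    have e : s ^ β + A = s ^ β * (Z * (1 + -(c * β / (s ^ β * Z)))) := by
      have : s ^ β + A = s ^ β * Z - c * β := by rw [← hY, hA']; ring
      rw [this]; field_simp; ring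
    have hge : -1 ≤ -(c * β / (s ^ β * Z)) := by
      rw [neg_le_neg_iff, div_le_one (by positivity), ← hY, hA']; linarith
    have hb := one_add_mul_self_le_rpow_one_add hge hp
    rw [e, Real.mul_rpow hsb.le (mul_nonneg hZ0.le (by linarith)), Real.mul_rpow hZ0.le (by linarith), hsp]
    calc _ = s * (Z ^ (1 / β) * (1 + 1 / β * -(c * β / (s ^ β * Z)))) := by
          rw [hZp]; field_simp; try ring
      _ ≤ _ := by gcongr
  have h3 : Z ^ (1 / β - 1) * (y + s * (A' / s ^ β)) =
      s * Z ^ (1 / β) + Z ^ (1 / β - 1) * (y - s) := by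
    rw [hZp, show A' / s ^ β = Z - 1 by rw [hZ]; ring]; ring
  rw [mul_add]
  linarith

lemma final_aux {Ω : Type} {inst : MeasurableSpace Ω} {P : Measure Ω}
    (hP : IsProbabilityMeasure P) {S : Ω → ℝ} (hS : Measurable S) (hpos : ∀ᵐ ω ∂P, 0 ≤ S ω)
    {g : ℝ → ℝ} {m N : ℝ} (hg : ∀ s, 0 < s → m ≤ g s)
    (hI : Integrable (fun ω => if 0 < S ω then g (S ω) else 0) P)
    (hle : ∫ ω, (if 0 < S ω then g (S ω) else 0) ∂P ≤ N) :
    m * (P {ω | S ω ≠ 0}).toReal ≤ N := by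
  have hms : MeasurableSet {ω | S ω ≠ 0} := (hS (measurableSet_singleton 0)).compl
  have : ∫ ω, Set.indicator {ω | S ω ≠ 0} (fun _ => m) ω ∂P = m * (P {ω | S ω ≠ 0}).toReal := by
    rw [integral_indicator_const _ hms, smul_eq_mul, mul_comm]; rfl
  rw [← this]
  refine (integral_mono_ae ((integrable_const m).indicator hms) hI ?_).trans hle
  filter_upwards [hpos] with ω h
  by_cases hs : S ω = 0
  · simp [hs]
  · have : 0 < S ω := lt_of_le_of_ne h (Ne.symm hs)
    simp [hs, this, hg _ this]

/-- uniform tail bound for the absorption time of a nonnegative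
supermartingale with drift `E[S_{k+1}-S_k | F_k] ≤ -c S_k^{-α}` on `{S_k > 0}`:
there is a constant `C = C(c,α)` such that for every such process started at `n ≥ 1`
and every `x > 1`, `P(τ ≥ x n^{1+α}) ≤ C x^{-1/(1+α)}`. -/
theorem supermartingale_absorption_time_tail :
    ∀ c α : ℝ, 0 < c → -1 < α →
    ∃ C : ℝ, ∀ (Ω : Type) (inst : MeasurableSpace Ω) (P : Measure Ω),
      IsProbabilityMeasure P →
      ∀ (𝓕 : Filtration ℕ inst) (S : ℕ → Ω → ℝ),
        Supermartingale S 𝓕 P →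
        -- nonnegativity
        (∀ k, ∀ᵐ ω ∂P, 0 ≤ S k ω) →
        -- absorption at 0
        (∀ k, ∀ᵐ ω ∂P, S k ω = 0 → S (k + 1) ω = 0) →
        -- drift condition on `{S_k > 0}`
        (∀ k, ∀ᵐ ω ∂P, 0 < S k ω →
          (P[fun ω' => S (k + 1) ω' - S k ω'|𝓕 k]) ω ≤ -c * S k ω ^ (-α)) →
        ∀ n : ℕ, 1 ≤ n → (∀ᵐ ω ∂P, S 0 ω = n) →
        ∀ x : ℝ, 1 < x →
          -- `τ ≥ x n^{1+α}` means that `S` does not vanish before time `x n^{1+α}`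
          (P {ω | ∀ k : ℕ, (k : ℝ) < x * (n : ℝ) ^ (1 + α) → S k ω ≠ 0}).toReal ≤
            C * x ^ (-(1 / (1 + α))) := by
  intro c α hc hα
  have hβ : 0 < 1 + α := by linarith
  -- main estimate
  suffices H : ∃ m0 : ℝ, 0 < m0 ∧ ∀ (Ω : Type) (inst : MeasurableSpace Ω) (P : Measure Ω),
      IsProbabilityMeasure P →
      ∀ (𝓕 : Filtration ℕ inst) (S : ℕ → Ω → ℝ),
        Supermartingale S 𝓕 P →
        (∀ k, ∀ᵐ ω ∂P, 0 ≤ S k ω) →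
        (∀ k, ∀ᵐ ω ∂P, S k ω = 0 → S (k + 1) ω = 0) →
        (∀ k, ∀ᵐ ω ∂P, 0 < S k ω →
          (P[fun ω' => S (k + 1) ω' - S k ω'|𝓕 k]) ω ≤ -c * S k ω ^ (-α)) →
        ∀ n : ℕ, 1 ≤ n → (∀ᵐ ω ∂P, S 0 ω = n) →
        ∀ T : ℝ, 1 < T → ∀ K : ℕ, T / 2 ≤ K →
          m0 * T ^ (1 / (1 + α)) * (P {ω | S K ω ≠ 0}).toReal ≤ n by
    obtain ⟨m0, hm0, H⟩ := H
    refine ⟨1 / m0, ?_⟩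
    intro Ω inst P hP 𝓕 S hS hpos habs hdrift n hn h0 x hx
    have hn' : (1 : ℝ) ≤ n := by exact_mod_cast hn
    have hnp : (0 : ℝ) < n := by linarith
    have hx0 : 0 < x := by linarith
    set T := x * (n : ℝ) ^ (1 + α) with hT
    have hT1 : 1 < T := by
      have : 1 ≤ (n : ℝ) ^ (1 + α) := Real.one_le_rpow hn' hβ.le
      nlinarith
    obtain ⟨K, hK1, hK2⟩ : ∃ K : ℕ, (K : ℝ) < T ∧ T / 2 ≤ K := by
      have h1 : 1 < ⌈T⌉₊ := by rw [Nat.lt_ceil]; exact_mod_cast hT1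
      refine ⟨⌈T⌉₊ - 1, ?_, ?_⟩
      · rw [← Nat.lt_ceil]; omega
      · have h2 := Nat.le_ceil T
        have h3 : (2 : ℝ) ≤ (⌈T⌉₊ : ℝ) := by exact_mod_cast h1
        rw [Nat.cast_sub h1.le]
        push_cast
        linarith
    have h := H Ω inst P hP 𝓕 S hS hpos habs hdrift n hn h0 T hT1 K hK2
    have hTp : T ^ (1 / (1 + α)) = x ^ (1 / (1 + α)) * n := by
      rw [hT, Real.mul_rpow hx0.le (by positivity), ← Real.rpow_mul hnp.le,
        mul_one_div_cancel hβ.ne', Real.rpow_one]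
    have hmono : (P {ω | ∀ k : ℕ, (k : ℝ) < T → S k ω ≠ 0}).toReal ≤
        (P {ω | S K ω ≠ 0}).toReal := by
      refine ENNReal.toReal_mono (measure_ne_top _ _) (measure_mono ?_)
      intro ω hω
      exact hω K hK1
    refine hmono.trans ?_
    have hxp : 0 < x ^ (1 / (1 + α)) := by positivity
    rw [Real.rpow_neg hx0.le, one_div m0, ← mul_inv, ← one_div, le_div_iff₀ (by positivity)]
    rw [hTp] at h
    refine le_of_mul_le_mul_right ?_ hnp
    linarith
  rcases le_or_gt 0 α with ha | ha
  · refine ⟨min 1 (c / 2), by positivity, ?_⟩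
    intro Ω inst P hP 𝓕 S hS hpos habs hdrift n hn h0 T hT K hK
    have hT0 : 0 < T := by linarith
    set M := T ^ (1 / (1 + α)) with hM
    have hM0 : 0 < M := by positivity
    have hMT : M ^ (-α) * T = M := by
      have : T = M ^ (1 + α) := by
        rw [hM, ← Real.rpow_mul hT0.le, one_div_mul_cancel hβ.ne', Real.rpow_one]
      rw [this, ← Real.rpow_add hM0]; simp
    have hMa : 0 < M ^ (-α) := by positivity
    obtain ⟨h1, h2⟩ := lyapunov_aux hP hc hS hpos habs hdrift h0
      (fun k s => min M (s + c * M ^ (-α) * k))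
      (fun k s => if s + c * M ^ (-α) * k < M then 1 else 0) (fun _ => 1)
      (fun k => by fun_prop)
      (fun k => Measurable.ite (measurableSet_lt (by fun_prop) measurable_const)
        measurable_const measurable_const)
      (fun k y hy => by positivity)
      (fun k s _ => by split_ifs <;> norm_num)
      (fun k s _ _ => by split_ifs <;> norm_num)
      (by
        intro k s y hs hy
        split_ifs with h
        · have hk : 0 ≤ c * M ^ (-α) * k := by positivity
          have : M ^ (-α) ≤ s ^ (-α) :=
            Real.rpow_le_rpow_of_nonpos hs (by linarith) (by linarith)
          have := mul_le_mul_of_nonneg_left this hc.le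
          rw [min_eq_right h.le]
          refine (min_le_right _ _).trans ?_
          push_cast
          linarith
        · rw [min_eq_left (not_lt.1 h)]
          simp) K
    refine final_aux hP ((hS.1 K).measurable.mono (𝓕.le K) le_rfl) (hpos K)
      (g := fun s => min M (s + c * M ^ (-α) * K)) ?_ h1 (h2.trans ?_)
    · intro s hs
      refine le_min ?_ ?_
      · have := mul_le_mul_of_nonneg_right (min_le_left 1 (c/2)) hM0.le
        linarith
      · have := mul_le_mul_of_nonneg_right (min_le_right 1 (c/2)) hM0.le
        have h3 : c * M ^ (-α) * (T / 2) ≤ c * M ^ (-α) * K := by gcongr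
        have h4 : c * M ^ (-α) * (T / 2) = c / 2 * M := by
          linear_combination (c/2) * hMT
        linarith
    · simp
  · have hcb : 0 < c * (1 + α) := by positivity
    refine ⟨(c * (1 + α) / 2) ^ (1 / (1 + α)), by positivity, ?_⟩
    intro Ω inst P hP 𝓕 S hS hpos habs hdrift n hn h0 T hT K hK
    have hT0 : 0 < T := by linarith
    have hp : 0 ≤ 1 / (1 + α) - 1 := by
      rw [sub_nonneg, le_div_iff₀ hβ]; linarith
    obtain ⟨h1, h2⟩ := lyapunov_aux hP hc hS hpos habs hdrift h0
      (fun k s => (s ^ (1 + α) + c * (1 + α) * k) ^ (1 / (1 + α)))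
      (fun k s => (1 + (c * (1 + α) * k + c * (1 + α)) / s ^ (1 + α)) ^ (1 / (1 + α) - 1))
      (fun k => (1 + (c * (1 + α) * k + c * (1 + α)) / c) ^ (1 / (1 + α) - 1))
      (fun k => by fun_prop)
      (fun k => by fun_prop)
      (fun k y hy => by positivity)
      (fun k s _ => by positivity)
      (fun k s hs hcs => by
        gcongr)
      (by
        intro k s y hs hy
        have := step_aux (c := c) (β := 1 + α) (A := c * (1 + α) * k) (s := s) (y := y) hc hβ
          (by linarith) (by positivity) hs hy
        rw [show -(1 + α - 1) = -α by ring] at this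
        rw [show c * (1 + α) * ((k + 1 : ℕ) : ℝ) = c * (1 + α) * k + c * (1 + α) by
          push_cast; ring]
        exact this) K
    refine final_aux hP ((hS.1 K).measurable.mono (𝓕.le K) le_rfl) (hpos K)
      (g := fun s => (s ^ (1 + α) + c * (1 + α) * K) ^ (1 / (1 + α))) ?_ h1 (h2.trans ?_)
    · intro s hs
      rw [← Real.mul_rpow (by positivity) hT0.le]
      refine Real.rpow_le_rpow (by positivity) ?_ (by positivity)
      have h3 : c * (1 + α) * (T / 2) ≤ c * (1 + α) * K := by gcongr
      have h4 : 0 < s ^ (1 + α) := by positivity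
      linarith
    · rw [Nat.cast_zero, mul_zero, add_zero, ← Real.rpow_mul (by positivity),
        mul_one_div_cancel hβ.ne', Real.rpow_one]
end

section
/- Under the stated hypotheses on the kernel κ: (a) for every a ∈ ℕ, ∫ √m κ(a,dm) ≤ √a (so that the square root of the chain is a supermartingale), and (b) there exists a constant c > 0 such that for every integer n ≥ 1, ∫ √m κ(n,dm) ≤ √n − c/√n. -/
open MeasureTheory ProbabilityTheory Filter

/-- for a critical Markov kernel on `ℕ` satisfying the martingale
property, a one-step variance lower bound, variance asymptotics `~ σ² n` and a
one-step CLT, the square root is a supermartingale function: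
(a) `∫ √m κ(a,dm) ≤ √a` for all `a`, and
(b) there is `c > 0` with `∫ √m κ(n,dm) ≤ √n - c/√n` for all `n ≥ 1`. -/
theorem sqrt_supermartingale_of_kernel
    (σ : ℝ) (hσ : 0 < σ) (κ : Kernel ℕ ℕ) [IsMarkovKernel κ]
    -- finite second moments
    (hmom : ∀ n : ℕ, Integrable (fun m : ℕ => (m : ℝ) ^ 2) (κ n))
    -- martingale property
    (hmart : ∀ a : ℕ, ∫ m, (m : ℝ) ∂(κ a) = a)
    -- variance lower bound
    (hlb : ∃ s : ℝ, 0 < s ∧ ∀ n : ℕ, 1 ≤ n → s ≤ ∫ m, ((m : ℝ) - n) ^ 2 ∂(κ n))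
    -- variance asymptotics
    (hvar : Tendsto (fun n : ℕ => (∫ m, ((m : ℝ) - n) ^ 2 ∂(κ n)) / n) atTop
      (nhds (σ ^ 2)))
    -- one-step CLT
    (hclt : ∀ f : BoundedContinuousFunction ℝ ℝ,
      Tendsto (fun n : ℕ => ∫ m, f (((m : ℝ) - n) / Real.sqrt n) ∂(κ n)) atTop
        (nhds (∫ x, f x ∂(gaussianReal 0 (Real.toNNReal (σ ^ 2)))))) :
    (∀ a : ℕ, ∫ m, Real.sqrt m ∂(κ a) ≤ Real.sqrt a) ∧
    ∃ c : ℝ, 0 < c ∧ ∀ n : ℕ, 1 ≤ n →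
      ∫ m, Real.sqrt m ∂(κ n) ≤ Real.sqrt n - c / Real.sqrt n := by
  have hi1 : ∀ n : ℕ, Integrable (fun m : ℕ => (m : ℝ)) (κ n) := by
    intro n
    refine (hmom n).mono' (by fun_prop) (Eventually.of_forall fun m => ?_)
    rw [Real.norm_of_nonneg (by positivity)]
    exact_mod_cast Nat.le_self_pow (by norm_num) m
  have hsqle : ∀ m : ℕ, Real.sqrt m ≤ m := by
    intro m
    rw [Real.sqrt_le_left (by positivity)]
    exact_mod_cast Nat.le_self_pow (by norm_num) m
  have hi2 : ∀ n : ℕ, Integrable (fun m : ℕ => Real.sqrt m) (κ n) := by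
    intro n
    refine (hi1 n).mono' (by fun_prop) (Eventually.of_forall fun m => ?_)
    rw [Real.norm_of_nonneg (by positivity)]
    exact hsqle m
  have hexp : ∀ m n : ℕ, (Real.sqrt m - Real.sqrt n) ^ 2
      = (m : ℝ) + n - 2 * Real.sqrt n * Real.sqrt m := by
    intro m n
    have h1 := Real.sq_sqrt (Nat.cast_nonneg (α := ℝ) m)
    have h2 := Real.sq_sqrt (Nat.cast_nonneg (α := ℝ) n)
    linear_combination h1 + h2
  have hi3 : ∀ n : ℕ, Integrable (fun m : ℕ => (Real.sqrt m - Real.sqrt n) ^ 2) (κ n) := by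
    intro n
    simp_rw [hexp]
    exact ((hi1 n).add (integrable_const _)).sub ((hi2 n).const_mul _)
  have hint : ∀ n : ℕ, ∫ m, (Real.sqrt m - Real.sqrt n) ^ 2 ∂(κ n)
      = 2 * n - 2 * Real.sqrt n * ∫ m, Real.sqrt m ∂(κ n) := by
    intro n
    simp_rw [hexp]
    have hs : Integrable (fun m : ℕ => (m : ℝ) + n) (κ n) := (hi1 n).add (integrable_const _)
    rw [integral_sub hs ((hi2 n).const_mul _),
      integral_add (hi1 n) (integrable_const _), integral_const_mul, hmart]
    simp
    ring
  have key : ∀ n : ℕ, 1 ≤ n → ∀ c : ℝ,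
      2 * c ≤ ∫ m, (Real.sqrt m - Real.sqrt n) ^ 2 ∂(κ n) →
      ∫ m, Real.sqrt m ∂(κ n) ≤ Real.sqrt n - c / Real.sqrt n := by
    intro n hn c hc
    have hp : 0 < Real.sqrt n := Real.sqrt_pos.2 (by exact_mod_cast hn)
    have h2 := Real.sq_sqrt (Nat.cast_nonneg (α := ℝ) n)
    rw [hint] at hc
    have : c / Real.sqrt n ≤ Real.sqrt n - ∫ m, Real.sqrt m ∂(κ n) := by
      rw [div_le_iff₀ hp]
      nlinarith
    linarith
  constructor
  · intro a
    rcases Nat.eq_zero_or_pos a with h0 | hpos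
    · subst h0
      calc ∫ m, Real.sqrt m ∂(κ 0) ≤ ∫ m, (m : ℝ) ∂(κ 0) :=
            integral_mono (hi2 0) (hi1 0) (fun m => hsqle m)
        _ = Real.sqrt (0 : ℕ) := by rw [hmart]; simp
    · have := key a hpos 0 (by
        rw [mul_zero]
        exact integral_nonneg fun m => sq_nonneg _)
      simpa using this
  -- pointwise positivity
  have hpos : ∀ n : ℕ, 1 ≤ n → 0 < ∫ m, (Real.sqrt m - Real.sqrt n) ^ 2 ∂(κ n) := by
    intro n hn
    refine lt_of_le_of_ne (integral_nonneg fun m => sq_nonneg _) fun h => ?_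
    have h' := (integral_eq_zero_iff_of_nonneg (fun m => sq_nonneg _) (hi3 n)).1 h.symm
    obtain ⟨s, hs, hs'⟩ := hlb
    have : ∫ m, ((m : ℝ) - n) ^ 2 ∂(κ n) = 0 := by
      refine integral_eq_zero_of_ae ?_
      filter_upwards [h'] with m hm
      have h1 : Real.sqrt m = Real.sqrt n := by
        have : (Real.sqrt m - Real.sqrt n) ^ 2 = 0 := hm
        linarith [pow_eq_zero_iff (two_ne_zero) |>.1 this]
      rw [Real.sqrt_inj (by positivity) (by positivity)] at h1
      simp [h1]
    have := hs' n hn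
    linarith
  -- limiting lower bound
  let f : BoundedContinuousFunction ℝ ℝ :=
    BoundedContinuousFunction.ofNormedAddCommGroup (fun x : ℝ => min (x ^ 2) 1 / 9)
      (by fun_prop) 1 (by
        intro x
        have : 0 ≤ min (x ^ 2) 1 := by positivity
        have h2 := min_le_right (x ^ 2) (1 : ℝ)
        rw [Real.norm_of_nonneg (by positivity)]
        linarith)
  have hf : ∀ x, f x = min (x ^ 2) 1 / 9 := fun x => rfl
  have hL : 0 < ∫ x, f x ∂(gaussianReal 0 (Real.toNNReal (σ ^ 2))) := by
    have hv : Real.toNNReal (σ ^ 2) ≠ 0 := by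
      simp only [ne_eq, Real.toNNReal_eq_zero, not_le]
      positivity
    haveI := noAtoms_gaussianReal (μ := 0) hv
    rw [integral_pos_iff_support_of_nonneg (fun x => by rw [hf]; simp only [Pi.zero_apply]; positivity)
      (f.integrable _)]
    have : Function.support f = {0}ᶜ := by
      ext x
      simp only [Function.mem_support, hf, Set.mem_compl_iff, Set.mem_singleton_iff]
      constructor
      · rintro h rfl
        simp at h
      · intro h
        have : 0 < min (x ^ 2) 1 := by positivity
        positivity
    rw [this, prob_compl_eq_one_sub (measurableSet_singleton 0)]
    simp
  have hev := (hclt f).eventually (lt_mem_nhds (half_lt_self hL))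
  obtain ⟨N, hN⟩ := eventually_atTop.1 hev
  set L := ∫ x, f x ∂(gaussianReal 0 (Real.toNNReal (σ ^ 2))) with hLdef
  have hlarge : ∀ n : ℕ, 1 ≤ n → N ≤ n →
      L / 2 ≤ ∫ m, (Real.sqrt m - Real.sqrt n) ^ 2 ∂(κ n) := by
    intro n hn hnN
    refine (hN n hnN).le.trans ?_
    refine integral_mono_of_nonneg (Eventually.of_forall fun m => ?_) (hi3 n)
      (Eventually.of_forall fun m => ?_)
    · simp only [hf, Pi.zero_apply]
      positivity
    · simp only [hf]
      have h1 := Real.sq_sqrt (Nat.cast_nonneg (α := ℝ) m)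
      have h2 := Real.sq_sqrt (Nat.cast_nonneg (α := ℝ) n)
      have hb : 1 ≤ Real.sqrt n := Real.one_le_sqrt.2 (by exact_mod_cast hn)
      have ha : 0 ≤ Real.sqrt m := Real.sqrt_nonneg _
      generalize Real.sqrt m = a at *
      generalize Real.sqrt n = b at *
      rw [← h1, ← h2]
      rcases le_total a (2 * b) with hab | hab
      · have h3 : ((a ^ 2 - b ^ 2) / b) ^ 2 ≤ 9 * (a - b) ^ 2 := by
          rw [div_pow, div_le_iff₀ (by positivity)]
          have : (a + b) ^ 2 ≤ 9 * b ^ 2 := by nlinarith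
          nlinarith [mul_le_mul_of_nonneg_left this (sq_nonneg (a - b))]
        have := min_le_left (((a ^ 2 - b ^ 2) / b) ^ 2) 1
        linarith
      · have := min_le_right (((a ^ 2 - b ^ 2) / b) ^ 2) 1
        nlinarith
  have hsmall : ∀ M : ℕ, ∃ c : ℝ, 0 < c ∧ ∀ n : ℕ, 1 ≤ n → n < M →
      c ≤ ∫ m, (Real.sqrt m - Real.sqrt n) ^ 2 ∂(κ n) := by
    intro M
    induction M with
    | zero => exact ⟨1, one_pos, fun n _ h => absurd h (by omega)⟩
    | succ M ih =>
      obtain ⟨c, hc, h⟩ := ih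
      rcases Nat.eq_zero_or_pos M with h0 | h0
      · exact ⟨1, one_pos, fun n _ h => absurd h (by omega)⟩
      · refine ⟨min c _, lt_min hc (hpos M h0), fun n hn hnM => ?_⟩
        rcases Nat.lt_succ_iff_lt_or_eq.1 hnM with h1 | h1
        · exact (min_le_left _ _).trans (h n hn h1)
        · subst h1
          exact min_le_right _ _
  obtain ⟨c, hc, h⟩ := hsmall N
  refine ⟨min c (L / 2) / 2, by positivity, fun n hn => key n hn _ ?_⟩
  rw [mul_div_cancel₀ _ two_ne_zero]
  rcases lt_or_ge n N with h1 | h1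
  · exact (min_le_left _ _).trans (h n hn h1)
  · exact (min_le_right _ _).trans (hlarge n hn h1)
end

section
/- Under the stated hypotheses on the kernel κ, there exists a bounded function δ : (0,∞) → [0,∞) with δ(t) → 0 as t → ∞, such that for every n ≥ 1 and every real k > 0, the one-step upward jump satisfies κ(n, {m : m − n ≥ k}) ≤ (n/k²) · δ(k²/n). -/
open MeasureTheory ProbabilityTheory Filter


/-- normalised squared jump -/
noncomputable def sqJump (n m : ℕ) : ℝ := ((m : ℝ) - n) ^ 2 / n

/-- truncated second moment -/
noncomputable def truncMom (κ : Kernel ℕ ℕ) (n : ℕ) (t : ℝ) : ℝ :=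
  ∫ m, Set.indicator {m : ℕ | t ≤ sqJump n m} (sqJump n) m ∂(κ n)

lemma sqJump_nonneg (n m : ℕ) : 0 ≤ sqJump n m := by unfold sqJump; positivity

lemma sqJump_integrable (κ : Kernel ℕ ℕ) [IsMarkovKernel κ]
    (hmom : ∀ n : ℕ, Integrable (fun m : ℕ => (m : ℝ) ^ 2) (κ n)) (n : ℕ) :
    Integrable (sqJump n) (κ n) := by
  have h : Integrable (fun m : ℕ => (2 * (m : ℝ) ^ 2 + 2 * (n : ℝ) ^ 2)) (κ n) :=
    ((hmom n).const_mul 2).add (integrable_const _)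
  have h2 : Integrable (fun m : ℕ => ((m : ℝ) - n) ^ 2) (κ n) := by
    refine h.mono' (Measurable.of_discrete).aestronglyMeasurable (ae_of_all _ fun m => ?_)
    rw [Real.norm_of_nonneg (by positivity)]
    nlinarith [sq_nonneg ((m : ℝ) + n)]
  exact h2.div_const _

lemma gauss_trunc (σ : ℝ) :
    Tendsto (fun M : ℕ => ∫ x, min (x ^ 2) (M : ℝ) ∂(gaussianReal 0 (Real.toNNReal (σ ^ 2))))
      atTop (nhds (σ ^ 2)) := by
  set μ := gaussianReal 0 (Real.toNNReal (σ ^ 2)) with hμ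
  have hL : MemLp id 2 μ := memLp_id_gaussianReal 2
  have hi : Integrable (fun x : ℝ => x ^ 2) μ := hL.integrable_sq
  have hv : ∫ x, x ^ 2 ∂μ = σ ^ 2 := by
    have h1 : variance id μ = Real.toNNReal (σ ^ 2) := variance_id_gaussianReal
    rw [variance_eq_integral measurable_id.aemeasurable] at h1
    have h2 : ∫ x, id x ∂μ = 0 := by
      simp only [id]
      exact integral_id_gaussianReal
    rw [h2] at h1
    simpa [Real.coe_toNNReal _ (sq_nonneg σ), sq_nonneg σ] using h1
  rw [← hv]
  refine tendsto_integral_of_dominated_convergence (fun x => x ^ 2) ?_ hi ?_ ?_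
  · intro M
    exact (by fun_prop : Continuous fun x : ℝ => min (x ^ 2) (M : ℝ)).aestronglyMeasurable
  · intro M
    refine ae_of_all _ fun x => ?_
    rw [Real.norm_of_nonneg (le_min (sq_nonneg x) (Nat.cast_nonneg M))]
    exact min_le_left _ _
  · refine ae_of_all _ fun x => ?_
    refine tendsto_const_nhds.congr' ?_
    filter_upwards [tendsto_natCast_atTop_atTop.eventually_ge_atTop (x ^ 2)] with M hM
    exact (min_eq_left hM).symm

lemma truncMom_integrable (κ : Kernel ℕ ℕ) [IsMarkovKernel κ]
    (hmom : ∀ n : ℕ, Integrable (fun m : ℕ => (m : ℝ) ^ 2) (κ n)) (n : ℕ) (t : ℝ) :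
    Integrable (Set.indicator {m : ℕ | t ≤ sqJump n m} (sqJump n)) (κ n) :=
  (sqJump_integrable κ hmom n).indicator (MeasurableSet.of_discrete)

lemma truncMom_nonneg (κ : Kernel ℕ ℕ) (n : ℕ) (t : ℝ) : 0 ≤ truncMom κ n t :=
  integral_nonneg fun m => Set.indicator_nonneg (fun m _ => sqJump_nonneg n m) m

lemma truncMom_le (κ : Kernel ℕ ℕ) [IsMarkovKernel κ]
    (hmom : ∀ n : ℕ, Integrable (fun m : ℕ => (m : ℝ) ^ 2) (κ n)) (n : ℕ) (t : ℝ) :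
    truncMom κ n t ≤ ∫ m, sqJump n m ∂(κ n) := by
  refine integral_mono (truncMom_integrable κ hmom n t) (sqJump_integrable κ hmom n) fun m => ?_
  exact Set.indicator_le_self' (fun m _ => sqJump_nonneg n m) m

lemma truncMom_tendsto (κ : Kernel ℕ ℕ) [IsMarkovKernel κ]
    (hmom : ∀ n : ℕ, Integrable (fun m : ℕ => (m : ℝ) ^ 2) (κ n)) (n : ℕ) :
    Tendsto (truncMom κ n) atTop (nhds 0) := by
  have h0 : (0 : ℝ) = ∫ m : ℕ, (0 : ℝ) ∂(κ n) := by simp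
  rw [h0]
  refine tendsto_integral_filter_of_dominated_convergence (sqJump n) ?_ ?_
    (sqJump_integrable κ hmom n) ?_
  · exact Eventually.of_forall fun t => (Measurable.of_discrete).aestronglyMeasurable
  · refine Eventually.of_forall fun t => ae_of_all _ fun m => ?_
    rw [Real.norm_of_nonneg (Set.indicator_nonneg (fun m _ => sqJump_nonneg n m) m)]
    exact Set.indicator_le_self' (fun m _ => sqJump_nonneg n m) m
  · refine ae_of_all _ fun m => ?_
    refine tendsto_const_nhds.congr' ?_
    filter_upwards [eventually_gt_atTop (sqJump n m)] with t ht
    rw [Set.indicator_of_notMem]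
    simpa using ht

lemma truncMom_large (σ : ℝ) (κ : Kernel ℕ ℕ) [IsMarkovKernel κ]
    (hmom : ∀ n : ℕ, Integrable (fun m : ℕ => (m : ℝ) ^ 2) (κ n))
    (hvar : Tendsto (fun n : ℕ => ∫ m, sqJump n m ∂(κ n)) atTop (nhds (σ ^ 2)))
    (hclt : ∀ f : BoundedContinuousFunction ℝ ℝ,
      Tendsto (fun n : ℕ => ∫ m, f (((m : ℝ) - n) / Real.sqrt n) ∂(κ n)) atTop
        (nhds (∫ x, f x ∂(gaussianReal 0 (Real.toNNReal (σ ^ 2))))))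
    (ε : ℝ) (hε : 0 < ε) :
    ∃ T : ℝ, ∀ᶠ n : ℕ in atTop, ∀ t : ℝ, T ≤ t → truncMom κ n t ≤ 4 * ε := by
  obtain ⟨M, hM⟩ := ((gauss_trunc σ).eventually_const_lt (sub_lt_self (σ ^ 2) hε)).exists
  let f : BoundedContinuousFunction ℝ ℝ :=
    BoundedContinuousFunction.ofNormedAddCommGroup (fun x : ℝ => min (x ^ 2) (M : ℝ))
      (by fun_prop) M (fun x => by
        rw [Real.norm_of_nonneg (le_min (sq_nonneg x) (Nat.cast_nonneg M))]
        exact min_le_right _ _)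
  have hf : ∀ n m : ℕ, f (((m : ℝ) - n) / Real.sqrt n) = min (sqJump n m) M := by
    intro n m
    change min ((((m : ℝ) - n) / Real.sqrt n) ^ 2) (M : ℝ) = _
    rw [div_pow, Real.sq_sqrt (Nat.cast_nonneg n)]
    rfl
  have h1 := hclt f
  simp only [hf] at h1
  have h2 := h1.eventually_const_lt (show σ ^ 2 - ε < _ from hM)
  have h3 := hvar.eventually_lt_const (show σ ^ 2 < σ ^ 2 + ε by linarith)
  refine ⟨2 * M, ?_⟩
  filter_upwards [h2, h3] with n hn2 hn3 t ht
  have hi := sqJump_integrable κ hmom n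
  have hj : Integrable (fun m => min (sqJump n m) (M : ℝ)) (κ n) :=
    hi.inf (integrable_const _)
  have : truncMom κ n t ≤ ∫ m, 2 * (sqJump n m - min (sqJump n m) M) ∂(κ n) := by
    refine integral_mono (truncMom_integrable κ hmom n t) ((hi.sub hj).const_mul 2) fun m => ?_
    have hm := min_le_right (sqJump n m) (M : ℝ)
    have hm' := min_le_left (sqJump n m) (M : ℝ)
    by_cases h : t ≤ sqJump n m
    · rw [Set.indicator_of_mem (by exact h)]
      simp only
      linarith
    · rw [Set.indicator_of_notMem (by exact h)]
      simp only
      linarith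
  rw [integral_const_mul, integral_sub hi hj] at this
  linarith

lemma truncMom_unif (σ : ℝ) (κ : Kernel ℕ ℕ) [IsMarkovKernel κ]
    (hmom : ∀ n : ℕ, Integrable (fun m : ℕ => (m : ℝ) ^ 2) (κ n))
    (hvar : Tendsto (fun n : ℕ => ∫ m, sqJump n m ∂(κ n)) atTop (nhds (σ ^ 2)))
    (hclt : ∀ f : BoundedContinuousFunction ℝ ℝ,
      Tendsto (fun n : ℕ => ∫ m, f (((m : ℝ) - n) / Real.sqrt n) ∂(κ n)) atTop
        (nhds (∫ x, f x ∂(gaussianReal 0 (Real.toNNReal (σ ^ 2))))))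
    (ε : ℝ) (hε : 0 < ε) :
    ∀ᶠ t : ℝ in atTop, ∀ n : ℕ, truncMom κ n t ≤ 4 * ε := by
  obtain ⟨T, hT⟩ := truncMom_large σ κ hmom hvar hclt ε hε
  obtain ⟨N, hN⟩ := eventually_atTop.1 hT
  have h1 : ∀ᶠ t : ℝ in atTop, ∀ n ∈ Finset.range N, truncMom κ n t ≤ 4 * ε := by
    rw [Filter.eventually_all_finset]
    intro n _
    exact (truncMom_tendsto κ hmom n).eventually_le_const (by positivity)
  filter_upwards [h1, eventually_ge_atTop T] with t ht1 ht2 n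
  by_cases h : n < N
  · exact ht1 n (Finset.mem_range.2 h)
  · exact hN n (not_lt.1 h) t ht2

/-- there is a bounded nonnegative function `δ` with `δ(t) → 0` as
`t → ∞` such that the one-step upward jump satisfies
`κ(n, {m : m - n ≥ k}) ≤ (n/k²) δ(k²/n)` for all `n ≥ 1` and all reals `k > 0`. -/
theorem one_step_jump_tail_bound
    (σ : ℝ) (hσ : 0 < σ) (κ : Kernel ℕ ℕ) [IsMarkovKernel κ]
    -- finite second moments
    (hmom : ∀ n : ℕ, Integrable (fun m : ℕ => (m : ℝ) ^ 2) (κ n))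
    -- martingale property
    (hmart : ∀ a : ℕ, ∫ m, (m : ℝ) ∂(κ a) = a)
    -- variance lower bound
    (hlb : ∃ s : ℝ, 0 < s ∧ ∀ n : ℕ, 1 ≤ n → s ≤ ∫ m, ((m : ℝ) - n) ^ 2 ∂(κ n))
    -- variance asymptotics
    (hvar : Tendsto (fun n : ℕ => (∫ m, ((m : ℝ) - n) ^ 2 ∂(κ n)) / n) atTop
      (nhds (σ ^ 2)))
    -- one-step CLT
    (hclt : ∀ f : BoundedContinuousFunction ℝ ℝ,
      Tendsto (fun n : ℕ => ∫ m, f (((m : ℝ) - n) / Real.sqrt n) ∂(κ n)) atTop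
        (nhds (∫ x, f x ∂(gaussianReal 0 (Real.toNNReal (σ ^ 2)))))) :
    ∃ δ : ℝ → ℝ, (∃ Cb : ℝ, ∀ t : ℝ, δ t ≤ Cb) ∧ (∀ t : ℝ, 0 ≤ δ t) ∧
      Tendsto δ atTop (nhds 0) ∧
      ∀ n : ℕ, 1 ≤ n → ∀ k : ℝ, 0 < k →
        ((κ n) {m : ℕ | k ≤ (m : ℝ) - n}).toReal ≤ (n / k ^ 2) * δ (k ^ 2 / n) := by
  have hvar' : Tendsto (fun n : ℕ => ∫ m, sqJump n m ∂(κ n)) atTop (nhds (σ ^ 2)) := by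
    refine hvar.congr fun n => ?_
    unfold sqJump
    rw [integral_div]
  obtain ⟨C, hC⟩ := hvar'.bddAbove_range
  have hC' : ∀ n t, truncMom κ n t ≤ C := fun n t =>
    (truncMom_le κ hmom n t).trans (hC ⟨n, rfl⟩)
  have hbdd : ∀ t, BddAbove (Set.range fun n => truncMom κ n t) := by
    intro t
    refine ⟨C, ?_⟩
    rintro _ ⟨n, rfl⟩
    exact hC' n t
  have hpos : ∀ t, 0 ≤ ⨆ n, truncMom κ n t := fun t =>
    Real.iSup_nonneg fun n => truncMom_nonneg κ n t
  refine ⟨fun t => ⨆ n, truncMom κ n t, ⟨C, fun t => ciSup_le fun n => hC' n t⟩, hpos, ?_, ?_⟩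
  · rw [Metric.tendsto_nhds]
    intro ε hε
    filter_upwards [truncMom_unif σ κ hmom hvar' hclt (ε / 8) (by positivity)] with t ht
    rw [Real.dist_eq, sub_zero, abs_of_nonneg (hpos t)]
    have := ciSup_le ht
    linarith
  · intro n hn k hk
    have hn' : (0 : ℝ) < n := by exact_mod_cast hn
    refine le_trans ?_ (mul_le_mul_of_nonneg_left (le_ciSup (hbdd (k ^ 2 / n)) n) (by positivity))
    have h1 : ∫ m, Set.indicator {m : ℕ | k ≤ (m : ℝ) - n} (fun _ => k ^ 2 / (n : ℝ)) m ∂(κ n)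
        ≤ truncMom κ n (k ^ 2 / n) := by
      refine integral_mono ((integrable_const _).indicator MeasurableSet.of_discrete)
        (truncMom_integrable κ hmom n _) fun m => ?_
      by_cases h : k ≤ (m : ℝ) - n
      · have h2 : k ^ 2 / n ≤ sqJump n m := by
          unfold sqJump
          gcongr
        rw [Set.indicator_of_mem (by exact h), Set.indicator_of_mem (by exact h2)]
        exact h2
      · rw [Set.indicator_of_notMem (by exact h)]
        exact Set.indicator_nonneg (fun m _ => sqJump_nonneg n m) m
    rw [integral_indicator_const _ MeasurableSet.of_discrete, smul_eq_mul] at h1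
    have h3 := mul_le_mul_of_nonneg_left h1 (show 0 ≤ (n : ℝ) / k ^ 2 by positivity)
    refine le_trans (le_of_eq ?_) h3
    rw [Measure.real]
    field_simp
end

section
/- Under the stated hypotheses on the kernel κ, there exists a constant c > 0 such that for all integers x, n, K with 1 ≤ x ≤ n ≤ K, the chain (A_k) started at x satisfies P_x( A_{k·n} ≤ n for every integer 1 ≤ k ≤ ⌊K/n⌋, and A_K > 0 ) ≤ exp(−c·K/n). -/
open MeasureTheory ProbabilityTheory Filter

/-- `P` is the law on path space `ℕ^ℕ` of the homogeneous Markov chain with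
transition kernel `κ` started at `x`, characterized by its cylinder probabilities
(this determines the Ionescu–Tulcea measure uniquely). -/
def IsChainLaw (κ : Kernel ℕ ℕ) (x : ℕ) (P : Measure (ℕ → ℕ)) : Prop :=
  ∀ (k : ℕ) (y : Fin (k + 1) → ℕ),
    P {ω | ∀ i : Fin (k + 1), ω i.val = y i} =
      (if y 0 = x then 1 else 0) * ∏ i : Fin k, (κ (y i.castSucc)) {y i.succ}

/-- transition operator -/
noncomputable def TT (κ : Kernel ℕ ℕ) (f : ℕ → ENNReal) : ℕ → ENNReal :=
  fun a => ∫⁻ m, f m ∂(κ a)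

lemma TT_mono (κ : Kernel ℕ ℕ) {f g : ℕ → ENNReal} (h : f ≤ g) : TT κ f ≤ TT κ g :=
  fun _ => lintegral_mono h

lemma TT_iter_mono (κ : Kernel ℕ ℕ) (n : ℕ) {f g : ℕ → ENNReal} (h : f ≤ g) :
    (TT κ)^[n] f ≤ (TT κ)^[n] g := by
  induction n with
  | zero => simpa using h
  | succ n ih => simp only [Function.iterate_succ_apply']; exact TT_mono κ ih

lemma TT_add (κ : Kernel ℕ ℕ) (f g : ℕ → ENNReal) : TT κ (f + g) = TT κ f + TT κ g := by
  funext a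
  exact lintegral_add_left (measurable_of_countable f) g

lemma TT_iter_add (κ : Kernel ℕ ℕ) (n : ℕ) (f g : ℕ → ENNReal) :
    (TT κ)^[n] (f + g) = (TT κ)^[n] f + (TT κ)^[n] g := by
  induction n with
  | zero => rfl
  | succ n ih => simp only [Function.iterate_succ_apply', ih, TT_add]

lemma TT_const (κ : Kernel ℕ ℕ) [IsMarkovKernel κ] (c : ENNReal) :
    TT κ (fun _ => c) = fun _ => c := by
  funext a; simp [TT]

lemma TT_iter_const (κ : Kernel ℕ ℕ) [IsMarkovKernel κ] (n : ℕ) (c : ENNReal) :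
    (TT κ)^[n] (fun _ => c) = fun _ => c := by
  induction n with
  | zero => rfl
  | succ n ih => simp only [Function.iterate_succ_apply', ih, TT_const]

lemma TT_iter_cmul (κ : Kernel ℕ ℕ) (n : ℕ) (c : ENNReal) (f : ℕ → ENNReal) :
    (TT κ)^[n] (fun m => c * f m) = fun m => c * (TT κ)^[n] f m := by
  induction n with
  | zero => rfl
  | succ n ih =>
    simp only [Function.iterate_succ_apply', ih]
    funext a
    exact lintegral_const_mul c (measurable_of_countable _)

lemma markov_one (κ : Kernel ℕ ℕ) (x : ℕ) (P : Measure (ℕ → ℕ)) (hP : IsChainLaw κ x P)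
    (k : ℕ) (G : (Fin (k + 1) → ℕ) → ENNReal) (g : ℕ → ENNReal) :
    ∫⁻ ω, G (fun i => ω i) * g (ω (k + 1)) ∂P = ∫⁻ ω, G (fun i => ω i) * TT κ g (ω k) ∂P := by
  have hm : ∀ j : ℕ, Measurable (fun (ω : ℕ → ℕ) (i : Fin j) => ω i) := fun j => by fun_prop
  have hl : ∀ (j : ℕ) (F : (Fin (j+1) → ℕ) → ENNReal), ∫⁻ ω, F (fun i => ω i) ∂P =
      ∑' y : Fin (j+1) → ℕ, F y * P {ω | ∀ i : Fin (j + 1), ω i.val = y i} := by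
    intro j F
    rw [← lintegral_map (measurable_of_countable F) (hm (j+1)), lintegral_countable']
    refine tsum_congr fun y => ?_
    rw [Measure.map_apply (hm _) (measurableSet_singleton y)]
    congr 2
    ext ω
    simp [funext_iff]
  have h1 := hl (k+1) (fun y => G (fun i => y i.castSucc) * g (y (Fin.last _)))
  have h2 := hl k (fun y => G y * TT κ g (y (Fin.last _)))
  simp only [Fin.val_castSucc, Fin.val_last] at h1 h2
  rw [h1, h2]
  rw [← (Fin.snocEquiv (fun _ : Fin (k+2) => ℕ)).tsum_eq, ENNReal.tsum_prod', ENNReal.tsum_comm]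
  refine tsum_congr fun y => ?_
  rw [TT, lintegral_countable', ← ENNReal.tsum_mul_left, ← ENNReal.tsum_mul_right]
  refine tsum_congr fun b => ?_
  rw [hP, hP, Fin.prod_univ_castSucc]
  have e0 : Fin.snocEquiv (fun _ : Fin (k+2) => ℕ) (b, y) 0 = y 0 := by
    have : (0 : Fin (k+2)) = Fin.castSucc 0 := rfl
    rw [this]; simp only [Fin.snocEquiv_apply, Fin.snoc_castSucc]
  have e1 : ∀ i : Fin (k+1), Fin.snocEquiv (fun _ : Fin (k+2) => ℕ) (b, y) i.castSucc = y i := by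
    intro i; simp only [Fin.snocEquiv_apply, Fin.snoc_castSucc]
  have e2 : Fin.snocEquiv (fun _ : Fin (k+2) => ℕ) (b, y) (Fin.last _) = b := by
    simp only [Fin.snocEquiv_apply, Fin.snoc_last]
  simp only [e0, e1, e2, ← Fin.castSucc_succ, Fin.succ_last]
  ring

lemma markov_iter (κ : Kernel ℕ ℕ) (x : ℕ) (P : Measure (ℕ → ℕ)) (hP : IsChainLaw κ x P)
    (k : ℕ) (G : (Fin (k + 1) → ℕ) → ENNReal) (j : ℕ) (g : ℕ → ENNReal) :
    ∫⁻ ω, G (fun i => ω i) * g (ω (k + j)) ∂P =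
      ∫⁻ ω, G (fun i => ω i) * (TT κ)^[j] g (ω k) ∂P := by
  induction j generalizing g with
  | zero => rfl
  | succ j ih =>
    rw [Function.iterate_succ_apply, ← ih]
    exact markov_one κ x P hP (k + j)
      (fun y => G (fun i => y ⟨i, by omega⟩)) g

lemma bound_of_delta (κ : Kernel ℕ ℕ) [IsMarkovKernel κ] (h0 : κ 0 {0}ᶜ = 0) (δ : ℝ)
    (hδ : 0 < δ) (hδ1 : δ ≤ 1)
    (h : ∀ n x : ℕ, x ≤ n → ENNReal.ofReal δ ≤ (TT κ)^[n] (fun m => if m = 0 then 1 else 0) x)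
    (P : Measure (ℕ → ℕ)) [IsProbabilityMeasure P] (x n K : ℕ) (hx : 1 ≤ x) (hxn : x ≤ n)
    (hnK : n ≤ K) (hP : IsChainLaw κ x P) :
    (P {ω | (∀ k : ℕ, 1 ≤ k → k ≤ K / n → ω (k * n) ≤ n) ∧ 0 < ω K}).toReal ≤
          Real.exp (-(δ / 2) * K / n) := by
  classical
  have hz : ∀ j, (TT κ)^[j] (fun m => if m = 0 then (0 : ENNReal) else 1) 0 = 0 := by
    intro j
    induction j with
    | zero => simp
    | succ j ih =>
      rw [Function.iterate_succ_apply', TT, lintegral_eq_zero_iff (measurable_of_countable _)]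
      rw [Filter.EventuallyEq, ae_iff]
      refine measure_mono_null ?_ h0
      intro m hm hm0
      simp only [Set.mem_singleton_iff] at hm0
      subst hm0
      exact hm ih
  have hq : ∀ y, y ≤ n → (TT κ)^[n] (fun m => if 0 < m ∧ m ≤ n then (1 : ENNReal) else 0) y
      ≤ ENNReal.ofReal (1 - δ) := by
    intro y hy
    have h1 := TT_iter_mono κ n (f := (fun m => if 0 < m ∧ m ≤ n then (1 : ENNReal) else 0) +
      (fun m => if m = 0 then 1 else 0)) (g := fun _ => 1) (by
        intro m
        by_cases hm : m = 0
        · simp [hm]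
        · simp only [Pi.add_apply, hm, if_false, add_zero]; split_ifs <;> simp)
    rw [TT_iter_add, TT_iter_const] at h1
    have h2 := h1 y
    simp only [Pi.add_apply] at h2
    rw [ENNReal.ofReal_sub _ hδ.le, ENNReal.ofReal_one]
    refine ENNReal.le_sub_of_add_le_right (by simp) (le_trans ?_ h2)
    gcongr
    exact h n y hy
  -- blocks
  have hB : ∀ k, P {ω | ∀ j ≤ k, 0 < ω (j * n) ∧ ω (j * n) ≤ n} ≤ ENNReal.ofReal (1 - δ) ^ k := by
    intro k
    induction k with
    | zero => simpa using prob_le_one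
    | succ k ih =>
      have hms : ∀ k, MeasurableSet {ω : ℕ → ℕ | ∀ j ≤ k, 0 < ω (j * n) ∧ ω (j * n) ≤ n} := by
        intro k
        have : {ω : ℕ → ℕ | ∀ j ≤ k, 0 < ω (j * n) ∧ ω (j * n) ≤ n} =
          ⋂ j, ⋂ (_ : j ≤ k), (fun ω : ℕ → ℕ => ω (j * n)) ⁻¹' {m | 0 < m ∧ m ≤ n} := by
          ext ω; simp
        rw [this]
        exact MeasurableSet.iInter fun j => MeasurableSet.iInter fun _ =>
          (measurable_pi_apply _) (MeasurableSet.of_discrete)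
      have key := markov_iter κ x P hP (k * n)
        (fun y => if ∀ (j : ℕ) (hj : j ≤ k), 0 < y ⟨j * n, Nat.lt_succ_of_le (Nat.mul_le_mul_right n hj)⟩ ∧
          y ⟨j * n, Nat.lt_succ_of_le (Nat.mul_le_mul_right n hj)⟩ ≤ n then 1 else 0) n
        (fun m => if 0 < m ∧ m ≤ n then (1 : ENNReal) else 0)
      simp only at key
      calc P {ω | ∀ j ≤ k + 1, 0 < ω (j * n) ∧ ω (j * n) ≤ n}
          = ∫⁻ ω, (if ∀ j ≤ k, 0 < ω (j * n) ∧ ω (j * n) ≤ n then 1 else 0) *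
              (if 0 < ω (k * n + n) ∧ ω (k * n + n) ≤ n then (1 : ENNReal) else 0) ∂P := by
            rw [← lintegral_indicator_one (hms _)]
            refine lintegral_congr fun ω => ?_
            simp only [Set.indicator, Set.mem_ofPred_eq, Pi.one_apply]
            have : (∀ j ≤ k + 1, 0 < ω (j * n) ∧ ω (j * n) ≤ n) ↔
              ((∀ j ≤ k, 0 < ω (j * n) ∧ ω (j * n) ≤ n) ∧
                (0 < ω (k * n + n) ∧ ω (k * n + n) ≤ n)) := by
              have e : k * n + n = (k+1) * n := by ring
              rw [e]
              constructor
              · intro H; exact ⟨fun j hj => H j (by omega), H _ le_rfl⟩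
              · rintro ⟨H1, H2⟩ j hj
                rcases Nat.lt_or_ge k j with hh | hh
                · have : j = k + 1 := by omega
                  subst this; exact H2
                · exact H1 j hh
            simp only [this]
            split_ifs <;> simp_all
        _ = _ := key
        _ ≤ ∫⁻ ω, ENNReal.ofReal (1 - δ) *
            ({ω | ∀ j ≤ k, 0 < ω (j * n) ∧ ω (j * n) ≤ n}).indicator 1 ω ∂P := by
            refine lintegral_mono fun ω => ?_
            simp only [Set.indicator, Set.mem_ofPred_eq, Pi.one_apply]
            split_ifs with H
            · rw [one_mul, mul_one]
              exact hq _ (H k le_rfl).2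
            · simp
        _ = ENNReal.ofReal (1 - δ) * P {ω | ∀ j ≤ k, 0 < ω (j * n) ∧ ω (j * n) ≤ n} := by
            rw [lintegral_const_mul _ (measurable_one.indicator (hms k)),
              lintegral_indicator_one (hms k)]
        _ ≤ _ := by rw [pow_succ']; gcongr
  have hN1 : P {ω | ω 0 ≠ x} = 0 := by
    have := hP 0 (fun _ => x)
    simp at this
    have h2 : {ω : ℕ → ℕ | ω 0 ≠ x} = {ω | ω 0 = x}ᶜ := rfl
    rw [h2, prob_compl_eq_zero_iff]
    · exact this
    · have hm : Measurable (fun ω : ℕ → ℕ => ω 0) := measurable_pi_apply 0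
      exact hm (measurableSet_singleton x)
  have hN2 : ∀ i ≤ K, P {ω | ω i = 0 ∧ 0 < ω K} = 0 := by
    intro i hi
    have key := markov_iter κ x P hP i (fun y => if y (Fin.last _) = 0 then 1 else 0) (K - i)
      (fun m => if m = 0 then (0 : ENNReal) else 1)
    have hi' : i + (K - i) = K := by omega
    rw [hi'] at key
    have r : ∫⁻ ω : ℕ → ℕ, (if ω i = 0 then 1 else 0) *
        (TT κ)^[K - i] (fun m => if m = 0 then (0 : ENNReal) else 1) (ω i) ∂P = 0 := by
      refine (lintegral_congr (g := fun _ => 0) fun ω => ?_).trans lintegral_zero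
      split_ifs with H
      · rw [H, hz]; simp
      · simp
    have key2 := key.trans r
    have hm : MeasurableSet {ω : ℕ → ℕ | ω i = 0 ∧ 0 < ω K} := by
      have : {ω : ℕ → ℕ | ω i = 0 ∧ 0 < ω K} = (fun ω : ℕ → ℕ => ω i) ⁻¹' {0} ∩
        (fun ω : ℕ → ℕ => ω K) ⁻¹' {m | 0 < m} := by ext; simp
      rw [this]
      exact ((measurable_pi_apply _) MeasurableSet.of_discrete).inter
        ((measurable_pi_apply _) MeasurableSet.of_discrete)
    rw [← lintegral_indicator_one hm, ← key2]
    refine lintegral_congr fun ω => ?_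
    simp only [Set.indicator, Set.mem_ofPred_eq, Pi.one_apply, Fin.val_last]
    by_cases a1 : ω i = 0 <;> by_cases a2 : ω K = 0 <;> simp [a1, a2, Nat.pos_iff_ne_zero]
  have hn : 0 < n := by omega
  have hsub : {ω : ℕ → ℕ | (∀ k : ℕ, 1 ≤ k → k ≤ K / n → ω (k * n) ≤ n) ∧ 0 < ω K} ⊆
      {ω | ∀ j ≤ K / n, 0 < ω (j * n) ∧ ω (j * n) ≤ n} ∪ ({ω | ω 0 ≠ x} ∪
        ⋃ i, ⋃ (_ : i ≤ K), {ω | ω i = 0 ∧ 0 < ω K}) := by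
    rintro ω ⟨H1, H2⟩
    by_contra hc
    simp only [Set.mem_union, not_or, Set.mem_iUnion, Set.mem_ofPred_eq, not_exists, not_and,
      not_not] at hc
    obtain ⟨c1, c2, c3⟩ := hc
    apply c1
    intro j hj
    refine ⟨Nat.pos_of_ne_zero fun h0 => c3 (j * n) ?_ h0 H2, ?_⟩
    · exact (Nat.mul_le_mul_right n hj).trans (Nat.div_mul_le_self K n)
    · rcases Nat.eq_zero_or_pos j with rfl | hj0
      · simp [c2, hxn]
      · exact H1 j hj0 hj
  have hfin : P {ω : ℕ → ℕ | (∀ k : ℕ, 1 ≤ k → k ≤ K / n → ω (k * n) ≤ n) ∧ 0 < ω K} ≤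
      ENNReal.ofReal (1 - δ) ^ (K / n) := by
    refine (measure_mono hsub).trans ((measure_union_le _ _).trans ?_)
    have : P ({ω | ω 0 ≠ x} ∪ ⋃ i, ⋃ (_ : i ≤ K), {ω | ω i = 0 ∧ 0 < ω K}) = 0 := by
      refine measure_union_null hN1 (measure_iUnion_null fun i => measure_iUnion_null fun hi => hN2 i hi)
    rw [this, add_zero]
    exact hB _
  rw [← ENNReal.ofReal_pow (by linarith)] at hfin
  refine (ENNReal.toReal_le_of_le_ofReal (by have : 0 ≤ 1 - δ := by linarith
                                             positivity) hfin).trans ?_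
  have e1 : 1 - δ ≤ Real.exp (-δ) := by have := Real.add_one_le_exp (-δ); linarith
  calc (1 - δ) ^ (K / n) ≤ (Real.exp (-δ)) ^ (K / n) := pow_le_pow_left₀ (by linarith) e1 _
    _ = Real.exp (-δ * (K / n : ℕ)) := by rw [← Real.exp_nat_mul]; ring_nf
    _ ≤ _ := by
      apply Real.exp_le_exp.2
      have hnr : (0 : ℝ) < n := by exact_mod_cast hn
      have h3 : K ≤ 2 * (n * (K / n)) := by
        have a1 := Nat.div_add_mod K n
        have a2 := Nat.mod_lt K hn
        have a3 : 1 ≤ K / n := (Nat.one_le_div_iff hn).2 hnK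
        nlinarith
      have h4 : (K : ℝ) ≤ 2 * (n * ((K / n : ℕ) : ℝ)) := by exact_mod_cast h3
      rw [mul_div_assoc]
      have h5 : (K : ℝ) / n ≤ 2 * ((K / n : ℕ) : ℝ) := by
        rw [div_le_iff₀ hnr]; linarith
      nlinarith

lemma exp_lower (y : ℝ) : 1 - y + min (y ^ 2) 1 / 4 ≤ Real.exp (-y) := by
  rcases le_total y 1 with hy | hy
  · rcases le_total y 0 with h0 | h0
    · have h1 := Real.quadratic_le_exp_of_nonneg (x := -y) (by linarith)
      have h2 := min_le_left (y ^ 2) 1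
      nlinarith
    · have h2 := min_le_left (y ^ 2) 1
      have h3 : Real.exp (-y) ≥ 1 - y + y ^ 2 / 4 := by
        have := Real.exp_bound' h0 hy (n := 3) (by norm_num)
        simp [Finset.sum_range_succ, Nat.factorial] at this
        rw [Real.exp_neg, ge_iff_le, ← one_div, le_div_iff₀ (Real.exp_pos y)]
        have hp : 0 ≤ 1 - y + y ^ 2 / 4 := by nlinarith [sq_nonneg (1 - y / 2)]
        refine (mul_le_mul_of_nonneg_left this hp).trans ?_
        have : 0 ≤ y ^ 2 := sq_nonneg y
        have : 0 ≤ y ^ 3 := by positivity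
        have : y ^ 3 ≤ y ^ 2 := by nlinarith
        have : y ^ 5 ≤ y ^ 4 := by nlinarith [pow_nonneg h0 4]
        have : y ^ 4 ≤ y ^ 3 := by nlinarith [pow_nonneg h0 3]
        nlinarith
      linarith
  · have h2 := min_le_right (y ^ 2) 1
    rcases le_total y (5/4) with h4 | h4
    · have : Real.exp (-y) ≥ 1/4 := by
        have : Real.exp (-y) ≥ Real.exp (-(5/4)) := Real.exp_le_exp.2 (by linarith)
        have h5 : Real.exp (5/4) ≤ 4 := by
          have : Real.exp (5/4) = Real.exp 1 * Real.exp (1/4) := by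
            rw [← Real.exp_add]; norm_num
          have h6 := Real.exp_one_lt_d9
          have h7 : Real.exp (1/4) ≤ 1/(1-1/4) := by
            have := Real.add_one_le_exp (-(1/4 : ℝ))
            rw [Real.exp_neg] at this
            have hp := Real.exp_pos (1/4)
            rw [le_div_iff₀ (by norm_num)]
            have h8 := mul_le_mul_of_nonneg_left this hp.le
            rw [mul_inv_cancel₀ hp.ne'] at h8
            linarith
          rw [this]
          nlinarith [Real.exp_pos (1/4)]
        have h9 : Real.exp (-(5/4)) ≥ 1/4 := by
          rw [Real.exp_neg, ← one_div]
          exact one_div_le_one_div_of_le (Real.exp_pos _) h5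
        linarith
      linarith
    · have := Real.exp_pos (-y)
      linarith

lemma exp_upper (c t : ℝ) (h0 : 0 ≤ t) (h1 : t ≤ 1) (hc0 : 0 ≤ c) (hc : c ≤ 1/4) :
    Real.exp (c * t) ≤ 1 + 2 * (c * t) := by
  have h : c * t ≤ 1/4 := by nlinarith
  have h' : 0 ≤ c * t := by positivity
  have := Real.abs_exp_sub_one_le (x := c * t) (by rw [abs_of_nonneg h']; linarith)
  rw [abs_of_nonneg h'] at this
  have := le_abs_self (Real.exp (c*t) - 1)
  linarith

/-- uniform positivity over all `n ≥ 1` from a positive limit -/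
lemma unif_pos (F : ℕ → ℝ) (l : ℝ) (hl : 0 < l) (hF : Tendsto F atTop (nhds l))
    (hp : ∀ n, 1 ≤ n → 0 < F n) : ∃ β, 0 < β ∧ ∀ n, 1 ≤ n → β ≤ F n := by
  have h1 : ∀ᶠ n in atTop, l / 2 < F n := hF.eventually (lt_mem_nhds (by linarith))
  obtain ⟨N, hN⟩ := eventually_atTop.1 h1
  have h2 : ∀ N : ℕ, ∃ β, 0 < β ∧ ∀ n, 1 ≤ n → n ≤ N → β ≤ F n := by
    intro N
    induction N with
    | zero => exact ⟨1, one_pos, fun n h h' => by omega⟩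
    | succ N ih =>
      obtain ⟨β, hβ, h⟩ := ih
      refine ⟨min β (F (N+1)), lt_min hβ (hp _ (by omega)), fun n hn hn' => ?_⟩
      rcases Nat.lt_or_ge N n with hh | hh
      · have : n = N + 1 := by omega
        subst this; exact min_le_right _ _
      · exact (min_le_left _ _).trans (h n hn hh)
  obtain ⟨β, hβ, h⟩ := h2 N
  refine ⟨min β (l/2), lt_min hβ (by linarith), fun n hn => ?_⟩
  rcases le_total n N with hh | hh
  · exact (min_le_left _ _).trans (h n hn hh)
  · exact (min_le_right _ _).trans (hN n hh).le

noncomputable def ff : BoundedContinuousFunction ℝ ℝ :=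
  BoundedContinuousFunction.ofNormedAddCommGroup (fun z : ℝ => min (z ^ 2) 1) (by fun_prop) 1 (by
    intro z
    rw [Real.norm_eq_abs, abs_of_nonneg (le_min (sq_nonneg z) zero_le_one)]
    exact min_le_right _ _)

lemma ff_apply (z : ℝ) : ff z = min (z ^ 2) 1 := rfl

lemma gauss_pos (σ : ℝ) (hσ : 0 < σ) : 0 < ∫ x, ff x ∂(gaussianReal 0 (Real.toNNReal (σ ^ 2))) := by
  have hv : Real.toNNReal (σ ^ 2) ≠ 0 := by
    simp [Real.toNNReal_eq_zero, hσ.ne']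
  rw [integral_pos_iff_support_of_nonneg]
  · have hs : Function.support (fun x => ff x) = {0}ᶜ := by
      ext z
      simp only [Function.mem_support, ff_apply, Set.mem_compl_iff, Set.mem_singleton_iff]
      constructor
      · rintro h rfl; simp at h
      · intro h; exact (lt_min (by positivity) one_pos).ne'
    rw [hs]
    have := nullSingletonClass_gaussianReal (μ := 0) hv
    rw [prob_compl_eq_one_sub (measurableSet_singleton 0), measure_singleton]
    simp
  · intro z; exact le_min (sq_nonneg z) zero_le_one
  · exact ff.integrable _

lemma kint (κ : Kernel ℕ ℕ) [IsMarkovKernel κ] (f : ℕ → ℝ) (C : ℝ) (h : ∀ m, |f m| ≤ C) (a : ℕ) :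
    Integrable f (κ a) :=
  Integrable.of_bound (measurable_of_countable f).aestronglyMeasurable C (ae_of_all _ h)

lemma ff_pos (κ : Kernel ℕ ℕ) [IsMarkovKernel κ]
    (hlb : ∃ s : ℝ, 0 < s ∧ ∀ n : ℕ, 1 ≤ n → s ≤ ∫ m, ((m : ℝ) - n) ^ 2 ∂(κ n))
    (n : ℕ) (hn : 1 ≤ n) : 0 < ∫ m, ff (((m : ℝ) - n) / Real.sqrt n) ∂(κ n) := by
  obtain ⟨s, hs, h⟩ := hlb
  have hn0 : (0 : ℝ) < Real.sqrt n := Real.sqrt_pos.2 (by exact_mod_cast hn)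
  have hnn : 0 ≤ fun m : ℕ => ff (((m : ℝ) - n) / Real.sqrt n) :=
    fun m => le_min (sq_nonneg _) zero_le_one
  refine lt_of_le_of_ne (integral_nonneg hnn) fun heq => ?_
  have hint : Integrable (fun m : ℕ => ff (((m : ℝ) - n) / Real.sqrt n)) (κ n) := by
    refine kint κ _ 1 (fun m => ?_) n
    rw [abs_of_nonneg (hnn m)]; exact min_le_right _ _
  have h1 := (integral_eq_zero_iff_of_nonneg hnn hint).1 heq.symm
  have h2 : (fun m : ℕ => ((m : ℝ) - n) ^ 2) =ᵐ[κ n] 0 := by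
    filter_upwards [h1] with m hm
    simp only [Pi.zero_apply, ff_apply] at hm ⊢
    by_contra hne
    have : ((m:ℝ) - n) ≠ 0 := fun h => hne (by rw [h]; norm_num)
    have : 0 < (((m : ℝ) - n) / Real.sqrt n) ^ 2 := by positivity
    exact (lt_min this one_pos).ne' hm
  have := h n hn
  rw [integral_congr_ae h2] at this
  simp at this
  linarith

lemma one_step (κ : Kernel ℕ ℕ) [IsMarkovKernel κ]
    (hint : ∀ n : ℕ, Integrable (fun m : ℕ => (m : ℝ)) (κ n))
    (hmart : ∀ a : ℕ, ∫ m, (m : ℝ) ∂(κ a) = a) (h0 : κ 0 {0}ᶜ = 0)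
    (c : ℝ) (hc : 0 < c) (hc1 : c ≤ 1/4)
    (hβ : ∀ n : ℕ, 1 ≤ n → 8 * c ≤ ∫ m, ff (((m : ℝ) - n) / Real.sqrt n) ∂(κ n))
    (l : ℝ) (hl : 1 ≤ l) (a : ℕ) :
    ENNReal.ofReal (Real.exp (-(a / (l + c)))) ≤
      TT κ (fun m => ENNReal.ofReal (Real.exp (-(m / l)))) a + ENNReal.ofReal (Real.exp (-(l/2))) := by
  rcases Nat.eq_zero_or_pos a with rfl | ha
  · refine le_trans ?_ le_self_add
    have : TT κ (fun m => ENNReal.ofReal (Real.exp (-(m / l)))) 0 = ∫⁻ m, 1 ∂(κ 0) := by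
      apply lintegral_congr_ae
      have : ∀ᵐ m ∂(κ 0), m ∈ ({0} : Set ℕ) := h0
      filter_upwards [this] with m hm
      simp only [Set.mem_singleton_iff] at hm
      simp [hm]
    rw [this]; simp
  have har : (1 : ℝ) ≤ a := by exact_mod_cast ha
  rcases lt_or_ge (l ^ 2) a with hbig | hsm
  · refine le_trans (ENNReal.ofReal_le_ofReal (Real.exp_le_exp.2 ?_)) le_add_self
    rw [neg_le_neg_iff, div_le_div_iff₀ (by norm_num) (by linarith)]
    nlinarith
  · refine le_trans ?_ le_self_add
    have hexpint : Integrable (fun m : ℕ => Real.exp (-(m / l))) (κ a) := by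
      refine kint κ _ 1 (fun m => ?_) a
      rw [abs_of_pos (Real.exp_pos _), Real.exp_le_one_iff]
      have : 0 ≤ (m : ℝ) / l := by positivity
      linarith
    rw [TT, ← ofReal_integral_eq_lintegral_ofReal hexpint (ae_of_all _ fun m => (Real.exp_pos _).le)]
    apply ENNReal.ofReal_le_ofReal
    set t : ℝ := a / l ^ 2 with ht
    have hlp : 0 < l := by linarith
    have ht0 : 0 ≤ t := by positivity
    have ht1 : t ≤ 1 := by rw [ht, div_le_one (by positivity)]; exact hsm
    have hsq : 0 < Real.sqrt a := Real.sqrt_pos.2 (by linarith)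
    have hpt : ∀ m : ℕ, Real.exp (-(a / l)) * (1 - ((m : ℝ) - a) / l +
        t / 4 * ff (((m : ℝ) - a) / Real.sqrt a)) ≤ Real.exp (-(m / l)) := by
      intro m
      have h1 := exp_lower (((m : ℝ) - a) / l)
      have e : Real.exp (-(m / l)) = Real.exp (-(a / l)) * Real.exp (-(((m : ℝ) - a) / l)) := by
        rw [← Real.exp_add]; congr 1; field_simp; ring
      rw [e]
      gcongr
      refine le_trans ?_ h1
      have h2 : t * ff (((m : ℝ) - a) / Real.sqrt a) ≤ min ((((m : ℝ) - a) / l) ^ 2) 1 := by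
        rw [ff_apply]
        refine le_min ?_ ?_
        · refine (mul_le_mul_of_nonneg_left (min_le_left _ _) ht0).trans (le_of_eq ?_)
          rw [div_pow, Real.sq_sqrt (by linarith), ht]
          field_simp
        · refine (mul_le_mul_of_nonneg_left (min_le_right _ _) ht0).trans (by linarith)
      linarith
    have hffint : Integrable (fun m : ℕ => ff (((m : ℝ) - a) / Real.sqrt a)) (κ a) := by
      refine kint κ _ 1 (fun m => ?_) a
      rw [ff_apply, abs_of_nonneg (le_min (sq_nonneg _) zero_le_one)]; exact min_le_right _ _
    have i1 : Integrable (fun m : ℕ => ((m : ℝ) - a) / l) (κ a) :=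
      ((hint a).sub (integrable_const _)).div_const _
    have i2 : Integrable (fun m : ℕ => 1 - ((m : ℝ) - a) / l) (κ a) := (integrable_const _).sub i1
    have i3 : Integrable (fun m : ℕ => t / 4 * ff (((m : ℝ) - a) / Real.sqrt a)) (κ a) :=
      hffint.const_mul _
    have hI := integral_mono ((i2.add i3).const_mul (Real.exp (-(a / l)))) hexpint hpt
    have hz : ∫ m : ℕ, ((m : ℝ) - a) / l ∂(κ a) = 0 := by
      rw [integral_div, integral_sub (hint a) (integrable_const _), hmart]; simp
    have hE : ∫ m : ℕ, Real.exp (-(a / l)) * (1 - ((m : ℝ) - a) / l +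
        t / 4 * ff (((m : ℝ) - a) / Real.sqrt a)) ∂(κ a) = Real.exp (-(a / l)) *
          (1 + t / 4 * ∫ m : ℕ, ff (((m : ℝ) - a) / Real.sqrt a) ∂(κ a)) := by
      rw [integral_const_mul, integral_add i2 i3, integral_sub (integrable_const _) i1, hz,
        integral_const_mul]
      simp
    have hI2 : Real.exp (-(a / l)) *
          (1 + t / 4 * ∫ m : ℕ, ff (((m : ℝ) - a) / Real.sqrt a) ∂(κ a)) ≤
          ∫ m : ℕ, Real.exp (-(m / l)) ∂(κ a) := by rw [← hE]; exact hI
    refine le_trans ?_ hI2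
    have h3 : Real.exp (c * t) ≤ 1 + t / 4 * ∫ m : ℕ, ff (((m : ℝ) - a) / Real.sqrt a) ∂(κ a) := by
      refine (exp_upper c t ht0 ht1 hc.le hc1).trans ?_
      have := mul_le_mul_of_nonneg_left (hβ a ha) (show 0 ≤ t / 4 by positivity)
      linarith
    refine le_trans ?_ (mul_le_mul_of_nonneg_left h3 (Real.exp_pos _).le)
    rw [← Real.exp_add]
    apply Real.exp_le_exp.2
    have h4 : (a : ℝ) / l - c * t ≤ a / (l + c) := by
      rw [ht, le_div_iff₀ (by linarith)]
      have : ((a : ℝ) / l - c * (a / l ^ 2)) * (l + c) = a - a * c ^ 2 / l ^ 2 := by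
        field_simp; ring
      rw [this]
      have : 0 ≤ a * c ^ 2 / l ^ 2 := by positivity
      linarith
    linarith

lemma multi_step (κ : Kernel ℕ ℕ) [IsMarkovKernel κ] (c : ℝ) (hc : 0 < c)
    (hstep : ∀ l : ℝ, 1 ≤ l → ∀ a : ℕ, ENNReal.ofReal (Real.exp (-(a / (l + c)))) ≤
      TT κ (fun m => ENNReal.ofReal (Real.exp (-(m / l)))) a + ENNReal.ofReal (Real.exp (-(l/2))))
    (l : ℝ) (hl : 1 ≤ l) (N : ℕ) (a : ℕ) :
    ENNReal.ofReal (Real.exp (-(a / (l + c * N)))) ≤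
      (TT κ)^[N] (fun m => ENNReal.ofReal (Real.exp (-(m / l)))) a +
      ENNReal.ofReal (∑ j ∈ Finset.range N, Real.exp (-((l + c * j)/2))) := by
  induction N generalizing a with
  | zero => simp
  | succ N ih =>
    have h1 : 1 ≤ l + c * N := by have : 0 ≤ c * N := by positivity
                                  linarith
    have h2 := hstep _ h1 a
    have e : l + c * (N + 1 : ℕ) = l + c * N + c := by push_cast; ring
    rw [e]
    refine h2.trans ?_
    rw [Function.iterate_succ_apply', Finset.sum_range_succ,
      ENNReal.ofReal_add (Finset.sum_nonneg fun _ _ => (Real.exp_pos _).le) (Real.exp_pos _).le,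
      ← add_assoc]
    gcongr
    have h3 := TT_mono κ (f := fun m => ENNReal.ofReal (Real.exp (-(m / (l + c * N)))))
      (g := (TT κ)^[N] (fun m => ENNReal.ofReal (Real.exp (-(m / l)))) +
        fun _ => ENNReal.ofReal (∑ j ∈ Finset.range N, Real.exp (-((l + c * j)/2)))) ih
    rw [TT_add, TT_const] at h3
    exact h3 a

lemma sum_bound (c : ℝ) (hc : 0 < c) (l : ℝ) (N : ℕ) :
    ∑ j ∈ Finset.range N, Real.exp (-((l + c * j)/2)) ≤
      Real.exp (-(l/2)) * (1 - Real.exp (-(c/2)))⁻¹ := by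
  have hr : Real.exp (-(c/2)) < 1 := by rw [Real.exp_lt_one_iff]; linarith
  have : ∀ j : ℕ, Real.exp (-((l + c * j)/2)) = Real.exp (-(l/2)) * Real.exp (-(c/2)) ^ j := by
    intro j
    rw [← Real.exp_nat_mul, ← Real.exp_add]; congr 1; ring
  simp only [this, ← Finset.mul_sum]
  gcongr
  rw [← tsum_geometric_of_lt_one (Real.exp_pos _).le hr]
  exact (summable_geometric_of_lt_one (Real.exp_pos _).le hr).sum_le_tsum _
    (fun i _ => by positivity)

/-- descending to zero -/
lemma descend (κ : Kernel ℕ ℕ) [IsMarkovKernel κ]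
    (hd : ∀ a, 0 < κ a (Set.Iic (a - 1))) (M : ℕ) :
    ∃ η : ℝ, 0 < η ∧ ∀ k, k ≤ M → ∀ a, a ≤ k →
      ENNReal.ofReal η ≤ (TT κ)^[k] (fun m => if m = 0 then 1 else 0) a := by
  have h1 : ∀ M : ℕ, ∃ h : ℝ, 0 < h ∧ h ≤ 1 ∧ ∀ a ≤ M, ENNReal.ofReal h ≤ κ a (Set.Iic (a-1)) := by
    intro M
    have hone : ∀ a, ENNReal.ofReal (κ a (Set.Iic (a-1))).toReal = κ a (Set.Iic (a-1)) :=
      fun a => ENNReal.ofReal_toReal (measure_ne_top _ _)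
    have hp : ∀ a, 0 < (κ a (Set.Iic (a-1))).toReal :=
      fun a => ENNReal.toReal_pos (hd a).ne' (measure_ne_top _ _)
    induction M with
    | zero =>
      refine ⟨min 1 (κ 0 (Set.Iic (0-1))).toReal, lt_min one_pos (hp 0), min_le_left _ _, ?_⟩
      intro a ha
      obtain rfl : a = 0 := by omega
      exact (ENNReal.ofReal_le_ofReal (min_le_right _ _)).trans (hone _).le
    | succ M ih =>
      obtain ⟨h, h1, h2, h3⟩ := ih
      refine ⟨min h (κ (M+1) (Set.Iic (M+1-1))).toReal, lt_min h1 (hp _),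
        (min_le_left _ _).trans h2, ?_⟩
      intro a ha
      rcases Nat.lt_or_ge M a with hh | hh
      · obtain rfl : a = M + 1 := by omega
        exact (ENNReal.ofReal_le_ofReal (min_le_right _ _)).trans (hone _).le
      · exact (ENNReal.ofReal_le_ofReal (min_le_left _ _)).trans (h3 a hh)
  obtain ⟨h, hp, hle, hh⟩ := h1 M
  refine ⟨h ^ M, by positivity, fun k hk a ha => ?_⟩
  have key : ∀ k, k ≤ M → ∀ a, a ≤ k →
      ENNReal.ofReal (h ^ k) ≤ (TT κ)^[k] (fun m => if m = 0 then 1 else 0) a := by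
    intro k
    induction k with
    | zero => intro _ a ha; obtain rfl : a = 0 := by omega
              simp
    | succ k ih =>
      intro hk a ha
      rw [Function.iterate_succ_apply', TT]
      calc ENNReal.ofReal (h ^ (k+1)) = ENNReal.ofReal (h ^ k) * ENNReal.ofReal h := by
            rw [← ENNReal.ofReal_mul (by positivity), pow_succ]
        _ ≤ ENNReal.ofReal (h ^ k) * κ a (Set.Iic (a - 1)) := by
            gcongr; exact hh a (by omega)
        _ = ∫⁻ m in Set.Iic (a-1), ENNReal.ofReal (h ^ k) ∂(κ a) := by simp
        _ ≤ ∫⁻ m in Set.Iic (a-1), (TT κ)^[k] (fun m => if m = 0 then 1 else 0) m ∂(κ a) := by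
            refine setLIntegral_mono (measurable_of_countable _) fun m hm => ?_
            exact ih (by omega) m (by have : m ≤ a - 1 := hm
                                      omega)
        _ ≤ _ := setLIntegral_le_lintegral _ _
  exact (ENNReal.ofReal_le_ofReal (pow_le_pow_of_le_one hp.le hle hk)).trans (key k hk a ha)

lemma delta_exists (κ : Kernel ℕ ℕ) [IsMarkovKernel κ]
    (hd : ∀ a, 0 < κ a (Set.Iic (a - 1))) (c : ℝ) (hc : 0 < c)
    (hstep : ∀ l : ℝ, 1 ≤ l → ∀ a : ℕ, ENNReal.ofReal (Real.exp (-(a / (l + c)))) ≤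
      TT κ (fun m => ENNReal.ofReal (Real.exp (-(m / l)))) a + ENNReal.ofReal (Real.exp (-(l/2)))) :
    ∃ δ : ℝ, 0 < δ ∧ δ ≤ 1 ∧ ∀ n x : ℕ, x ≤ n →
      ENNReal.ofReal δ ≤ (TT κ)^[n] (fun m => if m = 0 then 1 else 0) x := by
  set p : ℝ := Real.exp (-(2/c)) / 4 with hp
  have hp0 : 0 < p := by positivity
  have t1 : Tendsto (fun l : ℝ => Real.exp (-(l/2)) * (1 - Real.exp (-(c/2)))⁻¹) atTop (nhds 0) := by
    have : Tendsto (fun l : ℝ => Real.exp (-(l/2))) atTop (nhds 0) := 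
      Real.tendsto_exp_neg_atTop_nhds_zero.comp (tendsto_id.atTop_div_const (by norm_num))
    simpa using this.mul_const ((1 - Real.exp (-(c/2)))⁻¹)
  obtain ⟨l, hl1, hl⟩ := ((t1.eventually (gt_mem_nhds hp0)).and (eventually_ge_atTop (1 : ℝ))).exists
  have hlp : 0 < l := by linarith
  have t2 : Tendsto (fun m : ℕ => Real.exp (-((m : ℝ)/l))) atTop (nhds 0) :=
    Real.tendsto_exp_neg_atTop_nhds_zero.comp
      (tendsto_natCast_atTop_atTop.atTop_div_const hlp)
  obtain ⟨M, hM1, hM⟩ := ((t2.eventually (gt_mem_nhds hp0)).and (eventually_ge_atTop 1)).exists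
  obtain ⟨η, hη, hdes⟩ := descend κ hd (2 * M)
  have hη1 : η ≤ 1 := by
    have := hdes 0 (by omega) 0 le_rfl
    simpa using this
  have hpl : p ≤ 1 := by
    have : Real.exp (-(2/c)) ≤ 1 := by
      rw [Real.exp_le_one_iff]; have : 0 ≤ 2 / c := by positivity
      linarith
    rw [hp]; linarith
  refine ⟨η * p, by positivity, by nlinarith, fun n x hx => ?_⟩
  rcases le_total n (2 * M) with hn | hn
  · refine le_trans (ENNReal.ofReal_le_ofReal ?_) (hdes n hn x hx)
    nlinarith
  obtain ⟨N, rfl⟩ : ∃ N, n = N + M := ⟨n - M, by omega⟩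
  have hNM : M ≤ N := by omega
  have hN1 : 1 ≤ N := by omega
  have hNr : (1 : ℝ) ≤ N := by exact_mod_cast hN1
  have hms := multi_step κ c hc hstep l hl N x
  have hx2 : (x : ℝ) ≤ 2 * N := by exact_mod_cast (by omega : x ≤ 2 * N)
  have hlow : 4 * p ≤ Real.exp (-((x : ℝ) / (l + c * N))) := by
    have : Real.exp (-(2/c)) = 4 * p := by rw [hp]; ring
    rw [← this]
    apply Real.exp_le_exp.2
    have hcN : 0 < c * N := by positivity
    rw [neg_le_neg_iff, div_le_div_iff₀ (by linarith) hc]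
    nlinarith
  have hS := sum_bound c hc l N
  have hfun : (fun m : ℕ => ENNReal.ofReal (Real.exp (-((m:ℝ) / l)))) ≤
      (fun m : ℕ => if m ≤ M then (1 : ENNReal) else 0) + (fun _ => ENNReal.ofReal p) := by
    intro m
    simp only [Pi.add_apply]
    split_ifs with h
    · refine le_trans ?_ le_self_add
      rw [ENNReal.ofReal_le_one, Real.exp_le_one_iff]
      have : 0 ≤ (m : ℝ) / l := by positivity
      linarith
    · rw [zero_add]
      apply ENNReal.ofReal_le_ofReal
      refine le_trans (Real.exp_le_exp.2 ?_) hM1.le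
      have : (M : ℝ) ≤ m := by exact_mod_cast (by omega : M ≤ m)
      gcongr
  have h2 := TT_iter_mono κ N hfun x
  rw [TT_iter_add, TT_iter_const] at h2
  simp only [Pi.add_apply] at h2
  have h3 : ENNReal.ofReal p ≤ (TT κ)^[N] (fun m : ℕ => if m ≤ M then (1 : ENNReal) else 0) x := by
    have h4 : ENNReal.ofReal (4 * p) ≤
        (TT κ)^[N] (fun m : ℕ => if m ≤ M then (1 : ENNReal) else 0) x + ENNReal.ofReal (2 * p) := by
      refine (ENNReal.ofReal_le_ofReal hlow).trans (hms.trans ?_)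
      have e : ENNReal.ofReal (2 * p) = ENNReal.ofReal p + ENNReal.ofReal p := by
        rw [← ENNReal.ofReal_add hp0.le hp0.le]; ring_nf
      rw [e, ← add_assoc]
      exact add_le_add h2 (ENNReal.ofReal_le_ofReal (hS.trans hl1.le))
    have h5 : ENNReal.ofReal (2 * p) + ENNReal.ofReal (2 * p) = ENNReal.ofReal (4 * p) := by
      rw [← ENNReal.ofReal_add (by positivity) (by positivity)]; ring_nf
    rw [← h5] at h4
    have h6 := (ENNReal.add_le_add_iff_right ENNReal.ofReal_ne_top).1 h4
    exact (ENNReal.ofReal_le_ofReal (by linarith)).trans h6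
  rw [Function.iterate_add_apply]
  have h7 := TT_iter_mono κ N (f := fun m => ENNReal.ofReal η * (if m ≤ M then (1 : ENNReal) else 0))
    (g := (TT κ)^[M] (fun m => if m = 0 then 1 else 0)) (by
      intro m
      simp only
      split_ifs with h
      · rw [mul_one]; exact hdes M (by omega) m h
      · simp)
  refine le_trans ?_ (h7 x)
  rw [TT_iter_cmul, ENNReal.ofReal_mul hη.le]
  exact mul_le_mul_right h3 _

lemma zero_absorb (κ : Kernel ℕ ℕ) [IsMarkovKernel κ]
    (hint : ∀ n : ℕ, Integrable (fun m : ℕ => (m : ℝ)) (κ n))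
    (hmart : ∀ a : ℕ, ∫ m, (m : ℝ) ∂(κ a) = a) : κ 0 {0}ᶜ = 0 := by
  have h := hmart 0
  rw [Nat.cast_zero, integral_eq_zero_iff_of_nonneg (fun m => Nat.cast_nonneg m) (hint 0)] at h
  have : ∀ᵐ m ∂(κ 0), m ∈ ({0} : Set ℕ) := by
    filter_upwards [h] with m hm
    simpa using hm
  exact this

lemma dec_pos (κ : Kernel ℕ ℕ) [IsMarkovKernel κ]
    (hint : ∀ n : ℕ, Integrable (fun m : ℕ => (m : ℝ)) (κ n))
    (hmart : ∀ a : ℕ, ∫ m, (m : ℝ) ∂(κ a) = a)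
    (hlb : ∃ s : ℝ, 0 < s ∧ ∀ n : ℕ, 1 ≤ n → s ≤ ∫ m, ((m : ℝ) - n) ^ 2 ∂(κ n)) (a : ℕ) :
    0 < κ a (Set.Iic (a - 1)) := by
  rcases Nat.eq_zero_or_pos a with rfl | ha
  · have h0 := zero_absorb κ hint hmart
    have : κ 0 {0} = 1 := (prob_compl_eq_zero_iff (measurableSet_singleton 0)).1 h0
    have e : (Set.Iic (0 - 1) : Set ℕ) = {0} := by ext; simp
    rw [e, this]; simp
  · rw [pos_iff_ne_zero]
    intro h
    have hge : ∀ᵐ m : ℕ ∂(κ a), (0 : ℝ) ≤ (m : ℝ) - a := by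
      rw [ae_iff]
      refine measure_mono_null ?_ h
      intro m hm
      simp only [Set.mem_ofPred_eq, not_le, sub_neg, Nat.cast_lt] at hm
      simp only [Set.mem_Iic]; omega
    have hz : ∫ m : ℕ, ((m : ℝ) - a) ∂(κ a) = 0 := by
      rw [integral_sub (hint a) (integrable_const _), hmart]; simp
    have h2 := (integral_eq_zero_iff_of_nonneg_ae hge ((hint a).sub (integrable_const _))).1 hz
    obtain ⟨s, hs, hs2⟩ := hlb
    have h3 := hs2 a ha
    have h4 : (fun m : ℕ => ((m : ℝ) - a) ^ 2) =ᵐ[κ a] 0 := by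
      filter_upwards [h2] with m hm
      have hm' : (m : ℝ) - a = 0 := hm
      simp only [Pi.zero_apply]
      rw [hm']; norm_num
    rw [integral_congr_ae h4] at h3
    simp at h3
    linarith

/-- there is `c > 0` such that for all `1 ≤ x ≤ n ≤ K`, the chain
started at `x` satisfies
`P_x(A_{kn} ≤ n for all 1 ≤ k ≤ ⌊K/n⌋, and A_K > 0) ≤ exp(-c K/n)`. -/
theorem long_thin_survival_bound
    (σ : ℝ) (hσ : 0 < σ) (κ : Kernel ℕ ℕ) [IsMarkovKernel κ]
    -- finite second moments
    (hmom : ∀ n : ℕ, Integrable (fun m : ℕ => (m : ℝ) ^ 2) (κ n))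
    -- martingale property
    (hmart : ∀ a : ℕ, ∫ m, (m : ℝ) ∂(κ a) = a)
    -- variance lower bound
    (hlb : ∃ s : ℝ, 0 < s ∧ ∀ n : ℕ, 1 ≤ n → s ≤ ∫ m, ((m : ℝ) - n) ^ 2 ∂(κ n))
    -- variance asymptotics
    (hvar : Tendsto (fun n : ℕ => (∫ m, ((m : ℝ) - n) ^ 2 ∂(κ n)) / n) atTop
      (nhds (σ ^ 2)))
    -- one-step CLT
    (hclt : ∀ f : BoundedContinuousFunction ℝ ℝ,
      Tendsto (fun n : ℕ => ∫ m, f (((m : ℝ) - n) / Real.sqrt n) ∂(κ n)) atTop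
        (nhds (∫ x, f x ∂(gaussianReal 0 (Real.toNNReal (σ ^ 2)))))) :
    ∃ c : ℝ, 0 < c ∧
      ∀ (P : Measure (ℕ → ℕ)), IsProbabilityMeasure P →
      ∀ x n K : ℕ, 1 ≤ x → x ≤ n → n ≤ K → IsChainLaw κ x P →
        (P {ω | (∀ k : ℕ, 1 ≤ k → k ≤ K / n → ω (k * n) ≤ n) ∧ 0 < ω K}).toReal ≤
          Real.exp (-c * K / n) := by
  have hint : ∀ n : ℕ, Integrable (fun m : ℕ => (m : ℝ)) (κ n) := by
    intro n
    refine ((integrable_const (1 : ℝ)).add (hmom n)).mono'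
      (measurable_of_countable _).aestronglyMeasurable (ae_of_all _ fun m => ?_)
    rw [Real.norm_eq_abs, abs_of_nonneg (Nat.cast_nonneg m)]
    simp only [Pi.add_apply]
    nlinarith [sq_nonneg ((m : ℝ) - 1), sq_nonneg (m : ℝ)]
  have h0 := zero_absorb κ hint hmart
  obtain ⟨β, hβ, hβ2⟩ := unif_pos _ _ (gauss_pos σ hσ) (hclt ff) (ff_pos κ hlb)
  have hc : 0 < min (β / 8) (1 / 4) := lt_min (by linarith) (by norm_num)
  have hst := one_step κ hint hmart h0 (min (β / 8) (1 / 4)) hc (min_le_right _ _)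
    (fun n hn => le_trans (by linarith [min_le_left (β / 8) (1 / 4)]) (hβ2 n hn))
  obtain ⟨δ, hδ, hδ1, hδ2⟩ := delta_exists κ (dec_pos κ hint hmart hlb) _ hc hst
  refine ⟨δ / 2, by positivity, fun P hPp x n K hx hxn hnK hP => ?_⟩
  exact bound_of_delta κ h0 δ hδ hδ1 hδ2 P x n K hx hxn hnK hP
end

section
/- Under the stated hypotheses on the kernel κ, the extinction tail of the chain started from a single individual satisfies the Kolmogorov-type estimate: n · P₁( A_k > 0 for all 1 ≤ k ≤ n ) converges to 2/σ² as n → ∞; equivalently P₁(τ₀ > n) ∼ 2/(σ² n), where τ₀ = inf{k ≥ 1 : A_k = 0}. -/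
open MeasureTheory ProbabilityTheory Filter

lemma ke_exp_upper (a b : ℝ) (ha : 0 ≤ a) (hb : 0 ≤ b) :
    Real.exp (-b) - Real.exp (-a) + (b - a) * Real.exp (-a) ≤ (b - a) ^ 2 := by
  have hea : Real.exp (-a) ≤ 1 := Real.exp_le_one_iff.2 (by linarith)
  have hea0 := Real.exp_pos (-a)
  have hsplit : Real.exp (-b) = Real.exp (-a) * Real.exp (-(b - a)) := by
    rw [← Real.exp_add]; congr 1; ring
  rcases le_total a b with h | h
  · have key : Real.exp (-(b - a)) - 1 + (b - a) ≤ (b - a) ^ 2 := by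
      rcases le_total (b - a) 1 with h1 | h1
      · have := Real.abs_exp_sub_one_sub_id_le (x := -(b - a))
          (by rw [abs_neg, abs_of_nonneg (by linarith)]; exact h1)
        have := (abs_le.1 this).2
        nlinarith
      · have : Real.exp (-(b - a)) ≤ 1 := Real.exp_le_one_iff.2 (by linarith)
        nlinarith
    rw [hsplit]
    nlinarith [sq_nonneg (b - a)]
  · have h1 : Real.exp (-(a - b)) ≥ 1 - (a - b) := by
      have := Real.add_one_le_exp (-(a - b)); linarith
    have h2 : Real.exp (-a) = Real.exp (-b) * Real.exp (-(a - b)) := by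
      rw [← Real.exp_add]; congr 1; ring
    have heb : Real.exp (-b) ≤ 1 := Real.exp_le_one_iff.2 (by linarith)
    have heb0 := Real.exp_pos (-b)
    rw [h2]
    have : 1 - Real.exp (-(a - b)) + (b - a) * Real.exp (-(a - b)) ≤ (b - a) ^ 2 := by
      nlinarith
    nlinarith [sq_nonneg (b - a)]

lemma ke_exp_lower (a b : ℝ) :
    0 ≤ Real.exp (-b) - Real.exp (-a) + (b - a) * Real.exp (-a) := by
  have hea0 := Real.exp_pos (-a)
  have hsplit : Real.exp (-b) = Real.exp (-a) * Real.exp (-(b - a)) := by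
    rw [← Real.exp_add]; congr 1; ring
  have := Real.add_one_le_exp (-(b - a))
  rw [hsplit]; nlinarith

lemma ke_exp_third (u : ℝ) (hu : |u| ≤ 1) :
    |Real.exp (-u) - 1 + u - u ^ 2 / 2| ≤ |u| * u ^ 2 := by
  have := Real.exp_bound (x := -u) (by simpa using hu) (n := 3) (by norm_num)
  simp only [Finset.sum_range_succ, Finset.range_zero, Finset.sum_empty, abs_neg] at this
  norm_num [Nat.factorial] at this
  have e : |u| ^ 3 = |u| * u ^ 2 := by rw [← sq_abs u]; ring
  have e2 : Real.exp (-u) - 1 + u - u ^ 2 / 2 = Real.exp (-u) - (1 + -u + u ^ 2 / 2) := by ring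
  rw [e2, ← e]
  have h3 : 0 ≤ |u| ^ 3 := by positivity
  linarith

/-- combined pointwise estimate -/
lemma ke_exp_fine (a b δ : ℝ) (ha : 0 ≤ a) (hb : 0 ≤ b) (hδ : δ ≤ 1) (hδ0 : 0 ≤ δ) :
    |Real.exp (-b) - Real.exp (-a) + (b - a) * Real.exp (-a)
      - Real.exp (-a) * (b - a) ^ 2 / 2| ≤
      δ * (b - a) ^ 2 + 2 * (if δ < |b - a| then (b - a) ^ 2 else 0) := by
  have hea : Real.exp (-a) ≤ 1 := Real.exp_le_one_iff.2 (by linarith)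
  have hea0 := Real.exp_pos (-a)
  have hsq := sq_nonneg (b - a)
  split_ifs with h
  · have h1 := ke_exp_upper a b ha hb
    have h2 := ke_exp_lower a b
    have h3 : Real.exp (-a) * (b - a) ^ 2 ≤ (b - a) ^ 2 := by nlinarith
    have h4 : 0 ≤ Real.exp (-a) * (b - a) ^ 2 := by positivity
    have h5 : 0 ≤ δ * (b - a) ^ 2 := by positivity
    rw [abs_le]; constructor <;> linarith
  · push Not at h
    have h1 := ke_exp_third (b - a) (h.trans hδ)
    have hsplit : Real.exp (-b) = Real.exp (-a) * Real.exp (-(b - a)) := by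
      rw [← Real.exp_add]; congr 1; ring
    have e : Real.exp (-b) - Real.exp (-a) + (b - a) * Real.exp (-a)
      - Real.exp (-a) * (b - a) ^ 2 / 2 = Real.exp (-a) *
        (Real.exp (-(b - a)) - 1 + (b - a) - (b - a) ^ 2 / 2) := by rw [hsplit]; ring
    rw [e, abs_mul, abs_of_pos hea0]
    have h2 : |b - a| * (b - a) ^ 2 ≤ δ * (b - a) ^ 2 := by gcongr
    have := abs_nonneg (Real.exp (-(b - a)) - 1 + (b - a) - (b - a) ^ 2 / 2)
    nlinarith

section moments
set_option linter.unusedSectionVars false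
variable {κ : Kernel ℕ ℕ} [IsMarkovKernel κ]

lemma ke_int_id (hmom : ∀ n : ℕ, Integrable (fun m : ℕ => (m : ℝ) ^ 2) (κ n)) (x : ℕ) :
    Integrable (fun m : ℕ => (m : ℝ)) (κ x) := by
  refine (hmom x).mono' .of_discrete (ae_of_all _ fun m => ?_)
  rw [Real.norm_of_nonneg (by positivity)]
  rcases Nat.eq_zero_or_pos m with h | h
  · simp [h]
  · have : (1 : ℝ) ≤ m := by exact_mod_cast h
    nlinarith

lemma ke_int_sq (hmom : ∀ n : ℕ, Integrable (fun m : ℕ => (m : ℝ) ^ 2) (κ n)) (x : ℕ) :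
    Integrable (fun m : ℕ => ((m : ℝ) - x) ^ 2) (κ x) := by
  have h : (fun m : ℕ => ((m : ℝ) - x) ^ 2)
      = fun m : ℕ => ((m : ℝ) ^ 2 - 2 * x * m) + (x : ℝ) ^ 2 := by
    funext m; ring
  rw [h]
  exact ((hmom x).sub ((ke_int_id hmom x).const_mul _)).add (integrable_const _)

lemma ke_int_of_le (hmom : ∀ n : ℕ, Integrable (fun m : ℕ => (m : ℝ) ^ 2) (κ n)) (x : ℕ)
    (C : ℝ) (f : ℕ → ℝ) (hf : ∀ m : ℕ, |f m| ≤ C * ((m : ℝ) - x) ^ 2) : Integrable f (κ x) :=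
  ((ke_int_sq hmom x).const_mul C).mono' .of_discrete (ae_of_all _ hf)

lemma ke_int_bdd {μ : Measure ℕ} [IsFiniteMeasure μ] (C : ℝ) (f : ℕ → ℝ)
    (hf : ∀ m : ℕ, |f m| ≤ C) : Integrable f μ :=
  Integrable.of_bound .of_discrete C (ae_of_all _ hf)

lemma ke_int_sub (hmom : ∀ n : ℕ, Integrable (fun m : ℕ => (m : ℝ) ^ 2) (κ n))
    (hmart : ∀ a : ℕ, ∫ m, (m : ℝ) ∂(κ a) = a) (x : ℕ) :
    ∫ m, ((m : ℝ) - x) ∂(κ x) = 0 := by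
  rw [integral_sub (ke_int_id hmom x) (integrable_const _), hmart]; simp

lemma ke_zero_ae (hmom : ∀ n : ℕ, Integrable (fun m : ℕ => (m : ℝ) ^ 2) (κ n))
    (hmart : ∀ a : ℕ, ∫ m, (m : ℝ) ∂(κ a) = a) : ∀ᵐ m ∂(κ 0), m = 0 := by
  have h := hmart 0
  rw [Nat.cast_zero, integral_eq_zero_iff_of_nonneg (fun m => by positivity)
    (ke_int_id hmom 0)] at h
  filter_upwards [h] with m hm
  simpa using hm

lemma ke_zero_integral (hmom : ∀ n : ℕ, Integrable (fun m : ℕ => (m : ℝ) ^ 2) (κ n))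
    (hmart : ∀ a : ℕ, ∫ m, (m : ℝ) ∂(κ a) = a) (f : ℕ → ℝ) : ∫ m, f m ∂(κ 0) = f 0 := by
  have : ∫ m, f m ∂(κ 0) = ∫ m, f 0 ∂(κ 0) := by
    apply integral_congr_ae
    filter_upwards [ke_zero_ae hmom hmart] with m hm
    rw [hm]
  rw [this]; simp

lemma ke_var_upper {σ : ℝ} (hmom : ∀ n : ℕ, Integrable (fun m : ℕ => (m : ℝ) ^ 2) (κ n))
    (hmart : ∀ a : ℕ, ∫ m, (m : ℝ) ∂(κ a) = a)
    (hvar : Tendsto (fun n : ℕ => (∫ m, ((m : ℝ) - n) ^ 2 ∂(κ n)) / n) atTop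
      (nhds (σ ^ 2))) :
    ∃ C : ℝ, 0 < C ∧ ∀ x : ℕ, ∫ m, ((m : ℝ) - x) ^ 2 ∂(κ x) ≤ C * x := by
  obtain ⟨C, hC⟩ := hvar.bddAbove_range
  refine ⟨max C 1, by positivity, fun x => ?_⟩
  rcases Nat.eq_zero_or_pos x with h | h
  · subst h
    rw [ke_zero_integral hmom hmart]; simp
  · have h' : (0 : ℝ) < x := by exact_mod_cast h
    have := hC ⟨x, rfl⟩
    simp only at this
    rw [div_le_iff₀ h'] at this
    exact this.trans (by gcongr; exact le_max_left _ _)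

lemma ke_neg_lower {σ : ℝ} (hσ : 0 < σ)
    (hmom : ∀ n : ℕ, Integrable (fun m : ℕ => (m : ℝ) ^ 2) (κ n))
    (hmart : ∀ a : ℕ, ∫ m, (m : ℝ) ∂(κ a) = a)
    (hlb : ∃ s : ℝ, 0 < s ∧ ∀ n : ℕ, 1 ≤ n → s ≤ ∫ m, ((m : ℝ) - n) ^ 2 ∂(κ n))
    (hclt : ∀ f : BoundedContinuousFunction ℝ ℝ,
      Tendsto (fun n : ℕ => ∫ m, f (((m : ℝ) - n) / Real.sqrt n) ∂(κ n)) atTop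
        (nhds (∫ x, f x ∂(gaussianReal 0 (Real.toNNReal (σ ^ 2)))))) :
    ∃ c : ℝ, 0 < c ∧ ∀ x : ℕ, c * x ≤ ∫ m, (max ((x : ℝ) - m) 0) ^ 2 ∂(κ x) := by
  let f : BoundedContinuousFunction ℝ ℝ :=
    BoundedContinuousFunction.ofNormedAddCommGroup (fun z => min ((max (-z) 0) ^ 2) 1)
      (by fun_prop) 1 (fun z => by
        rw [Real.norm_of_nonneg (by positivity)]; exact min_le_right _ _)
  have hf : ∀ z, f z = min ((max (-z) 0) ^ 2) 1 := fun z => rfl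
  have hf0 : ∀ z, 0 ≤ f z := fun z => by rw [hf]; positivity
  have hlim := hclt f
  set ℓ := ∫ x, f x ∂(gaussianReal 0 (Real.toNNReal (σ ^ 2)))
  have hℓ : 0 < ℓ := by
    refine (integral_pos_iff_support_of_nonneg hf0 (f.integrable _)).2 ?_
    have hne : Real.toNNReal (σ ^ 2) ≠ 0 := by
      simp; positivity
    have hv : 0 < volume (Set.Ioo (-1 : ℝ) 0) := by simp
    have hsub : Set.Ioo (-1 : ℝ) 0 ⊆ Function.support f := by
      intro z hz
      have hz1 : 0 < -z := by linarith [hz.2]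
      rw [Function.mem_support, hf, max_eq_left hz1.le]
      have : 0 < min ((-z) ^ 2) 1 := by positivity
      exact this.ne'
    refine lt_of_lt_of_le ?_ (measure_mono hsub)
    rw [pos_iff_ne_zero] at hv ⊢
    exact fun h => hv (gaussianReal_absolutelyContinuous' 0 hne h)
  have hpos : ∀ n : ℕ, 1 ≤ n → 0 < ∫ m, f (((m : ℝ) - n) / Real.sqrt n) ∂(κ n) := by
    intro n hn
    have hn0 : (0 : ℝ) < n := by exact_mod_cast hn
    have hs : 0 < Real.sqrt n := Real.sqrt_pos.2 hn0
    have hint : Integrable (fun m : ℕ => f (((m : ℝ) - n) / Real.sqrt n)) (κ n) :=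
      ke_int_bdd 1 _ fun m => by
        rw [abs_of_nonneg (hf0 _), hf]; exact min_le_right _ _
    have h0 : 0 ≤ ∫ m, f (((m : ℝ) - n) / Real.sqrt n) ∂(κ n) :=
      integral_nonneg fun m => hf0 _
    refine lt_of_le_of_ne h0 fun h => ?_
    have h1 := (integral_eq_zero_iff_of_nonneg (f := fun m : ℕ => f (((m : ℝ) - n) / Real.sqrt n))
      (fun m => hf0 _) hint).1 h.symm
    have h2 : ∀ᵐ m : ℕ ∂(κ n), (0 : ℝ) ≤ (m : ℝ) - n := by
      filter_upwards [h1] with m hm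
      by_contra hc
      push Not at hc
      have hq : ((m : ℝ) - n) / Real.sqrt n < 0 := div_neg_of_neg_of_pos hc hs
      have : 0 < f (((m : ℝ) - n) / Real.sqrt n) := by
        rw [hf, max_eq_left (by linarith)]
        have : 0 < -(((m : ℝ) - n) / Real.sqrt n) := by linarith
        positivity
      simp at hm; linarith
    have h3 := (integral_eq_zero_iff_of_nonneg_ae h2
      ((ke_int_id hmom n).sub (integrable_const _))).1 (ke_int_sub hmom hmart n)
    have h4 : ∫ m, ((m : ℝ) - n) ^ 2 ∂(κ n) = 0 := by
      rw [integral_eq_zero_of_ae]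
      filter_upwards [h3] with m hm
      simp at hm ⊢; exact hm
    obtain ⟨s, hs, hs2⟩ := hlb
    linarith [hs2 n hn]
  obtain ⟨B, hB⟩ := (hlim.inv₀ hℓ.ne').bddAbove_range
  have hBpos : 0 < B := lt_of_lt_of_le (inv_pos.2 (hpos 1 le_rfl)) (hB ⟨1, rfl⟩)
  refine ⟨B⁻¹, by positivity, fun x => ?_⟩
  rcases Nat.eq_zero_or_pos x with h | h
  · subst h
    simp only [Nat.cast_zero, mul_zero]
    exact integral_nonneg fun m => by positivity
  have hx0 : (0 : ℝ) < x := by exact_mod_cast h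
  have hs : 0 < Real.sqrt x := Real.sqrt_pos.2 hx0
  have h1 : B⁻¹ ≤ ∫ m, f (((m : ℝ) - x) / Real.sqrt x) ∂(κ x) := by
    have := hB ⟨x, rfl⟩
    simp only at this
    exact (inv_le_comm₀ (hpos x h) hBpos).1 this
  have h2 : (x : ℝ) * ∫ m, f (((m : ℝ) - x) / Real.sqrt x) ∂(κ x) ≤
      ∫ m, (max ((x : ℝ) - m) 0) ^ 2 ∂(κ x) := by
    rw [← integral_const_mul]
    refine integral_mono ((ke_int_bdd 1 _ fun m => by
        rw [abs_of_nonneg (hf0 _), hf]; exact min_le_right _ _).const_mul _)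
      (ke_int_of_le hmom x 1 _ fun m => ?_) fun m => ?_
    · rw [abs_of_nonneg (by positivity), one_mul]
      rcases le_total ((x : ℝ) - m) 0 with h | h
      · rw [max_eq_right h]; nlinarith [sq_nonneg ((m : ℝ) - x)]
      · rw [max_eq_left h]; apply le_of_eq; ring
    · simp only
      rw [hf]
      have e : max (-(((m : ℝ) - x) / Real.sqrt x)) 0 = (max ((x : ℝ) - m) 0) / Real.sqrt x := by
        rw [← neg_div, neg_sub]
        rw [← max_div_div_right hs.le, zero_div]
      rw [e, div_pow, Real.sq_sqrt hx0.le]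
      calc (x : ℝ) * min ((max ((x : ℝ) - m) 0) ^ 2 / x) 1
          ≤ x * ((max ((x : ℝ) - m) 0) ^ 2 / x) := by gcongr; exact min_le_left _ _
        _ = _ := by field_simp
  nlinarith

lemma ke_lindeberg {σ : ℝ} 
    (hmom : ∀ n : ℕ, Integrable (fun m : ℕ => (m : ℝ) ^ 2) (κ n))
    (hvar : Tendsto (fun n : ℕ => (∫ m, ((m : ℝ) - n) ^ 2 ∂(κ n)) / n) atTop
      (nhds (σ ^ 2)))
    (hclt : ∀ f : BoundedContinuousFunction ℝ ℝ,
      Tendsto (fun n : ℕ => ∫ m, f (((m : ℝ) - n) / Real.sqrt n) ∂(κ n)) atTop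
        (nhds (∫ x, f x ∂(gaussianReal 0 (Real.toNNReal (σ ^ 2))))))
    (ε : ℝ) (hε : 0 < ε) :
    ∃ R : ℝ, 0 < R ∧ ∀ᶠ x : ℕ in atTop,
      ∫ m, (if R * Real.sqrt x < |(m : ℝ) - x| then ((m : ℝ) - x) ^ 2 else 0) ∂(κ x) ≤ ε * x := by
  let f : ℕ → BoundedContinuousFunction ℝ ℝ := fun L =>
    BoundedContinuousFunction.ofNormedAddCommGroup (fun z => min (z ^ 2) ((L : ℝ) ^ 2))
      (by fun_prop) ((L : ℝ) ^ 2) (fun z => by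
        rw [Real.norm_of_nonneg (by positivity)]; exact min_le_right _ _)
  have hf : ∀ L z, f L z = min (z ^ 2) ((L : ℝ) ^ 2) := fun L z => rfl
  set g := gaussianReal 0 (Real.toNNReal (σ ^ 2))
  have hgint : Integrable (fun z : ℝ => z ^ 2) g :=
    (memLp_id_gaussianReal (μ := 0) (v := Real.toNNReal (σ ^ 2)) 2).integrable_sq
  have hg2 : ∫ z, z ^ 2 ∂g = σ ^ 2 := by
    have h := variance_id_gaussianReal (μ := 0) (v := Real.toNNReal (σ ^ 2))
    rw [variance_eq_integral (by fun_prop)] at h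
    simp only [id, integral_id_gaussianReal, sub_zero] at h
    rw [h, Real.coe_toNNReal _ (sq_nonneg σ)]
  have hlim : Tendsto (fun L : ℕ => ∫ z, f L z ∂g) atTop (nhds (σ ^ 2)) := by
    rw [← hg2]
    refine tendsto_integral_of_dominated_convergence (fun z => z ^ 2)
      (fun L => (f L).continuous.aestronglyMeasurable) hgint
      (fun L => ae_of_all _ fun z => ?_) (ae_of_all _ fun z => ?_)
    · rw [hf, Real.norm_of_nonneg (by positivity)]; exact min_le_left _ _
    · apply tendsto_const_nhds.congr'
      filter_upwards [eventually_ge_atTop ⌈|z|⌉₊] with L hL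
      rw [hf, min_eq_left]
      rw [← sq_abs z]
      have : |z| ≤ L := (Nat.le_ceil _).trans (by exact_mod_cast hL)
      gcongr
  obtain ⟨L, hL1, hL⟩ := ((eventually_ge_atTop 1).and
    (hlim.eventually (lt_mem_nhds (show σ ^ 2 - ε / 4 < σ ^ 2 by linarith)))).exists
  have hL0 : (0 : ℝ) < L := by exact_mod_cast hL1
  refine ⟨2 * L, by positivity, ?_⟩
  filter_upwards [(hclt (f L)).eventually (lt_mem_nhds hL),
    hvar.eventually (gt_mem_nhds (show σ ^ 2 < σ ^ 2 + ε / 4 by linarith)),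
    eventually_ge_atTop 1] with x h1 h2 h3
  have hx0 : (0 : ℝ) < x := by exact_mod_cast h3
  have hs : 0 < Real.sqrt x := Real.sqrt_pos.2 hx0
  rw [div_lt_iff₀ hx0] at h2
  have hint1 : Integrable (fun m : ℕ => (f L) (((m : ℝ) - x) / Real.sqrt x)) (κ x) :=
    ke_int_bdd ((L : ℝ) ^ 2) _ fun m => by
        rw [hf, abs_of_nonneg (by positivity)]; exact min_le_right _ _
  have h4 : ∫ m, (if 2 * L * Real.sqrt x < |(m : ℝ) - x| then ((m : ℝ) - x) ^ 2 else 0) ∂(κ x)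
      ≤ ∫ m, (2 * (((m : ℝ) - x) ^ 2 - x * (f L) (((m : ℝ) - x) / Real.sqrt x))) ∂(κ x) := by
    refine integral_mono (ke_int_of_le hmom x 1 _ fun m => ?_)
      (((ke_int_sq hmom x).sub (hint1.const_mul _)).const_mul _) fun m => ?_
    · split_ifs
      · rw [abs_of_nonneg (by positivity), one_mul]
      · simp; positivity
    · simp only
      rw [hf, div_pow, Real.sq_sqrt hx0.le]
      set y := (m : ℝ) - x
      split_ifs with hy
      · have hy2 : 4 * L ^ 2 * x < y ^ 2 := by
          rw [← sq_abs y]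
          calc 4 * (L : ℝ) ^ 2 * x = (2 * L * Real.sqrt x) ^ 2 := by
                rw [mul_pow, Real.sq_sqrt hx0.le]; ring
            _ < _ := by gcongr
        have : (x : ℝ) * min (y ^ 2 / x) (L ^ 2) ≤ x * L ^ 2 := by
          gcongr; exact min_le_right _ _
        nlinarith
      · have : (x : ℝ) * min (y ^ 2 / x) (L ^ 2) ≤ x * (y ^ 2 / x) := by
          gcongr; exact min_le_left _ _
        have e : x * (y ^ 2 / x) = y ^ 2 := by field_simp
        linarith
  rw [integral_const_mul, integral_sub (ke_int_sq hmom x) (hint1.const_mul _),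
    integral_const_mul] at h4
  nlinarith

/-- supersolution step -/
lemma ke_super_step (hmom : ∀ n : ℕ, Integrable (fun m : ℕ => (m : ℝ) ^ 2) (κ n))
    (hmart : ∀ a : ℕ, ∫ m, (m : ℝ) ∂(κ a) = a) (c a : ℝ)
    (hc : ∀ x : ℕ, c * x ≤ ∫ m, (max ((x : ℝ) - m) 0) ^ 2 ∂(κ x))
    (ha : 0 < a) (ha1 : a ≤ 1 / 4) (hac : 4 * a ≤ c) (l l' : ℝ) (hl : 0 < l) (hl1 : l ≤ 1)
    (hl' : l - a * l ^ 2 ≤ l') (x : ℕ) :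
    (max (1 - l' * x) 0) ^ 2 ≤ ∫ m, (max (1 - l * m) 0) ^ 2 ∂(κ x) := by
  have hx0 : (0 : ℝ) ≤ x := by positivity
  have hintN : Integrable (fun m : ℕ => (max ((x : ℝ) - m) 0) ^ 2) (κ x) := by
    refine ke_int_of_le hmom x 1 _ fun m => ?_
    rw [abs_of_nonneg (by positivity), one_mul]
    rcases le_total ((x : ℝ) - m) 0 with h | h
    · rw [max_eq_right h]; nlinarith [sq_nonneg ((m : ℝ) - x)]
    · rw [max_eq_left h]; apply le_of_eq; ring
  have hintL : Integrable (fun m : ℕ => (max (1 - l * m) 0) ^ 2) (κ x) := by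
    refine ke_int_bdd 1 _ fun m => ?_
    rw [abs_of_nonneg (by positivity)]
    have : max (1 - l * (m : ℝ)) 0 ≤ 1 := max_le (by nlinarith [show (0:ℝ) ≤ l * m by positivity]) zero_le_one
    exact pow_le_one₀ (le_max_right _ _) this
  have hmono : max (1 - l' * x) 0 ≤ max (1 - l * x + a * l ^ 2 * x) 0 := by
    apply max_le_max_right; nlinarith
  have hsq : (max (1 - l' * x) 0) ^ 2 ≤ (max (1 - l * x + a * l ^ 2 * x) 0) ^ 2 :=
    pow_le_pow_left₀ (le_max_right _ _) hmono 2
  refine hsq.trans ?_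
  set w := 1 - l * x with hw
  set b := a * l ^ 2 * x with hb
  have hb0 : 0 ≤ b := by positivity
  have hN := hc x
  rcases le_or_gt 0 w with hw0 | hw0
  · rw [max_eq_left (by linarith)]
    have h1 : ∫ m, ((w ^ 2 - 2 * w * l * ((m : ℝ) - x)) + l ^ 2 * (max ((x : ℝ) - m) 0) ^ 2) ∂(κ x)
        ≤ ∫ m, (max (1 - l * m) 0) ^ 2 ∂(κ x) := by
      refine integral_mono (((integrable_const _).sub
        (((ke_int_id hmom x).sub (integrable_const _)).const_mul _)).add
          (hintN.const_mul _)) hintL fun m => ?_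
      simp only
      have e : 1 - l * (m : ℝ) = w + l * (x - m) := by rw [hw]; ring
      rw [e]
      rcases le_total ((x : ℝ) - m) 0 with h | h
      · rw [max_eq_right h]
        rcases le_total (w + l * (x - m)) 0 with h2 | h2
        · rw [max_eq_right h2]; nlinarith
        · rw [max_eq_left h2]; nlinarith [sq_nonneg (l * ((x : ℝ) - m))]
      · rw [max_eq_left h, max_eq_left (by positivity)]
        apply le_of_eq; ring
    have hi1 : Integrable (fun m : ℕ => 2 * w * l * ((m : ℝ) - x)) (κ x) :=
      ((ke_int_id hmom x).sub (integrable_const _)).const_mul _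
    have hi2 : Integrable (fun m : ℕ => w ^ 2 - 2 * w * l * ((m : ℝ) - x)) (κ x) :=
      (integrable_const _).sub hi1
    rw [integral_add hi2 (hintN.const_mul _),
      integral_sub (integrable_const _) hi1,
      integral_const_mul, integral_const_mul, ke_int_sub hmom hmart] at h1
    simp only [integral_const, probReal_univ, one_smul, mul_zero, sub_zero] at h1
    refine le_trans ?_ h1
    have hlx : l * x ≤ 1 := by linarith
    have hlx0 : 0 ≤ l * x := by positivity
    have hb1 : b ≤ 1 := by
      rw [hb]; have : a * l ^ 2 * x = (a * l) * (l * x) := by ring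
      rw [this]
      have : a * l ≤ 1 := by nlinarith
      have : 0 ≤ a * l := by positivity
      nlinarith
    have h3 : (w + b) ^ 2 ≤ w ^ 2 + 3 * b := by nlinarith
    have h4 : 3 * b ≤ l ^ 2 * (c * x) := by
      rw [hb]; 
      have : 0 ≤ l ^ 2 * x := by positivity
      nlinarith
    have h5 : l ^ 2 * (c * x) ≤ l ^ 2 * ∫ m, (max ((x : ℝ) - m) 0) ^ 2 ∂(κ x) := by gcongr
    linarith
  · rcases le_total (w + b) 0 with hwb | hwb
    · rw [max_eq_right hwb]
      simp only [ne_eq, OfNat.ofNat_ne_zero, not_false_eq_true, zero_pow]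
      exact integral_nonneg fun m => by positivity
    rw [max_eq_left hwb]
    have hlx2 : l * x ≤ 2 := by
      have h1 : b = (a * l) * (l * x) := by rw [hb]; ring
      have h2 : a * l ≤ 1 / 4 := by nlinarith
      have h3 : 0 ≤ l * x := by positivity
      nlinarith
    have hbl : b ≤ l / 2 := by
      have h1 : b = (a * l) * (l * x) := by rw [hb]; ring
      have h3 : 0 ≤ l * x := by positivity
      have h2 : a * l ≤ l / 4 := by nlinarith
      rw [h1]; nlinarith
    have h1 : ∫ m, (l ^ 2 / 4 * (max ((x : ℝ) - m) 0) ^ 2) ∂(κ x)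
        ≤ ∫ m, (max (1 - l * m) 0) ^ 2 ∂(κ x) := by
      refine integral_mono (hintN.const_mul _) hintL fun m => ?_
      simp only
      have e : 1 - l * (m : ℝ) = w + l * (x - m) := by rw [hw]; ring
      rw [e]
      rcases Nat.lt_or_ge m x with h | h
      · have hmx : (m : ℝ) + 1 ≤ x := by exact_mod_cast h
        rw [max_eq_left (by linarith)]
        have h6 : l * (x - m) / 2 ≤ w + l * (x - m) := by nlinarith
        have h7 : 0 ≤ l * ((x : ℝ) - m) / 2 := by
          have : 0 ≤ (x : ℝ) - m := by linarith
          positivity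
        rw [max_eq_left (by linarith)]
        calc _ = (l * ((x : ℝ) - m) / 2) ^ 2 := by ring
          _ ≤ _ := by gcongr
      · have hmx : (x : ℝ) ≤ m := by exact_mod_cast h
        rw [max_eq_right (by linarith)]
        simp
    rw [integral_const_mul] at h1
    refine le_trans ?_ h1
    have h3 : (w + b) ^ 2 ≤ b ^ 2 := by gcongr; linarith
    have h4 : b ^ 2 ≤ b := by nlinarith
    have h5 : b ≤ l ^ 2 / 4 * (c * x) := by
      rw [hb]
      have : 0 ≤ l ^ 2 * x := by positivity
      nlinarith
    have h6 : l ^ 2 / 4 * (c * x) ≤ l ^ 2 / 4 * ∫ m, (max ((x : ℝ) - m) 0) ^ 2 ∂(κ x) := by gcongr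
    linarith

/-- one-step error of the exponential ansatz -/
noncomputable def keErr (κ : Kernel ℕ ℕ) (σ l : ℝ) (x : ℕ) : ℝ :=
  ∫ m, Real.exp (-(l * m)) ∂(κ x) - Real.exp (-(l / (1 + σ ^ 2 / 2 * l) * x))

lemma ke_int_exp {μ : Measure ℕ} [IsFiniteMeasure μ] (l : ℝ) (hl : 0 ≤ l) :
    Integrable (fun m : ℕ => Real.exp (-(l * m))) μ := by
  refine ke_int_bdd 1 _ fun m => ?_
  rw [abs_of_pos (Real.exp_pos _)]
  apply Real.exp_le_one_iff.2
  have : 0 ≤ l * m := by positivity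
  linarith

lemma ke_exp_expansion (hmom : ∀ n : ℕ, Integrable (fun m : ℕ => (m : ℝ) ^ 2) (κ n))
    (hmart : ∀ a : ℕ, ∫ m, (m : ℝ) ∂(κ a) = a) (l : ℝ) (hl : 0 ≤ l) (x : ℕ) :
    Integrable (fun m : ℕ => Real.exp (-(l * m)) - Real.exp (-(l * x))
      + (l * m - l * x) * Real.exp (-(l * x))) (κ x) ∧
    ∫ m, (Real.exp (-(l * m)) - Real.exp (-(l * x))
      + (l * m - l * x) * Real.exp (-(l * x))) ∂(κ x) =
      ∫ m, Real.exp (-(l * m)) ∂(κ x) - Real.exp (-(l * x)) := by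
  have h1 : Integrable (fun m : ℕ => Real.exp (-(l * m)) - Real.exp (-(l * x))) (κ x) :=
    (ke_int_exp l hl).sub (integrable_const _)
  have h2 : Integrable (fun m : ℕ => (l * Real.exp (-(l * x))) * ((m : ℝ) - x)) (κ x) :=
    ((ke_int_id hmom x).sub (integrable_const _)).const_mul _
  have e : (fun m : ℕ => Real.exp (-(l * m)) - Real.exp (-(l * x))
      + (l * m - l * x) * Real.exp (-(l * x))) = fun m : ℕ =>
      (Real.exp (-(l * m)) - Real.exp (-(l * x))) + (l * Real.exp (-(l * x))) * ((m : ℝ) - x) := by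
    funext m; ring
  rw [e]
  refine ⟨h1.add h2, ?_⟩
  rw [integral_add h1 h2, integral_const_mul, ke_int_sub hmom hmart,
    integral_sub (ke_int_exp l hl) (integrable_const _)]
  simp

lemma ke_lam (σ l : ℝ) (hl : 0 ≤ l) :
    0 ≤ l / (1 + σ ^ 2 / 2 * l) ∧ l / (1 + σ ^ 2 / 2 * l) ≤ l ∧
    l - l / (1 + σ ^ 2 / 2 * l) ≤ σ ^ 2 / 2 * l ^ 2 ∧
    σ ^ 2 / 2 * l ^ 2 - (l - l / (1 + σ ^ 2 / 2 * l)) ≤ (σ ^ 2 / 2) ^ 2 * l ^ 3 := by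
  have hd : 0 < 1 + σ ^ 2 / 2 * l := by positivity
  have hle : l / (1 + σ ^ 2 / 2 * l) ≤ l := by
    rw [div_le_iff₀ hd]; nlinarith [show 0 ≤ σ ^ 2 / 2 * l * l by positivity]
  set q := l / (1 + σ ^ 2 / 2 * l) with hq
  have e : q * (1 + σ ^ 2 / 2 * l) = l := by rw [hq]; field_simp
  have hq0 : 0 ≤ q := by rw [hq]; positivity
  set t := σ ^ 2 / 2 with ht
  have ht0 : 0 ≤ t := by rw [ht]; positivity
  have e1 : l - q = t * l * q := by linarith
  have h2 : t * l * q ≤ t * l * l := by gcongr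
  refine ⟨hq0, hle, by nlinarith, ?_⟩
  have e2 : t * l ^ 2 - (l - q) = t * l * (l - q) := by 
    linear_combination (-1 : ℝ) * e1
  rw [e2]
  have : l - q ≤ t * l * l := by linarith
  calc t * l * (l - q) ≤ t * l * (t * l * l) := by gcongr
    _ = _ := by ring

lemma ke_err_crude {σ : ℝ} (hmom : ∀ n : ℕ, Integrable (fun m : ℕ => (m : ℝ) ^ 2) (κ n))
    (hmart : ∀ a : ℕ, ∫ m, (m : ℝ) ∂(κ a) = a) (C : ℝ) (hC0 : 0 < C)
    (hC : ∀ x : ℕ, ∫ m, ((m : ℝ) - x) ^ 2 ∂(κ x) ≤ C * x) (l : ℝ) (hl : 0 ≤ l) (x : ℕ) :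
    |keErr κ σ l x| ≤ l ^ 2 * ((C + σ ^ 2) * x) := by
  obtain ⟨hi, he⟩ := ke_exp_expansion hmom hmart l hl x
  obtain ⟨hq0, hq1, hq2, -⟩ := ke_lam σ l hl
  have h0 : 0 ≤ ∫ m, (Real.exp (-(l * m)) - Real.exp (-(l * x))
      + (l * m - l * x) * Real.exp (-(l * x))) ∂(κ x) :=
    integral_nonneg fun m => ke_exp_lower _ _
  have h1 : ∫ m, (Real.exp (-(l * m)) - Real.exp (-(l * x))
      + (l * m - l * x) * Real.exp (-(l * x))) ∂(κ x) ≤ ∫ m, l ^ 2 * ((m : ℝ) - x) ^ 2 ∂(κ x) := by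
    refine integral_mono hi ((ke_int_sq hmom x).const_mul _) fun m => ?_
    refine (ke_exp_upper _ _ (by positivity) (by positivity)).trans (le_of_eq ?_)
    ring
  rw [integral_const_mul] at h1
  rw [he] at h0 h1
  have h2 : l ^ 2 * ∫ m, ((m : ℝ) - x) ^ 2 ∂(κ x) ≤ l ^ 2 * (C * x) := by gcongr; exact hC x
  unfold keErr
  set q := l / (1 + σ ^ 2 / 2 * l)
  have hx : (0 : ℝ) ≤ x := by positivity
  have h3 : Real.exp (-(l * x)) ≤ Real.exp (-(q * x)) := by
    apply Real.exp_le_exp.2; nlinarith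
  have h4 : Real.exp (-(q * x)) - Real.exp (-(l * x)) ≤ (l - q) * x := by
    have e : Real.exp (-(l * x)) = Real.exp (-(q * x)) * Real.exp (-((l - q) * x)) := by
      rw [← Real.exp_add]; congr 1; ring
    have h5 : Real.exp (-(q * x)) ≤ 1 := Real.exp_le_one_iff.2 (by nlinarith)
    have h6 := Real.add_one_le_exp (-((l - q) * x))
    have h7 := Real.exp_pos (-(q * x))
    have h8 : 0 ≤ (l - q) * x := mul_nonneg (by linarith) hx
    rw [e]; nlinarith
  have h5 : (l - q) * x ≤ σ ^ 2 / 2 * l ^ 2 * x := by gcongr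
  have h6 : 0 ≤ σ ^ 2 * l ^ 2 * x := by positivity
  have h7 : 0 ≤ l ^ 2 * C * x := by positivity
  rw [abs_le]; constructor <;> nlinarith

lemma ke_err_fine {σ : ℝ} (hmom : ∀ n : ℕ, Integrable (fun m : ℕ => (m : ℝ) ^ 2) (κ n))
    (hmart : ∀ a : ℕ, ∫ m, (m : ℝ) ∂(κ a) = a) (C : ℝ) 
    (hC : ∀ x : ℕ, ∫ m, ((m : ℝ) - x) ^ 2 ∂(κ x) ≤ C * x) (l : ℝ) (hl : 0 ≤ l) (x : ℕ)
    (δ η R K : ℝ) (hδ0 : 0 ≤ δ) (hδ1 : δ ≤ 1) 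
    (hR : ∫ m, (if R * Real.sqrt x < |(m : ℝ) - x| then ((m : ℝ) - x) ^ 2 else 0) ∂(κ x) ≤ η * x)
    (hV : |∫ m, ((m : ℝ) - x) ^ 2 ∂(κ x) - σ ^ 2 * x| ≤ η * x)
    (hRl : l * (R * Real.sqrt x) ≤ δ) (hK : l * x ≤ K)
    (hl1 : σ ^ 2 / 2 * l * K ≤ 1) (hl2 : (σ ^ 2 / 2) ^ 2 * l * (K + 1) ≤ η) :
    |keErr κ σ l x| ≤ l ^ 2 * ((δ * C + 4 * η) * x) := by
  obtain ⟨hi, he⟩ := ke_exp_expansion hmom hmart l hl x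
  obtain ⟨hq0, hq1, hq2, hq3⟩ := ke_lam σ l hl
  have hx : (0 : ℝ) ≤ x := by positivity
  have hE0 := Real.exp_pos (-(l * x))
  have hE1 : Real.exp (-(l * x)) ≤ 1 := Real.exp_le_one_iff.2 (by nlinarith)
  have hind : Integrable (fun m : ℕ => (if R * Real.sqrt x < |(m : ℝ) - x| then
      ((m : ℝ) - x) ^ 2 else 0)) (κ x) := by
    refine ke_int_of_le hmom x 1 _ fun m => ?_
    split_ifs
    · rw [abs_of_nonneg (by positivity), one_mul]
    · simp; positivity
  have hVi := ke_int_sq hmom x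
  -- first comparison
  have hA : |∫ m, ((Real.exp (-(l * m)) - Real.exp (-(l * x))
      + (l * m - l * x) * Real.exp (-(l * x))) -
        (Real.exp (-(l * x)) * l ^ 2 / 2) * ((m : ℝ) - x) ^ 2) ∂(κ x)| ≤
      ∫ m, (δ * l ^ 2 * ((m : ℝ) - x) ^ 2 + 2 * l ^ 2 * (if R * Real.sqrt x < |(m : ℝ) - x| then
      ((m : ℝ) - x) ^ 2 else 0)) ∂(κ x) := by
    refine (abs_integral_le_integral_abs).trans ?_
    refine integral_mono (hi.sub (hVi.const_mul _)).abs
      ((hVi.const_mul _).add (hind.const_mul _)) fun m => ?_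
    simp only
    have := ke_exp_fine (l * x) (l * m) δ (by positivity) (by positivity) hδ1 hδ0
    have e : (l * m - l * x) ^ 2 = l ^ 2 * ((m : ℝ) - x) ^ 2 := by ring
    have e2 : |l * m - l * x| = l * |(m : ℝ) - x| := by
      rw [← mul_sub, abs_mul, abs_of_nonneg hl]
    rw [e, e2] at this
    have e3 : (Real.exp (-(l * x)) * l ^ 2 / 2) * ((m : ℝ) - x) ^ 2 =
      Real.exp (-(l * x)) * (l ^ 2 * ((m : ℝ) - x) ^ 2) / 2 := by ring
    rw [e3]
    refine this.trans ?_
    have : (if δ < l * |(m : ℝ) - x| then l ^ 2 * ((m : ℝ) - x) ^ 2 else 0) ≤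
        l ^ 2 * (if R * Real.sqrt x < |(m : ℝ) - x| then ((m : ℝ) - x) ^ 2 else 0) := by
      by_cases h : R * Real.sqrt x < |(m : ℝ) - x|
      · rw [if_pos h]; split_ifs
        · exact le_rfl
        · positivity
      · rw [if_neg h, if_neg]
        · simp
        · push Not at h ⊢
          exact (mul_le_mul_of_nonneg_left h hl).trans hRl
    linarith
  rw [integral_sub hi (hVi.const_mul _), he, integral_add (hVi.const_mul _) (hind.const_mul _),
    integral_const_mul, integral_const_mul, integral_const_mul] at hA
  have hVC := hC x
  set V := ∫ m, ((m : ℝ) - x) ^ 2 ∂(κ x)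
  set J := ∫ m, (if R * Real.sqrt x < |(m : ℝ) - x| then ((m : ℝ) - x) ^ 2 else 0) ∂(κ x)
  set E := Real.exp (-(l * x))
  have hA2 : δ * l ^ 2 * V + 2 * l ^ 2 * J ≤ l ^ 2 * ((δ * C + 2 * η) * x) := by
    have h1 : δ * l ^ 2 * V ≤ δ * l ^ 2 * (C * x) := by gcongr
    have h2 : 2 * l ^ 2 * J ≤ 2 * l ^ 2 * (η * x) := by gcongr
    linarith
  have hηx : 0 ≤ η * x := le_trans (abs_nonneg _) hV
  have hB : |E * l ^ 2 / 2 * V - E * l ^ 2 / 2 * (σ ^ 2 * x)| ≤ l ^ 2 * (η * x) / 2 := by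
    rw [← mul_sub, abs_mul, abs_of_nonneg (by positivity)]
    calc E * l ^ 2 / 2 * |V - σ ^ 2 * x| ≤ 1 * l ^ 2 / 2 * (η * x) := by gcongr
      _ = _ := by ring
  unfold keErr
  set q := l / (1 + σ ^ 2 / 2 * l)
  have hD : |Real.exp (-(q * x)) - E - E * l ^ 2 / 2 * (σ ^ 2 * x)| ≤ l ^ 2 * (η * x) := by
    have e : Real.exp (-(q * x)) = E * Real.exp ((l - q) * x) := by
      rw [← Real.exp_add]; congr 1; ring
    have e2 : Real.exp (-(q * x)) - E - E * l ^ 2 / 2 * (σ ^ 2 * x) =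
      E * ((Real.exp ((l - q) * x) - 1 - (l - q) * x) + ((l - q) * x - σ ^ 2 / 2 * l ^ 2 * x)) := by
      rw [e]; ring
    have ht0 : 0 ≤ (l - q) * x := mul_nonneg (by linarith) hx
    have ht : (l - q) * x ≤ σ ^ 2 / 2 * l ^ 2 * x := by gcongr
    have htt : σ ^ 2 / 2 * l ^ 2 * x ≤ σ ^ 2 / 2 * l * K := by
      calc _ = σ ^ 2 / 2 * l * (l * x) := by ring
        _ ≤ _ := by gcongr
    have h1 := Real.abs_exp_sub_one_sub_id_le (x := (l - q) * x)
      (by rw [abs_of_nonneg ht0]; linarith)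
    have h2 : ((l - q) * x) ^ 2 ≤ (σ ^ 2 / 2) ^ 2 * l ^ 3 * x * K := by
      calc ((l - q) * x) ^ 2 ≤ (σ ^ 2 / 2 * l ^ 2 * x) ^ 2 := by gcongr
        _ = (σ ^ 2 / 2) ^ 2 * l ^ 3 * x * (l * x) := by ring
        _ ≤ _ := by gcongr
    have h3 : |(l - q) * x - σ ^ 2 / 2 * l ^ 2 * x| ≤ (σ ^ 2 / 2) ^ 2 * l ^ 3 * x := by
      rw [abs_of_nonpos (by linarith)]
      calc _ = (σ ^ 2 / 2 * l ^ 2 - (l - q)) * x := by ring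
        _ ≤ _ := by gcongr
    rw [e2, abs_mul, abs_of_pos hE0]
    have h4 := abs_add_le (Real.exp ((l - q) * x) - 1 - (l - q) * x)
      ((l - q) * x - σ ^ 2 / 2 * l ^ 2 * x)
    have h5 : (σ ^ 2 / 2) ^ 2 * l ^ 3 * x * K + (σ ^ 2 / 2) ^ 2 * l ^ 3 * x ≤ l ^ 2 * (η * x) := by
      calc _ = l ^ 2 * x * ((σ ^ 2 / 2) ^ 2 * l * (K + 1)) := by ring
        _ ≤ l ^ 2 * x * η := by gcongr
        _ = _ := by ring
    have h6 := abs_nonneg (Real.exp ((l - q) * x) - 1 - (l - q) * x +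
      ((l - q) * x - σ ^ 2 / 2 * l ^ 2 * x))
    nlinarith
  set I := ∫ m, Real.exp (-(l * m)) ∂(κ x)
  have hsum : I - Real.exp (-(q * x)) = (I - E - E * l ^ 2 / 2 * V) +
    (E * l ^ 2 / 2 * V - E * l ^ 2 / 2 * (σ ^ 2 * x)) -
    (Real.exp (-(q * x)) - E - E * l ^ 2 / 2 * (σ ^ 2 * x)) := by ring
  rw [hsum]
  have hl2η : 0 ≤ l ^ 2 * (η * x) := by positivity
  have := abs_le.1 hA; have := abs_le.1 hB; have := abs_le.1 hD
  rw [abs_le]; constructor <;> linarith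

lemma ke_err {σ : ℝ} (hmom : ∀ n : ℕ, Integrable (fun m : ℕ => (m : ℝ) ^ 2) (κ n))
    (hmart : ∀ a : ℕ, ∫ m, (m : ℝ) ∂(κ a) = a)
    (hvar : Tendsto (fun n : ℕ => (∫ m, ((m : ℝ) - n) ^ 2 ∂(κ n)) / n) atTop
      (nhds (σ ^ 2)))
    (hclt : ∀ f : BoundedContinuousFunction ℝ ℝ,
      Tendsto (fun n : ℕ => ∫ m, f (((m : ℝ) - n) / Real.sqrt n) ∂(κ n)) atTop
        (nhds (∫ x, f x ∂(gaussianReal 0 (Real.toNNReal (σ ^ 2))))))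
    (ε : ℝ) (hε : 0 < ε) :
    ∃ D l0 : ℝ, 0 ≤ D ∧ 0 < l0 ∧ ∀ l : ℝ, 0 ≤ l → l ≤ l0 → ∀ x : ℕ,
      |keErr κ σ l x| ≤ l ^ 2 * (ε * x + D * (if 0 < x then 1 else 0) + ε * l * x ^ 2) := by
  obtain ⟨C, hC0, hC⟩ := ke_var_upper hmom hmart hvar
  set C1 := C + σ ^ 2 with hC1
  have hC1pos : 0 < C1 := by positivity
  set K := C1 / ε with hKdef
  have hKpos : 0 < K := by positivity
  set η := ε / 8 with hη
  have hηpos : 0 < η := by positivity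
  set δ := min 1 (ε / (2 * C)) with hδ
  have hδpos : 0 < δ := by positivity
  have hδC : δ * C ≤ ε / 2 := by
    calc δ * C ≤ ε / (2 * C) * C := by gcongr; exact min_le_right _ _
      _ = ε / 2 := by field_simp
  obtain ⟨R, hR0, hR⟩ := ke_lindeberg hmom hvar hclt η hηpos
  have hV : ∀ᶠ x : ℕ in atTop, |∫ m, ((m : ℝ) - x) ^ 2 ∂(κ x) - σ ^ 2 * x| ≤ η * x := by
    filter_upwards [(Metric.tendsto_nhds.1 hvar) η hηpos, eventually_ge_atTop 1] with x h1 h2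
    have hx0 : (0 : ℝ) < x := by exact_mod_cast h2
    rw [Real.dist_eq] at h1
    have e : ∫ m, ((m : ℝ) - x) ^ 2 ∂(κ x) - σ ^ 2 * x =
      ((∫ m, ((m : ℝ) - x) ^ 2 ∂(κ x)) / x - σ ^ 2) * x := by field_simp
    rw [e, abs_mul, abs_of_pos hx0]
    gcongr
  obtain ⟨M, hM⟩ := eventually_atTop.1 ((hR.and hV).and
    (eventually_ge_atTop (⌈(R * K / δ) ^ 2⌉₊ + 1)))
  set t := σ ^ 2 / 2 with ht
  have ht0 : 0 ≤ t := by positivity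
  refine ⟨C1 * M, min (1 / (t * K + 1)) (η / (t ^ 2 * (K + 1) + 1)), by positivity,
    by positivity, fun l hl hl0 x => ?_⟩
  have hxnn : (0 : ℝ) ≤ x := by positivity
  have hcrude := ke_err_crude (σ := σ) hmom hmart C hC0 hC l hl x
  rcases Nat.eq_zero_or_pos x with h0 | h0
  · subst h0
    simpa using hcrude
  rw [if_pos h0]
  have hx0 : (0 : ℝ) < x := by exact_mod_cast h0
  rcases Nat.lt_or_ge x M with hxM | hxM
  · have : (x : ℝ) ≤ M := by exact_mod_cast hxM.le
    refine hcrude.trans ?_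
    gcongr
    have : C1 * (x : ℝ) ≤ C1 * M := by gcongr
    have : 0 ≤ ε * x := by positivity
    have : 0 ≤ ε * l * x ^ 2 := by positivity
    linarith
  rcases le_or_gt (l * x) K with hlK | hlK
  · obtain ⟨⟨h1, h2⟩, h3⟩ := hM x hxM
    have hs : 0 < Real.sqrt x := Real.sqrt_pos.2 hx0
    have h4 : R * K / δ ≤ Real.sqrt x := by
      apply Real.le_sqrt_of_sq_le
      have : (⌈(R * K / δ) ^ 2⌉₊ : ℝ) ≤ x := by exact_mod_cast (Nat.le_succ _).trans h3
      exact (Nat.le_ceil _).trans this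
    have h5 : l * (R * Real.sqrt x) ≤ δ := by
      rw [div_le_iff₀ hδpos] at h4
      have h6 : R * K ≤ Real.sqrt x * δ := h4
      have h7 : l * (R * Real.sqrt x) * Real.sqrt x ≤ δ * Real.sqrt x := by
        calc l * (R * Real.sqrt x) * Real.sqrt x = R * (l * (Real.sqrt x * Real.sqrt x)) := by ring
          _ = R * (l * x) := by rw [Real.mul_self_sqrt hxnn]
          _ ≤ R * K := by gcongr
          _ ≤ _ := by linarith
      exact le_of_mul_le_mul_right h7 hs
    have hla : l ≤ 1 / (t * K + 1) := hl0.trans (min_le_left _ _)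
    have hlb : l ≤ η / (t ^ 2 * (K + 1) + 1) := hl0.trans (min_le_right _ _)
    rw [le_div_iff₀ (by positivity)] at hla hlb
    have := ke_err_fine (σ := σ) hmom hmart C hC l hl x δ η R K hδpos.le (min_le_left _ _) h1 h2 h5 hlK
      (by rw [← ht]; nlinarith) (by rw [← ht]; nlinarith)
    refine this.trans ?_
    have : (δ * C + 4 * η) * x ≤ ε * x := by
      gcongr; rw [hη]; linarith
    have : 0 ≤ ε * l * x ^ 2 := by positivity
    have : 0 ≤ C1 * M := by positivity
    gcongr
    linarith
  · refine hcrude.trans ?_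
    have h1 : C1 ≤ ε * (l * x) := by
      rw [hKdef, div_lt_iff₀ hε] at hlK; linarith
    have h2 : C1 * (x : ℝ) ≤ ε * (l * x) * x := by gcongr
    have : 0 ≤ ε * x := by positivity
    have : 0 ≤ C1 * M := by positivity
    gcongr
    nlinarith

end moments

section chain
set_option linter.unusedSectionVars false
variable {κ : Kernel ℕ ℕ} [IsMarkovKernel κ]

/-- marginal laws of the chain from `1` -/
noncomputable def keMu (κ : Kernel ℕ ℕ) : ℕ → Measure ℕ
  | 0 => Measure.dirac 1
  | n + 1 => κ ∘ₘ keMu κ n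

instance keMu_prob (n : ℕ) : IsProbabilityMeasure (keMu κ n) := by
  induction n with
  | zero => unfold keMu; infer_instance
  | succ n ih => unfold keMu; infer_instance

lemma keMu_integral (n : ℕ) (f : ℕ → ℝ) (hf : Integrable f (keMu κ (n + 1))) :
    ∫ x, f x ∂(keMu κ (n + 1)) = ∫ x, (∫ m, f m ∂(κ x)) ∂(keMu κ n) := by
  have : keMu κ (n + 1) = κ ∘ₘ keMu κ n := rfl
  rw [this, Measure.comp_eq_comp_const_apply] at hf ⊢
  rw [Kernel.integral_comp hf]
  simp

lemma ke_second (hmom : ∀ n : ℕ, Integrable (fun m : ℕ => (m : ℝ) ^ 2) (κ n))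
    (hmart : ∀ a : ℕ, ∫ m, (m : ℝ) ∂(κ a) = a) (x : ℕ) :
    ∫ m, (m : ℝ) ^ 2 ∂(κ x) = x ^ 2 + ∫ m, ((m : ℝ) - x) ^ 2 ∂(κ x) := by
  have h : (fun m : ℕ => (m : ℝ) ^ 2)
      = fun m : ℕ => (2 * (x : ℝ) * (m - x) + (x : ℝ) ^ 2) + ((m : ℝ) - x) ^ 2 := by
    funext m; ring
  have h1 : Integrable (fun m : ℕ => 2 * (x : ℝ) * (m - x)) (κ x) :=
    ((ke_int_id hmom x).sub (integrable_const _)).const_mul _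
  have h2 : Integrable (fun m : ℕ => 2 * (x : ℝ) * (m - x) + (x : ℝ) ^ 2) (κ x) :=
    h1.add (integrable_const _)
  rw [h, integral_add h2 (ke_int_sq hmom x), integral_add h1 (integrable_const _),
    integral_const_mul, ke_int_sub hmom hmart]
  simp

lemma keMu_moments (hmom : ∀ n : ℕ, Integrable (fun m : ℕ => (m : ℝ) ^ 2) (κ n))
    (hmart : ∀ a : ℕ, ∫ m, (m : ℝ) ∂(κ a) = a) (C : ℝ)
    (hC : ∀ x : ℕ, ∫ m, ((m : ℝ) - x) ^ 2 ∂(κ x) ≤ C * x) (n : ℕ) :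
    Integrable (fun m : ℕ => (m : ℝ) ^ 2) (keMu κ n) ∧
    Integrable (fun m : ℕ => (m : ℝ)) (keMu κ n) ∧
    ∫ m, (m : ℝ) ∂(keMu κ n) = 1 ∧ ∫ m, (m : ℝ) ^ 2 ∂(keMu κ n) ≤ 1 + C * n := by
  have hid : ∀ μ : Measure ℕ, Integrable (fun m : ℕ => (m : ℝ) ^ 2) μ →
      Integrable (fun m : ℕ => (m : ℝ)) μ := by
    intro μ h
    refine h.mono' .of_discrete (ae_of_all _ fun m => ?_)
    rw [Real.norm_of_nonneg (by positivity)]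
    rcases Nat.eq_zero_or_pos m with h | h
    · simp [h]
    · have : (1 : ℝ) ≤ m := by exact_mod_cast h
      nlinarith
  induction n with
  | zero =>
    have h1 : Integrable (fun m : ℕ => (m : ℝ) ^ 2) (keMu κ 0) := by
      unfold keMu; exact integrable_dirac (by simp)
    refine ⟨h1, hid _ h1, ?_, ?_⟩ <;> simp [keMu]
  | succ n ih =>
    obtain ⟨i2, i1, e1, e2⟩ := ih
    have hb : Integrable (fun x : ℕ => (x : ℝ) ^ 2 + C * x) (keMu κ n) := i2.add (i1.const_mul _)
    have hle : ∀ x : ℕ, ∫ m, (m : ℝ) ^ 2 ∂(κ x) ≤ (x : ℝ) ^ 2 + C * x := fun x => by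
      rw [ke_second hmom hmart]; linarith [hC x]
    have hi : Integrable (fun x : ℕ => ∫ m, (m : ℝ) ^ 2 ∂(κ x)) (keMu κ n) := by
      refine hb.mono' .of_discrete (ae_of_all _ fun x => ?_)
      rw [Real.norm_of_nonneg (integral_nonneg fun m => by positivity)]
      exact hle x
    have h2 : Integrable (fun m : ℕ => (m : ℝ) ^ 2) (keMu κ (n + 1)) := by
      have : keMu κ (n + 1) = κ ∘ₘ keMu κ n := rfl
      rw [this, Measure.integrable_comp_iff .of_discrete]
      refine ⟨ae_of_all _ hmom, ?_⟩
      simpa using hi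
    refine ⟨h2, hid _ h2, ?_, ?_⟩
    · rw [keMu_integral _ _ (hid _ h2)]
      simp_rw [hmart]; exact e1
    · rw [keMu_integral _ _ h2]
      refine (integral_mono hi hb hle).trans ?_
      rw [integral_add i2 (i1.const_mul _), integral_const_mul, e1]
      push_cast; linarith

/-- survival probability -/
noncomputable def keP (κ : Kernel ℕ ℕ) (n : ℕ) : ℝ :=
  ∫ x, (if 0 < x then (1 : ℝ) else 0) ∂(keMu κ n)

lemma ke_int_ind {μ : Measure ℕ} [IsFiniteMeasure μ] :
    Integrable (fun x : ℕ => if 0 < x then (1 : ℝ) else 0) μ :=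
  ke_int_bdd 1 _ fun m => by split_ifs <;> simp

lemma ke_int_v {μ : Measure ℕ} [IsFiniteMeasure μ] (l : ℝ) (hl : 0 ≤ l) :
    Integrable (fun m : ℕ => (max (1 - l * m) 0) ^ 2) μ := by
  refine ke_int_bdd 1 _ fun m => ?_
  rw [abs_of_nonneg (by positivity)]
  have : max (1 - l * (m : ℝ)) 0 ≤ 1 :=
    max_le (by nlinarith [show (0:ℝ) ≤ l * m by positivity]) zero_le_one
  exact pow_le_one₀ (le_max_right _ _) this

lemma keP_le (hmom : ∀ n : ℕ, Integrable (fun m : ℕ => (m : ℝ) ^ 2) (κ n))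
    (hmart : ∀ a : ℕ, ∫ m, (m : ℝ) ∂(κ a) = a) (c a : ℝ)
    (hc : ∀ x : ℕ, c * x ≤ ∫ m, (max ((x : ℝ) - m) 0) ^ 2 ∂(κ x))
    (ha : 0 < a) (ha1 : a ≤ 1 / 4) (hac : 4 * a ≤ c) (m n : ℕ) :
    keP κ (n + m) ≤ 1 - ∫ x, (max (1 - 1 / (1 + a * m) * (x : ℝ)) 0) ^ 2 ∂(keMu κ n) := by
  induction m generalizing n with
  | zero =>
    have : ∀ x : ℕ, (if 0 < x then (1 : ℝ) else 0) =
        1 - (max (1 - 1 / (1 + a * (0 : ℕ)) * (x : ℝ)) 0) ^ 2 := by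
      intro x
      rcases Nat.eq_zero_or_pos x with h | h
      · simp [h]
      · have h' : (1 : ℝ) ≤ x := by exact_mod_cast h
        rw [if_pos h, max_eq_right (by simp; linarith)]; simp
    unfold keP
    simp_rw [this]
    rw [integral_sub (integrable_const _) (ke_int_v _ (by simp))]
    simp
  | succ m ih =>
    have h1 := ih (n + 1)
    have e : n + (m + 1) = n + 1 + m := by ring
    rw [e]
    refine h1.trans ?_
    have hd : 0 < 1 + a * (m : ℝ) := by positivity
    have hd2 : 0 < 1 + a * ((m : ℝ) + 1) := by positivity
    rw [keMu_integral _ _ (ke_int_v _ (by positivity))]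
    have h2 : ∫ x, (max (1 - 1 / (1 + a * ((m + 1 : ℕ) : ℝ)) * (x : ℝ)) 0) ^ 2 ∂(keMu κ n) ≤
        ∫ x, (∫ y, (max (1 - 1 / (1 + a * m) * (y : ℝ)) 0) ^ 2 ∂(κ x)) ∂(keMu κ n) := by
      refine integral_mono (ke_int_v _ (by positivity)) ?_ fun x => ?_
      · refine ke_int_bdd 1 _ fun x => ?_
        rw [abs_of_nonneg (integral_nonneg fun y => by positivity)]
        calc _ ≤ ∫ y, (1 : ℝ) ∂(κ x) := by
              refine integral_mono (ke_int_v _ (by positivity)) (integrable_const _) fun y => ?_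
              have : max (1 - 1 / (1 + a * m) * (y : ℝ)) 0 ≤ 1 :=
                max_le (by
                  have : 0 ≤ 1 / (1 + a * m) * (y : ℝ) := by positivity
                  linarith) zero_le_one
              exact pow_le_one₀ (le_max_right _ _) this
          _ = 1 := by simp
      · refine ke_super_step hmom hmart c a hc ha ha1 hac _ _ (by positivity) ?_ ?_ x
        · rw [div_le_one hd]
          have : 0 ≤ a * (m : ℝ) := by positivity
          linarith
        · push_cast
          have e : 1 / (1 + a * ((m : ℝ) + 1)) - (1 / (1 + a * m) - a * (1 / (1 + a * m)) ^ 2)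
            = a ^ 2 / ((1 + a * ((m : ℝ) + 1)) * (1 + a * m) ^ 2) := by
            field_simp; ring
          have : 0 ≤ a ^ 2 / ((1 + a * ((m : ℝ) + 1)) * (1 + a * m) ^ 2) := by positivity
          linarith
    linarith

lemma keP_nonneg (n : ℕ) : 0 ≤ keP κ n :=
  integral_nonneg fun x => by positivity

lemma keP_tendsto (hmom : ∀ n : ℕ, Integrable (fun m : ℕ => (m : ℝ) ^ 2) (κ n))
    (hmart : ∀ a : ℕ, ∫ m, (m : ℝ) ∂(κ a) = a) (c a : ℝ)
    (hc : ∀ x : ℕ, c * x ≤ ∫ m, (max ((x : ℝ) - m) 0) ^ 2 ∂(κ x))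
    (ha : 0 < a) (ha1 : a ≤ 1 / 4) (hac : 4 * a ≤ c) :
    Tendsto (keP κ) atTop (nhds 0) := by
  have hb : ∀ m : ℕ, keP κ m ≤ 2 * (1 / (1 + a * m)) := by
    intro m
    have h := keP_le hmom hmart c a hc ha ha1 hac m 0
    rw [zero_add] at h
    refine h.trans ?_
    simp only [keMu, integral_dirac, Nat.cast_one, mul_one]
    have hd : 0 ≤ 1 / (1 + a * (m : ℝ)) := by positivity
    have h2 : 1 - 1 / (1 + a * (m : ℝ)) ≤ max (1 - 1 / (1 + a * (m : ℝ))) 0 := le_max_left _ _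
    have h1 : 1 / (1 + a * (m : ℝ)) ≤ 1 := by
      rw [div_le_one (by positivity)]
      have : 0 ≤ a * (m : ℝ) := by positivity
      linarith
    nlinarith [sq_nonneg (1 / (1 + a * (m : ℝ)))]
  refine squeeze_zero keP_nonneg hb ?_
  have : Tendsto (fun m : ℕ => 1 + a * (m : ℝ)) atTop atTop :=
    tendsto_atTop_add_const_left _ _ (tendsto_natCast_atTop_atTop.const_mul_atTop ha)
  have h3 := (this.const_div_atTop 1).const_mul 2
  simpa using h3

lemma ke_main_bound {σ : ℝ} (hmom : ∀ n : ℕ, Integrable (fun m : ℕ => (m : ℝ) ^ 2) (κ n))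
    (hmart : ∀ a : ℕ, ∫ m, (m : ℝ) ∂(κ a) = a) (C : ℝ) (hC0 : 0 < C)
    (hC : ∀ x : ℕ, ∫ m, ((m : ℝ) - x) ^ 2 ∂(κ x) ≤ C * x)
    (ε D l0 : ℝ) (hε : 0 < ε) (hD : 0 ≤ D) 
    (herr : ∀ l : ℝ, 0 ≤ l → l ≤ l0 → ∀ x : ℕ,
      |keErr κ σ l x| ≤ l ^ 2 * (ε * x + D * (if 0 < x then 1 else 0) + ε * l * x ^ 2))
    (n : ℕ) (l : ℝ) (hl : 0 ≤ l) (hl0 : l ≤ l0) :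
    |∫ x, Real.exp (-(l * x)) ∂(keMu κ n) - Real.exp (-(l / (1 + σ ^ 2 / 2 * n * l)))| ≤
      ∑ j ∈ Finset.range n, l ^ 2 * (ε + D * keP κ j + ε * l * (1 + C * j)) := by
  induction n generalizing l with
  | zero => simp [keMu]
  | succ n ih =>
    obtain ⟨hq0, hq1, -, -⟩ := ke_lam σ l hl
    set q := l / (1 + σ ^ 2 / 2 * l) with hq
    have hih := ih q hq0 (hq1.trans hl0)
    have e : q / (1 + σ ^ 2 / 2 * n * q) = l / (1 + σ ^ 2 / 2 * (n + 1 : ℕ) * l) := by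
      rw [hq]
      have h1 : 0 < 1 + σ ^ 2 / 2 * l := by positivity
      have h2 : 0 < 1 + σ ^ 2 / 2 * ((n : ℝ) + 1) * l := by positivity
      have h3 : 0 < 1 + σ ^ 2 / 2 * n * (l / (1 + σ ^ 2 / 2 * l)) := by positivity
      push_cast
      rw [div_div]
      congr 1
      rw [mul_add]
      field_simp
      ring
    rw [e] at hih
    obtain ⟨i2, i1, e1, e2⟩ := keMu_moments hmom hmart C hC n
    have hiq : Integrable (fun x : ℕ => Real.exp (-(q * x))) (keMu κ n) := ke_int_exp q hq0
    have hiT : Integrable (fun x : ℕ => ∫ m, Real.exp (-(l * m)) ∂(κ x)) (keMu κ n) := by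
      refine ke_int_bdd 1 _ fun x => ?_
      rw [abs_of_nonneg (integral_nonneg fun y => (Real.exp_pos _).le)]
      calc _ ≤ ∫ y, (1 : ℝ) ∂(κ x) := by
            refine integral_mono (ke_int_exp l hl) (integrable_const _) fun y => ?_
            apply Real.exp_le_one_iff.2
            have : 0 ≤ l * y := by positivity
            linarith
        _ = 1 := by simp
    have hstep : |∫ x, Real.exp (-(l * x)) ∂(keMu κ (n + 1)) - ∫ x, Real.exp (-(q * x)) ∂(keMu κ n)|
        ≤ l ^ 2 * (ε + D * keP κ n + ε * l * (1 + C * n)) := by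
      rw [keMu_integral _ _ (ke_int_exp l hl), ← integral_sub hiT hiq]
      refine abs_integral_le_integral_abs.trans ?_
      have hi4 : Integrable (fun x : ℕ => ε * (x : ℝ) + D * (if 0 < x then 1 else 0)) (keMu κ n) :=
        (i1.const_mul _).add (ke_int_ind.const_mul _)
      have hi3 : Integrable (fun x : ℕ => ε * (x : ℝ) + D * (if 0 < x then 1 else 0)
        + ε * l * (x : ℝ) ^ 2) (keMu κ n) :=
        hi4.add (i2.const_mul _)
      calc _ ≤ ∫ x : ℕ, l ^ 2 * (ε * (x : ℝ) + D * (if 0 < x then 1 else 0)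
            + ε * l * (x : ℝ) ^ 2) ∂(keMu κ n) := by
            refine integral_mono (hiT.sub hiq).abs (hi3.const_mul _) fun x => ?_
            exact herr l hl hl0 x
        _ = l ^ 2 * (ε + D * keP κ n + ε * l * ∫ x, (x : ℝ) ^ 2 ∂(keMu κ n)) := by
            rw [integral_const_mul, integral_add hi4 (i2.const_mul _),
              integral_add (i1.const_mul _) (ke_int_ind.const_mul _), integral_const_mul,
              integral_const_mul, integral_const_mul, e1, mul_one]
            rfl
        _ ≤ _ := by gcongr
    have hmono : ∑ j ∈ Finset.range n, q ^ 2 * (ε + D * keP κ j + ε * q * (1 + C * j)) ≤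
        ∑ j ∈ Finset.range n, l ^ 2 * (ε + D * keP κ j + ε * l * (1 + C * j)) := by
      refine Finset.sum_le_sum fun j _ => ?_
      have := keP_nonneg (κ := κ) j
      gcongr
    rw [Finset.sum_range_succ]
    have := abs_sub_le (∫ x, Real.exp (-(l * x)) ∂(keMu κ (n + 1)))
      (∫ x, Real.exp (-(q * x)) ∂(keMu κ n)) (Real.exp (-(l / (1 + σ ^ 2 / 2 * (n + 1 : ℕ) * l))))
    linarith

lemma ke_main {σ : ℝ} (hσ : 0 < σ) (hmom : ∀ n : ℕ, Integrable (fun m : ℕ => (m : ℝ) ^ 2) (κ n))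
    (hmart : ∀ a : ℕ, ∫ m, (m : ℝ) ∂(κ a) = a)
    (hvar : Tendsto (fun n : ℕ => (∫ m, ((m : ℝ) - n) ^ 2 ∂(κ n)) / n) atTop
      (nhds (σ ^ 2)))
    (hclt : ∀ f : BoundedContinuousFunction ℝ ℝ,
      Tendsto (fun n : ℕ => ∫ m, f (((m : ℝ) - n) / Real.sqrt n) ∂(κ n)) atTop
        (nhds (∫ x, f x ∂(gaussianReal 0 (Real.toNNReal (σ ^ 2))))))
    (hP0 : Tendsto (keP κ) atTop (nhds 0)) (B η : ℝ) (hB : 0 < B) (hη : 0 < η) :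
    ∀ᶠ n : ℕ in atTop, ∀ l : ℝ, 0 ≤ l → l ≤ B / n →
      |∫ x, Real.exp (-(l * x)) ∂(keMu κ n) - Real.exp (-(l / (1 + σ ^ 2 / 2 * n * l)))| ≤ η / n := by
  obtain ⟨C, hC0, hC⟩ := ke_var_upper hmom hmart hvar
  set ε := η / (2 * (B ^ 2 + B ^ 3 * (1 + C))) with hε
  have hεpos : 0 < ε := by positivity
  obtain ⟨D, l0, hD, hl0, herr⟩ := ke_err hmom hmart hvar hclt ε hεpos
  have hces : Tendsto (fun n : ℕ => B ^ 2 * D * ((n : ℝ)⁻¹ * ∑ i ∈ Finset.range n, keP κ i)) atTop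
      (nhds 0) := by simpa using hP0.cesaro.const_mul (B ^ 2 * D)
  filter_upwards [hces.eventually (gt_mem_nhds (show (0 : ℝ) < η / 2 by positivity)),
    eventually_ge_atTop 1, eventually_ge_atTop ⌈B / l0⌉₊] with n h1 h2 h3 l hl hlB
  have hn : (0 : ℝ) < n := by exact_mod_cast h2
  have hn1 : (1 : ℝ) ≤ n := by exact_mod_cast h2
  have hll0 : l ≤ l0 := by
    refine hlB.trans ?_
    rw [div_le_iff₀ hn]
    have : B / l0 ≤ n := (Nat.le_ceil _).trans (by exact_mod_cast h3)
    rw [div_le_iff₀ hl0] at this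
    linarith
  refine (ke_main_bound hmom hmart C hC0 hC ε D l0 hεpos hD herr n l hl hll0).trans ?_
  set S := ∑ i ∈ Finset.range n, keP κ i with hS
  have hS0 : 0 ≤ S := Finset.sum_nonneg fun i _ => keP_nonneg i
  calc ∑ j ∈ Finset.range n, l ^ 2 * (ε + D * keP κ j + ε * l * (1 + C * j))
      ≤ ∑ j ∈ Finset.range n, ((B / n) ^ 2 * D * keP κ j +
        (B / n) ^ 2 * (ε + ε * (B / n) * ((1 + C) * n))) := by
        refine Finset.sum_le_sum fun j hj => ?_
        have hjn : (j : ℝ) ≤ n := by exact_mod_cast (Finset.mem_range.1 hj).le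
        have hp := keP_nonneg (κ := κ) j
        have h5 : 1 + C * (j : ℝ) ≤ (1 + C) * n := by nlinarith
        have h6 : (0 : ℝ) ≤ 1 + C * j := by positivity
        calc l ^ 2 * (ε + D * keP κ j + ε * l * (1 + C * j)) ≤
            (B / n) ^ 2 * (ε + D * keP κ j + ε * (B / n) * ((1 + C) * n)) := by gcongr
          _ = _ := by ring
    _ = (B / n) ^ 2 * D * S + n * ((B / n) ^ 2 * (ε + ε * (B / n) * ((1 + C) * n))) := by
        rw [Finset.sum_add_distrib, ← Finset.mul_sum, ← hS]; simp
    _ = (B ^ 2 * D * ((n : ℝ)⁻¹ * S) + ε * (B ^ 2 + B ^ 3 * (1 + C))) / n := by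
        field_simp
    _ ≤ (η / 2 + η / 2) / n := by
        have : ε * (B ^ 2 + B ^ 3 * (1 + C)) = η / 2 := by rw [hε]; field_simp
        gcongr
        exact this.le
    _ = η / n := by ring

lemma ke_pw (R q x : ℝ) (hR0 : 0 < R) (hq0 : 0 < q) (hx : 0 ≤ x) :
    (1 - Real.exp (-R)) * (1 - (max (1 - q * x) 0) ^ 2) ≤ 1 - Real.exp (-(2 * R * q * x)) := by
  have hER : 0 < 1 - Real.exp (-R) := by
    have : Real.exp (-R) < 1 := Real.exp_lt_one_iff.2 (by linarith)
    linarith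
  obtain ⟨u, hu⟩ : ∃ u, u = 2 * q * x := ⟨_, rfl⟩
  have hu0 : 0 ≤ u := by rw [hu]; positivity
  have e3 : 2 * R * q * x = R * u := by rw [hu]; ring
  rw [e3]
  rcases le_total u 1 with hu1 | hu1
  · have h9 : 1 - (max (1 - q * x) 0) ^ 2 ≤ u := by
      rw [max_eq_left (by linarith)]
      nlinarith [sq_nonneg (q * x)]
    have h10 : Real.exp (-(R * u)) ≤ (1 - u) * 1 + u * Real.exp (-R) := by
      have := convexOn_exp.2 (Set.mem_univ (0 : ℝ)) (Set.mem_univ (-R))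
        (show 0 ≤ 1 - u by linarith) hu0 (by ring)
      simp only [smul_eq_mul, mul_zero, zero_add, Real.exp_zero] at this
      have e4 : -(R * u) = u * -R := by ring
      rw [e4]; exact this
    have h11 := mul_le_mul_of_nonneg_left h9 hER.le
    linarith
  · have h9 : Real.exp (-(R * u)) ≤ Real.exp (-R) := by
      apply Real.exp_le_exp.2; nlinarith
    have h10 : 1 - (max (1 - q * x) 0) ^ 2 ≤ 1 := by linarith [sq_nonneg (max (1 - q * x) 0)]
    have h11 := mul_le_mul_of_nonneg_left h10 hER.le
    linarith

lemma ke_tendsto {σ : ℝ} (hσ : 0 < σ)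
    (hmom : ∀ n : ℕ, Integrable (fun m : ℕ => (m : ℝ) ^ 2) (κ n))
    (hmart : ∀ a : ℕ, ∫ m, (m : ℝ) ∂(κ a) = a)
    (hlb : ∃ s : ℝ, 0 < s ∧ ∀ n : ℕ, 1 ≤ n → s ≤ ∫ m, ((m : ℝ) - n) ^ 2 ∂(κ n))
    (hvar : Tendsto (fun n : ℕ => (∫ m, ((m : ℝ) - n) ^ 2 ∂(κ n)) / n) atTop
      (nhds (σ ^ 2)))
    (hclt : ∀ f : BoundedContinuousFunction ℝ ℝ,
      Tendsto (fun n : ℕ => ∫ m, f (((m : ℝ) - n) / Real.sqrt n) ∂(κ n)) atTop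
        (nhds (∫ x, f x ∂(gaussianReal 0 (Real.toNNReal (σ ^ 2)))))) :
    Tendsto (fun n : ℕ => (n : ℝ) * keP κ n) atTop (nhds (2 / σ ^ 2)) := by
  obtain ⟨c, hc0, hc⟩ := ke_neg_lower hσ hmom hmart hlb hclt
  set a := min (1 / 4) (c / 4) with ha
  have ha0 : 0 < a := by positivity
  have ha1 : a ≤ 1 / 4 := min_le_left _ _
  have hac : 4 * a ≤ c := by linarith [min_le_right (1 / 4) (c / 4)]
  have hP0 := keP_tendsto hmom hmart c a hc ha0 ha1 hac
  have hmain := ke_main hσ hmom hmart hvar hclt hP0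
  have hσ2 : 0 < σ ^ 2 := by positivity
  rw [tendsto_order]
  constructor
  · intro b hb
    have hcont : Tendsto (fun t : ℝ => 1 / (t + σ ^ 2 / 2) - 2 * t) (nhdsWithin 0 (Set.Ioi 0))
        (nhds (2 / σ ^ 2)) := by
      have : ContinuousAt (fun t : ℝ => 1 / (t + σ ^ 2 / 2) - 2 * t) 0 := by
        apply ContinuousAt.sub _ (by fun_prop)
        apply ContinuousAt.div (by fun_prop) (by fun_prop)
        positivity
      have h2 := this.tendsto.mono_left (nhdsWithin_le_nhds (s := Set.Ioi (0 : ℝ)))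
      convert h2 using 2
      field_simp; ring
    obtain ⟨t, htb, ht0⟩ := ((hcont.eventually (lt_mem_nhds hb)).and
      self_mem_nhdsWithin).exists
    have ht0 : 0 < t := ht0
    set θ := 1 / (t + σ ^ 2 / 2) with hθ
    have hθ0 : 0 < θ := by positivity
    filter_upwards [hmain (1 / t) t (by positivity) ht0, eventually_ge_atTop 1,
      eventually_ge_atTop ⌈θ ^ 2 / t⌉₊] with n h1 h2 h3
    have hn : (0 : ℝ) < n := by exact_mod_cast h2
    have h4 := h1 (1 / t / n) (by positivity) le_rfl
    have e : 1 / t / n / (1 + σ ^ 2 / 2 * n * (1 / t / n)) = θ / n := by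
      rw [hθ]; field_simp
    rw [e] at h4
    have h5 : ∫ x, (1 - Real.exp (-(1 / t / n * (x : ℝ)))) ∂(keMu κ n) ≤ keP κ n := by
      refine integral_mono ((integrable_const _).sub (ke_int_exp _ (by positivity))) ke_int_ind
        fun x => ?_
      simp only
      split_ifs with hx
      · linarith [Real.exp_pos (-(1 / t / n * (x : ℝ)))]
      · have : x = 0 := by omega
        simp [this]
    rw [integral_sub (integrable_const _) (ke_int_exp _ (by positivity))] at h5
    simp only [integral_const, probReal_univ, one_smul] at h5
    have h6 : Real.exp (-(θ / n)) ≤ 1 - θ / n + (θ / n) ^ 2 := by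
      have := ke_exp_upper 0 (θ / n) le_rfl (by positivity)
      simp at this
      linarith
    have h7 : θ / n - (θ / n) ^ 2 - t / n ≤ keP κ n := by
      have := (abs_le.1 h4).2
      linarith
    have h8 : θ ^ 2 / n ≤ t := by
      have : θ ^ 2 / t ≤ n := (Nat.le_ceil _).trans (by exact_mod_cast h3)
      rw [div_le_iff₀ ht0] at this
      rw [div_le_iff₀ hn]; linarith
    calc b < θ - 2 * t := htb
      _ ≤ θ - θ ^ 2 / n - t := by linarith
      _ = n * (θ / n - (θ / n) ^ 2 - t / n) := by field_simp
      _ ≤ _ := by gcongr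
  · intro b hb
    have hcont : Tendsto (fun t : ℝ => (2 / σ ^ 2 + t) / ((1 - t) * (1 - Real.exp (-t⁻¹))))
        (nhdsWithin 0 (Set.Ioi 0)) (nhds (2 / σ ^ 2)) := by
      have hid : Tendsto (fun t : ℝ => t) (nhdsWithin 0 (Set.Ioi 0)) (nhds 0) :=
        tendsto_id.mono_left nhdsWithin_le_nhds
      have hexp : Tendsto (fun t : ℝ => Real.exp (-t⁻¹)) (nhdsWithin 0 (Set.Ioi 0)) (nhds 0) :=
        Real.tendsto_exp_neg_atTop_nhds_zero.comp tendsto_inv_nhdsGT_zero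
      have h1 := ((hid.const_add (2 / σ ^ 2)).div ((hid.const_sub 1).mul (hexp.const_sub 1))
        (by norm_num))
      simp only [add_zero, sub_zero, mul_one, div_one] at h1
      exact h1
    have hlt1 : ∀ᶠ t : ℝ in nhdsWithin 0 (Set.Ioi 0), t < 1 :=
      nhdsWithin_le_nhds (gt_mem_nhds one_pos)
    obtain ⟨t, ⟨htb, ht1⟩, ht0⟩ := (((hcont.eventually (gt_mem_nhds hb)).and hlt1).and
      self_mem_nhdsWithin).exists
    have ht0 : 0 < t := ht0
    set R := t⁻¹ with hR
    have hR0 : 0 < R := by positivity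
    have hER : 0 < 1 - Real.exp (-R) := by
      have : Real.exp (-R) < 1 := Real.exp_lt_one_iff.2 (by linarith)
      linarith
    obtain ⟨N1, hN1⟩ := eventually_atTop.1
      (hmain (2 * R / (a * t)) t (by positivity) ht0)
    filter_upwards [eventually_ge_atTop 1, eventually_ge_atTop ⌈N1 / (1 - t)⌉₊] with N h1 h2
    have hN : (0 : ℝ) < N := by exact_mod_cast h1
    have h1t : 0 < 1 - t := by linarith
    set m := ⌊t * N⌋₊ with hm
    have hmle : (m : ℝ) ≤ t * N := Nat.floor_le (by positivity)
    have hmlt : t * N < m + 1 := Nat.lt_floor_add_one _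
    have hmN : m ≤ N := by
      have : (m : ℝ) ≤ N := hmle.trans (by nlinarith)
      exact_mod_cast this
    obtain ⟨n, hn⟩ : ∃ n, N = n + m := ⟨N - m, by omega⟩
    have hnN : (N : ℝ) = n + m := by exact_mod_cast hn
    have hnge : (1 - t) * N ≤ n := by nlinarith
    have hn0 : (0 : ℝ) < n := lt_of_lt_of_le (by positivity) hnge
    have hnN1 : N1 ≤ n := by
      have : (N1 : ℝ) / (1 - t) ≤ N := (Nat.le_ceil _).trans (by exact_mod_cast h2)
      rw [div_le_iff₀ h1t] at this
      have : (N1 : ℝ) ≤ n := by linarith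
      exact_mod_cast this
    set q := 1 / (1 + a * (m : ℝ)) with hq
    have hq0 : 0 < q := by positivity
    set l := 2 * R * q with hl
    have hl0 : 0 < l := by positivity
    have hlB : l ≤ 2 * R / (a * t) / n := by
      rw [hl, hq, div_div, mul_one_div]
      gcongr
      have : a * t * n ≤ a * (t * N) := by
        rw [mul_assoc]; gcongr; linarith [show (0 : ℝ) ≤ m by positivity]
      nlinarith
    have h4 := (abs_le.1 (hN1 n hnN1 l hl0.le hlB)).1
    have h5 : 1 - l / (1 + σ ^ 2 / 2 * n * l) ≤ Real.exp (-(l / (1 + σ ^ 2 / 2 * n * l))) := by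
      have := Real.add_one_le_exp (-(l / (1 + σ ^ 2 / 2 * n * l)))
      linarith
    have h6 : l / (1 + σ ^ 2 / 2 * n * l) ≤ 2 / σ ^ 2 / n := by
      rw [div_div, div_le_div_iff₀ (by positivity) (by positivity)]
      nlinarith
    have h7 := keP_le hmom hmart c a hc ha0 ha1 hac m n
    rw [← hn, ← hq] at h7
    have h8 : (1 - Real.exp (-R)) * (1 - ∫ x, (max (1 - q * (x : ℝ)) 0) ^ 2 ∂(keMu κ n)) ≤
        1 - ∫ x, Real.exp (-(l * (x : ℝ))) ∂(keMu κ n) := by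
      have e1 : 1 - ∫ x, (max (1 - q * (x : ℝ)) 0) ^ 2 ∂(keMu κ n) =
          ∫ x, (1 - (max (1 - q * (x : ℝ)) 0) ^ 2) ∂(keMu κ n) := by
        rw [integral_sub (integrable_const _) (ke_int_v _ hq0.le)]; simp
      have e2 : 1 - ∫ x, Real.exp (-(l * (x : ℝ))) ∂(keMu κ n) =
          ∫ x, (1 - Real.exp (-(l * (x : ℝ)))) ∂(keMu κ n) := by
        rw [integral_sub (integrable_const _) (ke_int_exp _ hl0.le)]; simp
      rw [e1, e2, ← integral_const_mul]
      refine integral_mono (((integrable_const _).sub (ke_int_v _ hq0.le)).const_mul _)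
        ((integrable_const _).sub (ke_int_exp _ hl0.le)) fun x => ?_
      simp only
      exact ke_pw R q x hR0 hq0 (by positivity)
    have h9 : (1 - Real.exp (-R)) * keP κ N ≤ (2 / σ ^ 2 + t) / n := by
      have : (1 - Real.exp (-R)) * keP κ N ≤
        (1 - Real.exp (-R)) * (1 - ∫ x, (max (1 - q * (x : ℝ)) 0) ^ 2 ∂(keMu κ n)) := by gcongr
      rw [add_div]
      linarith
    refine lt_of_le_of_lt ?_ htb
    rw [le_div_iff₀ (by positivity)]
    rw [le_div_iff₀ hn0] at h9
    have hp := keP_nonneg (κ := κ) N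
    calc N * keP κ N * ((1 - t) * (1 - Real.exp (-R)))
        = (1 - Real.exp (-R)) * keP κ N * ((1 - t) * N) := by ring
      _ ≤ (1 - Real.exp (-R)) * keP κ N * n := by gcongr
      _ ≤ _ := h9

end chain

section link
set_option linter.unusedSectionVars false
variable {κ : Kernel ℕ ℕ} [IsMarkovKernel κ] {P : Measure (ℕ → ℕ)} [IsProbabilityMeasure P]

lemma ke_meas (k c : ℕ) : MeasurableSet {ω : ℕ → ℕ | ω k = c} :=
  measurableSet_eq_fun (measurable_pi_apply k) measurable_const

lemma ke_decomp (n : ℕ) (S : Set (ℕ → ℕ)) (hS : MeasurableSet S) :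
    P S = ∑' y : Fin (n + 1) → ℕ, P ({ω | ∀ i : Fin (n + 1), ω i.val = y i} ∩ S) := by
  rw [← measure_iUnion]
  · congr 1
    ext ω
    simp only [Set.mem_iUnion, Set.mem_inter_iff, Set.mem_setOf_eq]
    constructor
    · intro h
      exact ⟨fun i => ω i.val, fun i => rfl, h⟩
    · rintro ⟨y, -, h⟩; exact h
  · intro y z hyz
    rw [Function.onFun, Set.disjoint_left]
    rintro ω ⟨h1, -⟩ ⟨h2, -⟩
    exact hyz (funext fun i => (h1 i).symm.trans (h2 i))
  · intro y
    refine MeasurableSet.inter ?_ hS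
    rw [Set.setOf_forall]
    exact MeasurableSet.iInter fun i => ke_meas i.val (y i)

lemma ke_joint {x : ℕ} (hP : IsChainLaw κ x P) (n a b : ℕ) :
    P {ω | ω n = a ∧ ω (n + 1) = b} = P {ω | ω n = a} * κ a {b} := by
  have m1 : ∀ k c : ℕ, MeasurableSet {ω : ℕ → ℕ | ω k = c} := ke_meas
  rw [ke_decomp n {ω | ω n = a ∧ ω (n + 1) = b} ((m1 n a).inter (m1 (n + 1) b)),
    ke_decomp n {ω | ω n = a} (m1 n a), ← ENNReal.tsum_mul_right]
  refine tsum_congr fun y => ?_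
  by_cases hy : y (Fin.last n) = a
  · have e1 : {ω : ℕ → ℕ | ∀ i : Fin (n + 1), ω i.val = y i} ∩ {ω | ω n = a} =
        {ω | ∀ i : Fin (n + 1), ω i.val = y i} := by
      ext ω
      simp only [Set.mem_inter_iff, Set.mem_setOf_eq, and_iff_left_iff_imp]
      intro h
      rw [← hy, ← h (Fin.last n)]; rfl
    have e2 : {ω : ℕ → ℕ | ∀ i : Fin (n + 1), ω i.val = y i} ∩ {ω | ω n = a ∧ ω (n + 1) = b} =
        {ω | ∀ i : Fin (n + 1 + 1), ω i.val = (Fin.snoc y b : Fin (n + 1 + 1) → ℕ) i} := by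
      ext ω
      simp only [Set.mem_inter_iff, Set.mem_setOf_eq]
      constructor
      · rintro ⟨h1, h2, h3⟩ i
        refine Fin.lastCases ?_ (fun j => ?_) i
        · simpa using h3
        · simpa using h1 j
      · intro h
        have h1 : ∀ i : Fin (n + 1), ω i.val = y i := fun i => by
          simpa using h i.castSucc
        refine ⟨h1, ?_, ?_⟩
        · rw [← hy, ← h1 (Fin.last n)]; rfl
        · simpa using h (Fin.last (n + 1))
    rw [e1, e2, hP, hP, Fin.prod_univ_castSucc]
    have e3 : (Fin.snoc y b : Fin (n + 1 + 1) → ℕ) 0 = y 0 := by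
      have : (0 : Fin (n + 1 + 1)) = Fin.castSucc 0 := rfl
      rw [this, Fin.snoc_castSucc]
    rw [e3]
    simp only [Fin.succ_castSucc, Fin.snoc_castSucc, Fin.succ_last, Fin.snoc_last, hy]
    rw [mul_assoc]
  · have e1 : {ω : ℕ → ℕ | ∀ i : Fin (n + 1), ω i.val = y i} ∩ {ω | ω n = a} = ∅ := by
      ext ω
      simp only [Set.mem_inter_iff, Set.mem_setOf_eq, Set.mem_empty_iff_false, iff_false, not_and]
      intro h h2
      exact hy ((h (Fin.last n)).symm.trans h2)
    have e2 : {ω : ℕ → ℕ | ∀ i : Fin (n + 1), ω i.val = y i} ∩ {ω | ω n = a ∧ ω (n + 1) = b} = ∅ :=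
      Set.subset_empty_iff.1 (e1 ▸ Set.inter_subset_inter_right _ fun ω h => h.1)
    rw [e1, e2]; simp

lemma ke_law (hP : IsChainLaw κ 1 P) (n : ℕ) : P.map (fun ω => ω n) = keMu κ n := by
  have m1 : ∀ k c : ℕ, MeasurableSet {ω : ℕ → ℕ | ω k = c} := ke_meas
  have mapk : ∀ k c : ℕ, (P.map (fun ω => ω k)) {c} = P {ω | ω k = c} := fun k c => by
    rw [Measure.map_apply (measurable_pi_apply k) (measurableSet_singleton c)]; rfl
  induction n with
  | zero =>
    refine Measure.ext_of_singleton fun c => ?_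
    rw [mapk]
    have h := hP 0 (fun _ => c)
    have e : {ω : ℕ → ℕ | ∀ i : Fin (0 + 1), ω i.val = c} = {ω | ω 0 = c} := by
      ext ω; simp
    rw [e] at h
    rw [h]
    simp only [keMu, Finset.univ_eq_empty, Finset.prod_empty, mul_one]
    rw [Measure.dirac_apply' _ (measurableSet_singleton c)]
    by_cases hc : c = 1
    · simp [hc]
    · simp [hc, Ne.symm hc]
  | succ n ih =>
    refine Measure.ext_of_singleton fun b => ?_
    rw [mapk]
    have : keMu κ (n + 1) = κ ∘ₘ keMu κ n := rfl
    rw [this, Measure.bind_apply (measurableSet_singleton b) κ.measurable.aemeasurable,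
      lintegral_countable', ← ih]
    have e : {ω : ℕ → ℕ | ω (n + 1) = b} = ⋃ a : ℕ, {ω | ω n = a ∧ ω (n + 1) = b} := by
      ext ω; simp
    rw [e, measure_iUnion]
    · refine tsum_congr fun a => ?_
      rw [ke_joint hP, mapk, mul_comm]
    · intro y z hyz
      rw [Function.onFun, Set.disjoint_left]
      rintro ω ⟨h1, -⟩ ⟨h2, -⟩
      exact hyz (h1.symm.trans h2)
    · intro a
      exact (m1 n a).inter (m1 (n + 1) b)

lemma ke_absorb (hmom : ∀ n : ℕ, Integrable (fun m : ℕ => (m : ℝ) ^ 2) (κ n))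
    (hmart : ∀ a : ℕ, ∫ m, (m : ℝ) ∂(κ a) = a) (hP : IsChainLaw κ 1 P) :
    ∀ᵐ ω ∂P, ∀ k, ω k = 0 → ω (k + 1) = 0 := by
  rw [ae_all_iff]
  intro k
  have h : ∀ b : ℕ, ∀ᵐ ω ∂P, ¬ (ω k = 0 ∧ ω (k + 1) = b + 1) := by
    intro b
    rw [ae_iff]
    simp only [not_not]
    rw [ke_joint hP]
    have : κ 0 {b + 1} = 0 := by
      have := ke_zero_ae hmom hmart
      rw [ae_iff] at this
      exact measure_mono_null (by intro m hm; simp at hm ⊢; omega) this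
    rw [this, mul_zero]
  filter_upwards [ae_all_iff.2 h] with ω hω h0
  by_contra hc
  exact hω (ω (k + 1) - 1) ⟨h0, by omega⟩

lemma ke_event (hmom : ∀ n : ℕ, Integrable (fun m : ℕ => (m : ℝ) ^ 2) (κ n))
    (hmart : ∀ a : ℕ, ∫ m, (m : ℝ) ∂(κ a) = a) (hP : IsChainLaw κ 1 P) (n : ℕ) (hn : 1 ≤ n) :
    (P {ω | ∀ k : ℕ, 1 ≤ k → k ≤ n → 0 < ω k}).toReal = keP κ n := by
  have h1 : P {ω | ∀ k : ℕ, 1 ≤ k → k ≤ n → 0 < ω k} = P {ω | 0 < ω n} := by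
    apply measure_congr
    filter_upwards [ke_absorb hmom hmart hP] with ω hω
    apply propext
    change (∀ k : ℕ, 1 ≤ k → k ≤ n → 0 < ω k) ↔ 0 < ω n
    constructor
    · intro h; exact h n hn le_rfl
    · intro h k _ hk
      by_contra hc
      have hz : ∀ j, ω (k + j) = 0 := by
        intro j
        induction j with
        | zero => simp; omega
        | succ j ih => exact hω _ ih
      have := hz (n - k)
      rw [Nat.add_sub_cancel' hk] at this
      omega
  rw [h1]
  unfold keP
  have e : (fun x : ℕ => if 0 < x then (1 : ℝ) else 0) = Set.indicator {x : ℕ | 0 < x} 1 := by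
    funext x; simp [Set.indicator]
  rw [e, integral_indicator_one (MeasurableSet.of_discrete), Measure.real, ← ke_law hP,
    Measure.map_apply (measurable_pi_apply n) MeasurableSet.of_discrete]
  rfl

end link


/-- Kolmogorov-type estimate: for the chain started at `1`,
`n · P₁(A_k > 0 for all 1 ≤ k ≤ n) → 2/σ²`, i.e. `P₁(τ₀ > n) ~ 2/(σ² n)`. -/
theorem kolmogorov_estimate
    (σ : ℝ) (hσ : 0 < σ) (κ : Kernel ℕ ℕ) [IsMarkovKernel κ]
    -- finite second moments
    (hmom : ∀ n : ℕ, Integrable (fun m : ℕ => (m : ℝ) ^ 2) (κ n))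
    -- martingale property
    (hmart : ∀ a : ℕ, ∫ m, (m : ℝ) ∂(κ a) = a)
    -- variance lower bound
    (hlb : ∃ s : ℝ, 0 < s ∧ ∀ n : ℕ, 1 ≤ n → s ≤ ∫ m, ((m : ℝ) - n) ^ 2 ∂(κ n))
    -- variance asymptotics
    (hvar : Tendsto (fun n : ℕ => (∫ m, ((m : ℝ) - n) ^ 2 ∂(κ n)) / n) atTop
      (nhds (σ ^ 2)))
    -- one-step CLT
    (hclt : ∀ f : BoundedContinuousFunction ℝ ℝ,
      Tendsto (fun n : ℕ => ∫ m, f (((m : ℝ) - n) / Real.sqrt n) ∂(κ n)) atTop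
        (nhds (∫ x, f x ∂(gaussianReal 0 (Real.toNNReal (σ ^ 2))))))
    (P : Measure (ℕ → ℕ)) [IsProbabilityMeasure P] (hP : IsChainLaw κ 1 P) :
    Tendsto (fun n : ℕ =>
        (n : ℝ) * (P {ω | ∀ k : ℕ, 1 ≤ k → k ≤ n → 0 < ω k}).toReal) atTop
      (nhds (2 / σ ^ 2)) := by
  refine (ke_tendsto hσ hmom hmart hlb hvar hclt).congr' ?_
  filter_upwards [eventually_ge_atTop 1] with n hn
  rw [ke_event hmom hmart hP n hn]
end
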